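/- The box limit defining F(2,2) exists and (256/(9π²))·F(2,2) = ∫_{√2−1}^1 (3u−1)/√(u(1−u)) · ₂F₁(1/2,1/2;1;1−u²) du, where the integral is over the real interval [√2−1, 1]. -/

import Mathlib

open Real Filter Topology

/-- The partial "box" sum appearing in the definition of the lattice sum `F(a,b,c,d)`. -/
noncomputable def boxSum (a b c d : ℝ) (v : ℕ) : ℝ :=
  ∑ n₁ ∈ Finset.Icc (-(v:ℤ)) (v:ℤ), ∑ n₂ ∈ Finset.Icc (-(v:ℤ)) (v:ℤ),
    ∑ n₃ ∈ Finset.Icc (-(v:ℤ)) (v:ℤ), ∑ n₄ ∈ Finset.Icc (-(v:ℤ)) (v:ℤ),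
      (-1:ℝ)^(n₁+n₂+n₃+n₄) /
        (a*((6*n₁+1:ℤ):ℝ)^2 + b*((6*n₂+1:ℤ):ℝ)^2 + c*((6*n₃+1:ℤ):ℝ)^2 + d*((6*n₄+1:ℤ):ℝ)^2)^2

/-- The Pochhammer symbol `(a)_n`. -/
noncomputable def poch (a : ℝ) (n : ℕ) : ℝ := ∏ i ∈ Finset.range n, (a + i)

/-- The Gauss hypergeometric function `₂F₁(1/2,1/2;1;z)`. -/
noncomputable def hyp2F1half (z : ℝ) : ℝ :=
  ∑' n : ℕ, (poch (1/2) n / (n.factorial : ℝ))^2 * z^n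

theorem summable_int_pow_mul_exp_neg (k : ℕ) {x : ℝ} (hx : 0 < x) :
    Summable fun n : ℤ => |(n : ℝ)| ^ k * exp (-x * |(n : ℝ)|) := by
  have h := Real.summable_pow_mul_exp_neg_nat_mul k hx
  refine Summable.of_nat_of_neg ?_ ?_ <;> simpa using h

theorem exp_neg_sq_le (x c : ℝ) (hx : 0 < x) (n : ℤ) :
    exp (-(n + c) ^ 2 * x) ≤ exp (x * (|c| + 1 / 4)) * exp (-x * |(n : ℝ)|) := by
  rw [← Real.exp_add, Real.exp_le_exp]
  have h1 : |(n : ℝ)| ≤ |n + c| + |c| := by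
    have := abs_sub ((n : ℝ) + c) c
    simpa using this
  have h2 : |n + c| ≤ (n + c) ^ 2 + 1 / 4 := by
    rw [← sq_abs ((n : ℝ) + c)]
    nlinarith [sq_nonneg (|n + c| - 1 / 2)]
  nlinarith

theorem summable_pow_mul_exp_neg_sq (k : ℕ) (c : ℝ) {x : ℝ} (hx : 0 < x) :
    Summable fun n : ℤ => |(n : ℝ)| ^ k * exp (-(n + c) ^ 2 * x) := by
  refine Summable.of_nonneg_of_le (fun n => by positivity) (fun n => ?_)
    ((summable_int_pow_mul_exp_neg k hx).mul_left (exp (x * (|c| + 1 / 4))))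
  calc |(n : ℝ)| ^ k * exp (-(n + c) ^ 2 * x)
      ≤ |(n : ℝ)| ^ k * (exp (x * (|c| + 1 / 4)) * exp (-x * |(n : ℝ)|)) := by
        gcongr; exact exp_neg_sq_le x c hx n
    _ = _ := by ring

/-- The Jacobi theta constant `θ₂` at the nome `exp (-x)`. -/
noncomputable def theta2 (x : ℝ) : ℝ := ∑' n : ℤ, exp (-((n : ℝ) + 1 / 2) ^ 2 * x)

/-- The Jacobi theta constant `θ₃` at the nome `exp (-x)`. -/
noncomputable def theta3 (x : ℝ) : ℝ := ∑' n : ℤ, exp (-(n : ℝ) ^ 2 * x)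

/-- The Jacobi theta constant `θ₄` at the nome `exp (-x)`. -/
noncomputable def theta4 (x : ℝ) : ℝ := ∑' n : ℤ, (-1 : ℝ) ^ n * exp (-(n : ℝ) ^ 2 * x)

theorem summable_theta2 {x : ℝ} (hx : 0 < x) :
    Summable fun n : ℤ => exp (-((n : ℝ) + 1 / 2) ^ 2 * x) := by
  simpa using summable_pow_mul_exp_neg_sq 0 (1 / 2) hx

theorem summable_sq_mul_theta3 {x : ℝ} (k : ℕ) (hx : 0 < x) :
    Summable fun n : ℤ => |(n : ℝ)| ^ k * exp (-(n : ℝ) ^ 2 * x) := by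
  simpa using summable_pow_mul_exp_neg_sq k 0 hx

theorem summable_theta3 {x : ℝ} (hx : 0 < x) :
    Summable fun n : ℤ => exp (-(n : ℝ) ^ 2 * x) := by
  simpa using summable_pow_mul_exp_neg_sq 0 0 hx

theorem summable_theta4 {x : ℝ} (hx : 0 < x) :
    Summable fun n : ℤ => (-1 : ℝ) ^ n * exp (-(n : ℝ) ^ 2 * x) := by
  refine Summable.of_norm ?_
  simpa [abs_neg_one_zpow] using summable_theta3 hx

/-- Splitting a sum over `ℤ × ℤ` according to the parity of the sum of the coordinates. -/
theorem tsum_int_prod_parity {F : ℤ × ℤ → ℝ} (hF : Summable F) :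
    ∑' p, F p = (∑' p : ℤ × ℤ, F (p.1 + p.2, p.1 - p.2)) +
      ∑' p : ℤ × ℤ, F (p.1 + p.2 + 1, p.1 - p.2) := by
  have i0 : Function.Injective (fun p : ℤ × ℤ => (p.1 + p.2, p.1 - p.2)) := by
    rintro ⟨a, b⟩ ⟨c, d⟩ h
    simp only [Prod.mk.injEq] at h ⊢
    omega
  have i1 : Function.Injective (fun p : ℤ × ℤ => (p.1 + p.2 + 1, p.1 - p.2)) := by
    rintro ⟨a, b⟩ ⟨c, d⟩ h
    simp only [Prod.mk.injEq] at h ⊢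
    omega
  have hc : IsCompl (Set.range (fun p : ℤ × ℤ => (p.1 + p.2, p.1 - p.2)))
      (Set.range (fun p : ℤ × ℤ => (p.1 + p.2 + 1, p.1 - p.2))) := by
    rw [isCompl_iff, Set.disjoint_left, codisjoint_iff]
    refine ⟨?_, Set.eq_univ_iff_forall.2 ?_⟩
    · rintro ⟨m, n⟩ ⟨⟨a, b⟩, h⟩ ⟨⟨c, d⟩, h'⟩
      simp only [Prod.mk.injEq] at h h'
      omega
    · rintro ⟨m, n⟩
      simp only [Set.sup_eq_union, Set.mem_union, Set.mem_range, Prod.exists, Prod.mk.injEq]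
      rcases Int.even_or_odd' (m + n) with ⟨k, hk | hk⟩
      · exact Or.inl ⟨k, m - k, by omega, by omega⟩
      · exact Or.inr ⟨k, m - k - 1, by omega, by omega⟩
  have h0 := (i0.hasSum_range_iff (f := F)).2 (hF.comp_injective i0).hasSum
  have h1 := (i1.hasSum_range_iff (f := F)).2 (hF.comp_injective i1).hasSum
  exact (h0.add_isCompl hc h1).tsum_eq

theorem tsum_mul_tsum_int {f g : ℤ → ℝ} (hf : Summable f) (hg : Summable g) :
    (∑' n, f n) * ∑' n, g n = ∑' p : ℤ × ℤ, f p.1 * g p.2 :=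
  tsum_mul_tsum_of_summable_norm hf.norm hg.norm

theorem tsum_mul_tsum_int_parity {f g : ℤ → ℝ} (hf : Summable f) (hg : Summable g) :
    (∑' n, f n) * ∑' n, g n = (∑' p : ℤ × ℤ, f (p.1 + p.2) * g (p.1 - p.2)) +
      ∑' p : ℤ × ℤ, f (p.1 + p.2 + 1) * g (p.1 - p.2) := by
  rw [tsum_mul_tsum_int hf hg]
  exact tsum_int_prod_parity (F := fun p => f p.1 * g p.2)
    (summable_mul_of_summable_norm hf.norm hg.norm)

theorem theta3_sq {x : ℝ} (hx : 0 < x) :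
    theta3 x ^ 2 = theta3 (2 * x) ^ 2 + theta2 (2 * x) ^ 2 := by
  have h2 : 0 < 2 * x := by positivity
  have h := tsum_mul_tsum_int_parity (summable_theta3 hx) (summable_theta3 hx)
  have e3 := tsum_mul_tsum_int (summable_theta3 h2) (summable_theta3 h2)
  have e2 := tsum_mul_tsum_int (summable_theta2 h2) (summable_theta2 h2)
  rw [theta3, theta3, theta2, sq, sq, sq, h, e3, e2]
  congr 1 <;>
  · refine tsum_congr fun p => ?_
    simp only [← Real.exp_add]
    congr 1
    push_cast
    ring

theorem neg_one_zpow_add_mul_sub (a b : ℤ) : (-1 : ℝ) ^ (a + b) * (-1 : ℝ) ^ (a - b) = 1 := by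
  rw [← zpow_add₀ (by norm_num), show a + b + (a - b) = 2 * a by ring, zpow_mul]
  norm_num

theorem theta4_sq {x : ℝ} (hx : 0 < x) :
    theta4 x ^ 2 = theta3 (2 * x) ^ 2 - theta2 (2 * x) ^ 2 := by
  have h2 : 0 < 2 * x := by positivity
  have h := tsum_mul_tsum_int_parity (summable_theta4 hx) (summable_theta4 hx)
  have e3 := tsum_mul_tsum_int (summable_theta3 h2) (summable_theta3 h2)
  have e2 := tsum_mul_tsum_int (summable_theta2 h2) (summable_theta2 h2)
  rw [theta3, theta4, theta2, sq, sq, sq, h, e3, e2, sub_eq_add_neg, ← tsum_neg]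
  congr 1
  · refine tsum_congr fun p => ?_
    rw [mul_mul_mul_comm, neg_one_zpow_add_mul_sub, one_mul, ← Real.exp_add, ← Real.exp_add]
    congr 1
    push_cast
    ring
  · refine tsum_congr fun p => ?_
    rw [mul_mul_mul_comm, zpow_add_one₀ (by norm_num), mul_neg_one, neg_mul,
      neg_one_zpow_add_mul_sub, neg_one_mul, ← Real.exp_add, ← Real.exp_add]
    congr 2
    push_cast
    ring

theorem theta2_sq {x : ℝ} (hx : 0 < x) :
    theta2 x ^ 2 = 2 * theta2 (2 * x) * theta3 (2 * x) := by
  have h2 : 0 < 2 * x := by positivity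
  have h := tsum_mul_tsum_int_parity (summable_theta2 hx) (summable_theta2 hx)
  have s3 : Summable fun n : ℤ => exp (-((n + 1 : ℤ) : ℝ) ^ 2 * (2 * x)) :=
    (Equiv.addRight (1 : ℤ)).summable_iff.2 (summable_theta3 h2)
  have t3 : ∑' n : ℤ, exp (-((n + 1 : ℤ) : ℝ) ^ 2 * (2 * x)) = theta3 (2 * x) :=
    (Equiv.addRight (1 : ℤ)).tsum_eq fun n : ℤ => exp (-(n : ℝ) ^ 2 * (2 * x))
  have e3 := tsum_mul_tsum_int (summable_theta2 h2) (summable_theta3 h2)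
  have e2 := tsum_mul_tsum_int s3 (summable_theta2 h2)
  have : 2 * theta2 (2 * x) * theta3 (2 * x) =
      theta2 (2 * x) * theta3 (2 * x) + theta3 (2 * x) * theta2 (2 * x) := by ring
  rw [this]
  nth_rewrite 2 [← t3]
  rw [theta2, theta2, theta3, sq, h, e3, e2]
  congr 1 <;>
  · refine tsum_congr fun p => ?_
    simp only [← Real.exp_add]
    congr 1
    push_cast
    ring

theorem tsum_neg_one_zpow_theta2 {x : ℝ} :
    ∑' n : ℤ, (-1 : ℝ) ^ n * exp (-((n : ℝ) + 1 / 2) ^ 2 * x) = 0 := by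
  set f : ℤ → ℝ := fun n => (-1 : ℝ) ^ n * exp (-((n : ℝ) + 1 / 2) ^ 2 * x)
  have h := (Equiv.subLeft (-1 : ℤ)).tsum_eq f
  have : ∀ n, f (Equiv.subLeft (-1 : ℤ) n) = -f n := by
    intro n
    have e : (-1 : ℝ) ^ (-1 - n) = -(-1) ^ n := by
      rw [zpow_sub₀ (by norm_num)]
      rcases Int.even_or_odd n with h | h <;> simp [h.neg_one_zpow]
    simp only [f, Equiv.subLeft_apply, e, neg_mul]
    congr 3
    push_cast
    ring
  rw [tsum_congr this, tsum_neg] at h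
  linarith

theorem theta3_mul_theta4 {x : ℝ} (hx : 0 < x) : theta3 x * theta4 x = theta4 (2 * x) ^ 2 := by
  have h2 : 0 < 2 * x := by positivity
  have h := tsum_mul_tsum_int_parity (summable_theta4 hx) (summable_theta3 hx)
  have e3 := tsum_mul_tsum_int (summable_theta4 h2) (summable_theta4 h2)
  have s2 : Summable fun n : ℤ => (-1 : ℝ) ^ n * exp (-((n : ℝ) + 1 / 2) ^ 2 * (2 * x)) :=
    Summable.of_norm (by simpa using summable_theta2 h2)
  have e2 := tsum_mul_tsum_int s2 s2
  rw [tsum_neg_one_zpow_theta2, mul_zero] at e2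
  rw [mul_comm, theta3, theta4, theta4, sq, h, e3]
  have : ∑' p : ℤ × ℤ, ((-1 : ℝ) ^ (p.1 + p.2 + 1) * exp (-((p.1 + p.2 + 1 : ℤ) : ℝ) ^ 2 * x)) *
      exp (-((p.1 - p.2 : ℤ) : ℝ) ^ 2 * x) = 0 := by
    rw [← neg_eq_zero, e2, ← tsum_neg]
    refine tsum_congr fun p => ?_
    rw [zpow_add_one₀ (by norm_num), zpow_add₀ (by norm_num), mul_neg_one, neg_mul, neg_mul,
      neg_neg, mul_mul_mul_comm, mul_assoc, ← Real.exp_add, ← Real.exp_add]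
    congr 2
    push_cast
    ring
  rw [this, add_zero]
  refine tsum_congr fun p => ?_
  rw [zpow_add₀ (by norm_num), mul_mul_mul_comm, mul_assoc, ← Real.exp_add, ← Real.exp_add]
  congr 2
  push_cast
  ring

theorem hasDerivAt_tsum_theta {ε : ℤ → ℝ} (hε : ∀ n, |ε n| ≤ 1) {x : ℝ} (hx : 0 < x) :
    HasDerivAt (fun y => ∑' n : ℤ, ε n * exp (-(n : ℝ) ^ 2 * y))
      (-∑' n : ℤ, (n : ℝ) ^ 2 * (ε n * exp (-(n : ℝ) ^ 2 * x))) x := by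
  rw [← tsum_neg]
  have h2 : 0 < x / 2 := by positivity
  refine hasDerivAt_tsum_of_isPreconnected (t := Set.Ioi (x / 2))
    (g := fun (n : ℤ) (y : ℝ) => ε n * exp (-(n : ℝ) ^ 2 * y))
    (g' := fun (n : ℤ) (y : ℝ) => -((n : ℝ) ^ 2 * (ε n * exp (-(n : ℝ) ^ 2 * y))))
    (summable_sq_mul_theta3 2 h2) isOpen_Ioi isPreconnected_Ioi (fun n y _ => ?_)
    (fun n y hy => ?_) (y₀ := x) (by simp; linarith) ?_ (by simp; linarith)
  · have := ((((hasDerivAt_id y).const_mul (-(n : ℝ) ^ 2)).exp).const_mul (ε n))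
    refine this.congr_deriv ?_
    simp only [id]
    ring
  · rw [norm_neg, Real.norm_eq_abs, abs_mul, abs_mul, sq_abs, abs_pow, sq_abs, Real.abs_exp]
    rw [Set.mem_Ioi] at hy
    have : exp (-(n : ℝ) ^ 2 * y) ≤ exp (-(n : ℝ) ^ 2 * (x / 2)) := by
      rw [Real.exp_le_exp]
      nlinarith [sq_nonneg (n : ℝ)]
    calc (n : ℝ) ^ 2 * (|ε n| * exp (-(n : ℝ) ^ 2 * y))
        ≤ (n : ℝ) ^ 2 * (1 * exp (-(n : ℝ) ^ 2 * (x / 2))) := by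
          gcongr
          exact hε n
      _ = _ := by rw [one_mul]
  · refine Summable.of_norm_bounded (summable_theta3 hx) fun n => ?_
    rw [Real.norm_eq_abs, abs_mul, Real.abs_exp]
    exact mul_le_of_le_one_left (exp_pos _).le (hε n)

theorem tendsto_tsum_theta {ε : ℤ → ℝ} (hε : ∀ n, |ε n| ≤ 1) :
    Tendsto (fun y => ∑' n : ℤ, ε n * exp (-(n : ℝ) ^ 2 * y)) atTop (𝓝 (ε 0)) := by
  have key := tendsto_tsum_of_dominated_convergence (𝓕 := atTop)
    (f := fun (y : ℝ) (n : ℤ) => ε n * exp (-(n : ℝ) ^ 2 * y))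
    (g := fun n : ℤ => if n = 0 then ε 0 else 0)
    (bound := fun n : ℤ => exp (-(n : ℝ) ^ 2 * 1)) (summable_theta3 one_pos) (fun n => ?_) ?_
  · simpa using key
  · by_cases hn : n = 0
    · simp [hn]
    · simp only [hn, if_false]
      rw [← mul_zero (ε n)]
      refine (Real.tendsto_exp_atBot.comp ?_).const_mul _
      have : 0 < (n : ℝ) ^ 2 := by positivity
      exact tendsto_id.const_mul_atTop_of_neg (by linarith)
  · filter_upwards [eventually_ge_atTop 1] with y hy n
    rw [Real.norm_eq_abs, abs_mul, Real.abs_exp]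
    refine (mul_le_of_le_one_left (exp_pos _).le (hε n)).trans ?_
    rw [Real.exp_le_exp]
    nlinarith [sq_nonneg (n : ℝ)]

theorem tendsto_theta3 : Tendsto theta3 atTop (𝓝 1) := by
  have h := tendsto_tsum_theta (ε := fun _ => 1) (by simp)
  simp only [one_mul] at h
  exact h

theorem tendsto_theta4 : Tendsto theta4 atTop (𝓝 1) := by
  have h := tendsto_tsum_theta (ε := fun n => (-1) ^ n) (by simp)
  rw [zpow_zero] at h
  exact h

theorem hasDerivAt_theta3 {x : ℝ} (hx : 0 < x) :
    HasDerivAt theta3 (-∑' n : ℤ, (n : ℝ) ^ 2 * exp (-(n : ℝ) ^ 2 * x)) x := by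
  have h := hasDerivAt_tsum_theta (ε := fun _ => 1) (by simp) hx
  simp only [one_mul] at h
  exact h

theorem hasDerivAt_theta4 {x : ℝ} (hx : 0 < x) :
    HasDerivAt theta4
      (-∑' n : ℤ, (n : ℝ) ^ 2 * ((-1) ^ n * exp (-(n : ℝ) ^ 2 * x))) x :=
  hasDerivAt_tsum_theta (ε := fun n => (-1) ^ n) (by simp) hx

theorem theta3_pos {x : ℝ} (hx : 0 < x) : 0 < theta3 x :=
  (summable_theta3 hx).tsum_pos (fun _ => (exp_pos _).le) 0 (exp_pos _)

theorem theta2_pos {x : ℝ} (hx : 0 < x) : 0 < theta2 x :=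
  (summable_theta2 hx).tsum_pos (fun _ => (exp_pos _).le) 0 (exp_pos _)

theorem tendsto_two_pow_mul_atTop {x : ℝ} (hx : 0 < x) :
    Tendsto (fun n : ℕ => 2 ^ n * x) atTop atTop :=
  (tendsto_pow_atTop_atTop_of_one_lt one_lt_two).atTop_mul_const hx

/-- A function on the positive reals that is invariant under `x ↦ 2 x` and has a limit at infinity
is equal to this limit. -/
theorem eq_of_tendsto_of_two_mul {f : ℝ → ℝ} {l : ℝ} (hf : Tendsto f atTop (𝓝 l))
    (h2 : ∀ x, 0 < x → f (2 * x) = f x) {x : ℝ} (hx : 0 < x) : f x = l := by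
  have h : ∀ n : ℕ, f (2 ^ n * x) = f x := by
    intro n
    induction n with
    | zero => simp
    | succ n ih => rw [pow_succ', mul_assoc, h2 _ (by positivity), ih]
  refine tendsto_nhds_unique ?_ (hf.comp (tendsto_two_pow_mul_atTop hx))
  simp only [Function.comp_def, h]
  exact tendsto_const_nhds

theorem theta4_ne_zero {x : ℝ} (hx : 0 < x) : theta4 x ≠ 0 := by
  intro h0
  have h : ∀ n : ℕ, theta4 (2 ^ n * x) = 0 := by
    intro n
    induction n with
    | zero => simpa using h0
    | succ n ih =>
      have := theta3_mul_theta4 (x := 2 ^ n * x) (by positivity)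
      rw [ih, mul_zero, ← mul_assoc, ← pow_succ', eq_comm] at this
      exact pow_eq_zero_iff two_ne_zero |>.1 this
  have := tendsto_theta4.comp (tendsto_two_pow_mul_atTop hx)
  simp only [Function.comp_def, h] at this
  exact zero_ne_one (tendsto_nhds_unique tendsto_const_nhds this)

theorem theta4_pos {x : ℝ} (hx : 0 < x) : 0 < theta4 x := by
  have h := theta3_mul_theta4 hx
  have h4 := theta4_ne_zero (x := 2 * x) (by positivity)
  have : 0 < theta3 x * theta4 x := by rw [h]; positivity
  exact (pos_iff_pos_of_mul_pos this).1 (theta3_pos hx)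

theorem theta3_pi_div_sqrt_two : theta3 (π / √2) ^ 2 = √2 * theta3 (2 * (π / √2)) ^ 2 := by
  have h := Real.tsum_exp_neg_mul_int_sq (a := 1 / √2) (by positivity)
  have h1 : theta3 (π / √2) = ∑' n : ℤ, exp (-π * (1 / √2) * (n : ℝ) ^ 2) :=
    tsum_congr fun n => by congr 1; ring
  have h2 : theta3 (2 * (π / √2)) = ∑' n : ℤ, exp (-π / (1 / √2) * (n : ℝ) ^ 2) := by
    refine tsum_congr fun n => ?_
    congr 1
    field_simp
    rw [Real.sq_sqrt (by norm_num)]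
  rw [h1, h2, h, mul_pow]
  congr 1
  rw [← Real.sqrt_eq_rpow, div_pow, Real.sq_sqrt (by positivity)]
  simp

/-- The Taylor coefficients of `(1 - z) ^ (-1/2)`. -/
noncomputable def invSqrtCoeff (n : ℕ) : ℝ := poch (1 / 2) n / n.factorial

theorem invSqrtCoeff_eq_prod (n : ℕ) :
    invSqrtCoeff n = ∏ i ∈ Finset.range n, (2 * (i : ℝ) + 1) / (2 * i + 2) := by
  induction n with
  | zero => simp [invSqrtCoeff, poch]
  | succ n ih =>
    rw [Finset.prod_range_succ, ← ih, invSqrtCoeff, invSqrtCoeff, poch, poch,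
      Finset.prod_range_succ, Nat.factorial_succ]
    push_cast
    field_simp
    ring

theorem ascPochhammer_eval_half (n : ℕ) :
    (ascPochhammer ℝ n).eval (1 / 2 : ℝ) = poch (1 / 2) n := by
  induction n with
  | zero => simp [poch]
  | succ n ih => rw [ascPochhammer_succ_eval, ih, poch, poch, Finset.prod_range_succ]

theorem invSqrtCoeff_eq_choose (n : ℕ) :
    invSqrtCoeff n = Ring.choose ((1 / 2 : ℝ) + n - 1) n := by
  rw [← Ring.multichoose_eq]
  have h := Ring.factorial_nsmul_multichoose_eq_ascPochhammer (1 / 2 : ℝ) n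
  rw [Polynomial.ascPochhammer_smeval_eq_eval, nsmul_eq_mul, ascPochhammer_eval_half] at h
  rw [invSqrtCoeff, ← h]
  field_simp

theorem invSqrtCoeff_nonneg (n : ℕ) : 0 ≤ invSqrtCoeff n := by
  rw [invSqrtCoeff_eq_prod]
  positivity

theorem invSqrtCoeff_le_one (n : ℕ) : invSqrtCoeff n ≤ 1 := by
  rw [invSqrtCoeff_eq_prod]
  refine Finset.prod_le_one (fun i _ => by positivity) fun i _ => ?_
  rw [div_le_one (by positivity)]
  linarith

theorem hasSum_invSqrtCoeff_complex {z : ℂ} (hz : ‖z‖ < 1) :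
    HasSum (fun n => (invSqrtCoeff n : ℂ) * z ^ n) (1 / (1 - z) ^ (1 / 2 : ℂ)) := by
  have h := (Complex.one_div_one_sub_cpow_hasFPowerSeriesOnBall_zero (1 / 2)).hasSum
    (y := z) (by simpa [enorm_eq_nnnorm, ← NNReal.coe_lt_coe] using hz)
  simp only [zero_add] at h
  have e : ∀ n, (FormalMultilinearSeries.ofScalars ℂ
      (fun n : ℕ => Ring.choose (1 / 2 + (n : ℂ) - 1) n) n) (fun _ => z) =
        (invSqrtCoeff n : ℂ) * z ^ n := fun n => by
    rw [FormalMultilinearSeries.ofScalars_apply_eq, invSqrtCoeff_eq_choose, Complex.ofReal_choose]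
    simp
  simpa only [e] using h

theorem hasSum_invSqrtCoeff {y : ℝ} (hy : |y| < 1) :
    HasSum (fun n => invSqrtCoeff n * y ^ n) (1 / √(1 - y)) := by
  have h := (Real.one_div_one_sub_rpow_hasFPowerSeriesOnBall_zero (1 / 2)).hasSum
    (y := y) (by simpa [enorm_eq_nnnorm, ← NNReal.coe_lt_coe] using hy)
  simp only [zero_add] at h
  rw [Real.sqrt_eq_rpow]
  have e : ∀ n, (FormalMultilinearSeries.ofScalars ℝ
      (fun n : ℕ => Ring.choose (1 / 2 + (n : ℝ) - 1) n) n) (fun _ => y) =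
        invSqrtCoeff n * y ^ n := fun n => by
    rw [FormalMultilinearSeries.ofScalars_apply_eq, invSqrtCoeff_eq_choose]
    simp
  simpa only [e] using h

theorem hasSum_intervalIntegral_of_norm_le {ι : Type*} [Countable ι] {F : ι → ℝ → ℂ} {f : ℝ → ℂ}
    {M : ι → ℝ} {a b : ℝ} (hM : Summable M) (hF : ∀ i, Continuous (F i))
    (hb : ∀ i t, ‖F i t‖ ≤ M i) (h : ∀ t, HasSum (fun i => F i t) (f t)) :
    HasSum (fun i => ∫ t in a..b, F i t) (∫ t in a..b, f t) :=
  intervalIntegral.hasSum_integral_of_dominated_convergence (fun i _ => M i)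
    (fun i => (hF i).aestronglyMeasurable) (fun i => .of_forall fun t _ => hb i t)
    (.of_forall fun _ _ => hM) (by simp) (.of_forall fun t _ => h t)

theorem norm_invSqrt_sq {z : ℂ} :
    1 / (1 - z) ^ (1 / 2 : ℂ) * (starRingEnd ℂ) (1 / (1 - z) ^ (1 / 2 : ℂ)) =
      ((1 / ‖1 - z‖ : ℝ) : ℂ) := by
  rw [Complex.mul_conj, Complex.normSq_eq_norm_sq, norm_div, norm_one, div_pow, one_pow, ← norm_pow]
  congr 3
  simp

theorem integral_exp_two_mul_I (n : ℤ) :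
    ∫ t in (0 : ℝ)..π, Complex.exp (2 * n * t * Complex.I) = if n = 0 then (π : ℂ) else 0 := by
  split_ifs with h
  · simp [h]
  · have h2 : (2 * n * Complex.I : ℂ) ≠ 0 := by simp [h]
    have := integral_exp_mul_complex (a := 0) (b := π) h2
    have h3 : Complex.exp (2 * n * Complex.I * π) = 1 := by
      rw [Complex.exp_eq_one_iff]
      exact ⟨n, by ring⟩
    rw [h3] at this
    simp only [Complex.ofReal_zero, mul_zero, Complex.exp_zero, sub_self, zero_div] at this
    rw [← this]
    congr 1
    ext t
    ring_nf

theorem hasSum_integral_inv_norm {k : ℝ} (h0 : 0 ≤ k) (h1 : k < 1) {z : ℝ → ℂ}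
    (hc : Continuous z) (hz : ∀ t, ‖z t‖ = k) :
    HasSum (fun p : ℕ × ℕ => ∫ t in (0 : ℝ)..π, (invSqrtCoeff p.1 * z t ^ p.1) *
      (starRingEnd ℂ) (invSqrtCoeff p.2 * z t ^ p.2))
      (∫ t in (0 : ℝ)..π, ((1 / ‖1 - z t‖ : ℝ) : ℂ)) := by
  have hk : Summable fun n => invSqrtCoeff n * k ^ n :=
    (hasSum_invSqrtCoeff (by rwa [abs_of_nonneg h0])).summable
  have hk' : Summable fun p : ℕ × ℕ =>
      (invSqrtCoeff p.1 * k ^ p.1) * (invSqrtCoeff p.2 * k ^ p.2) :=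
    hk.mul_of_nonneg hk (fun n => mul_nonneg (invSqrtCoeff_nonneg n) (by positivity))
      (fun n => mul_nonneg (invSqrtCoeff_nonneg n) (by positivity))
  have hn : ∀ (p : ℕ × ℕ) t, ‖(invSqrtCoeff p.1 * z t ^ p.1) *
      (starRingEnd ℂ) (invSqrtCoeff p.2 * z t ^ p.2)‖ =
      (invSqrtCoeff p.1 * k ^ p.1) * (invSqrtCoeff p.2 * k ^ p.2) := fun p t => by
    rw [norm_mul, RCLike.norm_conj, norm_mul, norm_mul, norm_pow, norm_pow, hz t,
      Complex.norm_real, Complex.norm_real, Real.norm_of_nonneg (invSqrtCoeff_nonneg _),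
      Real.norm_of_nonneg (invSqrtCoeff_nonneg _)]
  have hc' : Continuous fun t => (starRingEnd ℂ) (z t) := Complex.continuous_conj.comp hc
  refine hasSum_intervalIntegral_of_norm_le hk' (fun p => ?_) (fun p t => (hn p t).le) fun t => ?_
  · simp only [map_mul, map_pow, Complex.conj_ofReal]
    exact (continuous_const.mul (hc.pow _)).mul (continuous_const.mul (hc'.pow _))
  · have hs := hasSum_invSqrtCoeff_complex (z := z t) (by rwa [hz t])
    rw [← norm_invSqrt_sq]
    have hs' : HasSum (fun n => (starRingEnd ℂ) (invSqrtCoeff n * z t ^ n)) _ :=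
      hs.map (starRingEnd ℂ) Complex.continuous_conj
    have hsum : Summable fun p : ℕ × ℕ => (invSqrtCoeff p.1 * z t ^ p.1) *
        (starRingEnd ℂ) (invSqrtCoeff p.2 * z t ^ p.2) := by
      refine Summable.of_norm ?_
      simpa only [hn] using hk'
    exact HasSum.mul (f := fun n => invSqrtCoeff n * z t ^ n)
      (g := fun n => (starRingEnd ℂ) (invSqrtCoeff n * z t ^ n)) hs hs' hsum

theorem integral_inv_norm_eq_hyp {k : ℝ} (h0 : 0 ≤ k) (h1 : k < 1) :
    ∫ t in (0 : ℝ)..π, ((1 / ‖1 - (-k * Complex.exp (2 * t * Complex.I))‖ : ℝ) : ℂ) =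
      ((π * hyp2F1half (k ^ 2) : ℝ) : ℂ) := by
  have hz : ∀ t : ℝ, ‖-(k : ℂ) * Complex.exp (2 * t * Complex.I)‖ = k := fun t => by
    have : ‖Complex.exp (2 * t * Complex.I)‖ = 1 := by
      rw [← Complex.norm_exp_ofReal_mul_I (2 * t)]
      push_cast
      rfl
    rw [norm_mul, this, norm_neg, Complex.norm_real, Real.norm_of_nonneg h0, mul_one]
  have key := hasSum_integral_inv_norm h0 h1
    (z := fun t => -k * Complex.exp (2 * t * Complex.I)) (by fun_prop) hz
  have hterm : ∀ p : ℕ × ℕ, ∫ t in (0 : ℝ)..π,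
      (invSqrtCoeff p.1 * (-k * Complex.exp (2 * t * Complex.I)) ^ p.1) *
      (starRingEnd ℂ) (invSqrtCoeff p.2 * (-k * Complex.exp (2 * t * Complex.I)) ^ p.2) =
      if p.1 = p.2 then ((π * (invSqrtCoeff p.1 ^ 2 * (k ^ 2) ^ p.1) : ℝ) : ℂ) else 0 := by
    rintro ⟨m, n⟩
    have : ∀ t : ℝ, (invSqrtCoeff m * (-k * Complex.exp (2 * t * Complex.I)) ^ m) *
      (starRingEnd ℂ) (invSqrtCoeff n * (-k * Complex.exp (2 * t * Complex.I)) ^ n) =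
      (invSqrtCoeff m * invSqrtCoeff n * (-k) ^ (m + n)) *
        Complex.exp (2 * ((m - n : ℤ) : ℂ) * t * Complex.I) := fun t => by
      simp only [map_mul, map_pow, map_neg, Complex.conj_ofReal, ← Complex.exp_conj,
        Complex.conj_I, mul_pow, ← Complex.exp_nat_mul, map_ofNat,
        map_natCast]
      have : Complex.exp (2 * ((m - n : ℤ) : ℂ) * t * Complex.I) =
          Complex.exp (m * (2 * t * Complex.I)) * Complex.exp (n * (2 * t * -Complex.I)) := by
        rw [← Complex.exp_add]
        push_cast
        ring_nf
      rw [this]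
      ring
    simp only [this]
    rw [intervalIntegral.integral_const_mul, integral_exp_two_mul_I]
    by_cases hmn : m = n
    · subst hmn
      simp only [sub_self, if_true]
      push_cast
      rw [← two_mul, pow_mul, neg_sq]
      ring
    · rw [if_neg (by omega), if_neg hmn, mul_zero]
  simp only [hterm] at key
  have hinj : Function.Injective fun n : ℕ => (n, n) := fun a b h => (Prod.mk.inj h).1
  have key2 := (hinj.hasSum_iff (fun p hp => ?_)).mpr key
  · rw [← key2.tsum_eq, hyp2F1half, ← tsum_mul_left, Complex.ofReal_tsum]
    simp [invSqrtCoeff]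
  · rw [if_neg]
    rintro h
    exact hp ⟨p.1, by ext <;> simp [h]⟩

theorem integral_inv_norm_eq_hyp_landen {k : ℝ} (h0 : 0 ≤ k) (h1 : k < 1) :
    ∫ t in (0 : ℝ)..π, ((1 / ‖1 - (-k * Complex.exp (2 * t * Complex.I))‖ : ℝ) : ℂ) =
      ((π / (1 + k) * hyp2F1half (4 * k / (1 + k) ^ 2) : ℝ) : ℂ) := by
  set m := 4 * k / (1 + k) ^ 2 with hm
  have hm0 : 0 ≤ m := by positivity
  have hm1 : m < 1 := by
    rw [hm, div_lt_one (by positivity)]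
    nlinarith [sq_pos_of_pos (sub_pos.mpr h1)]
  have hk : Summable fun n => 1 / (1 + k) * (invSqrtCoeff n * m ^ n) :=
    (hasSum_invSqrtCoeff (by rwa [abs_of_nonneg hm0])).summable.mul_left _
  have hsin : ∀ t : ℝ, sin t ^ 2 ≤ 1 := fun t => sin_sq_le_one t
  have key := hasSum_intervalIntegral_of_norm_le (a := 0) (b := π) (ι := ℕ)
    (F := fun n t => ((1 / (1 + k) * (invSqrtCoeff n * (m * sin t ^ 2) ^ n) : ℝ) : ℂ))
    (f := fun t => ((1 / ‖1 - (-k * Complex.exp (2 * t * Complex.I))‖ : ℝ) : ℂ))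
    hk (fun p => by fun_prop) (fun n t => by
      rw [Complex.norm_real, Real.norm_of_nonneg (mul_nonneg (by positivity)
        (mul_nonneg (invSqrtCoeff_nonneg _) (by positivity)))]
      have := invSqrtCoeff_nonneg n
      have := mul_le_of_le_one_right hm0 (hsin t)
      gcongr) (fun t => by
      rw [Complex.hasSum_ofReal]
      have hy : |m * sin t ^ 2| < 1 := by
        rw [abs_of_nonneg (by positivity)]
        exact (mul_le_of_le_one_right hm0 (hsin t)).trans_lt hm1
      have h2 : ‖1 - (-k * Complex.exp (2 * t * Complex.I))‖ = (1 + k) * √(1 - m * sin t ^ 2) := by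
        rw [show (1 + k) * √(1 - m * sin t ^ 2) = √((1 + k) ^ 2 * (1 - m * sin t ^ 2)) by
          rw [Real.sqrt_mul (by positivity), Real.sqrt_sq (by positivity)],
          Complex.norm_eq_sqrt_sq_add_sq]
        have e : Complex.exp (2 * t * Complex.I) =
            (cos (2 * t) : ℂ) + (sin (2 * t) : ℂ) * Complex.I := by
          rw [Complex.ofReal_cos, Complex.ofReal_sin, ← Complex.exp_mul_I]
          push_cast
          rfl
        have hre : (1 - (-k * Complex.exp (2 * t * Complex.I))).re = 1 + k * cos (2 * t) := by
          rw [e]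
          simp [-Complex.ofReal_cos, -Complex.ofReal_sin]
        have him : (1 - (-k * Complex.exp (2 * t * Complex.I))).im = k * sin (2 * t) := by
          rw [e]
          simp [-Complex.ofReal_cos, -Complex.ofReal_sin]
        rw [hre, him]
        congr 1
        have h3 : (1 + k) ^ 2 * (1 - m * sin t ^ 2) = (1 + k) ^ 2 - 4 * k * sin t ^ 2 := by
          rw [hm]
          field_simp
        rw [h3]
        have h4 := sin_sq_add_cos_sq (2 * t)
        have h5 : cos (2 * t) = 1 - 2 * sin t ^ 2 := by
          rw [cos_two_mul, cos_sq']
          ring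
        rw [mul_pow, show sin (2 * t) ^ 2 = 1 - cos (2 * t) ^ 2 by linarith, h5]
        ring
      rw [h2, ← one_div_mul_one_div]
      exact (hasSum_invSqrtCoeff hy).mul_left (1 / (1 + k)))
  rw [← key.tsum_eq, hyp2F1half, ← tsum_mul_left, Complex.ofReal_tsum]
  congr 1
  ext n
  rw [intervalIntegral.integral_ofReal, intervalIntegral.integral_const_mul]
  simp only [mul_pow, ← pow_mul]
  rw [intervalIntegral.integral_const_mul, intervalIntegral.integral_const_mul,
    integral_sin_pow_even, ← invSqrtCoeff_eq_prod]
  congr 1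
  rw [invSqrtCoeff]
  ring

theorem hyp2F1half_landen {k : ℝ} (h0 : 0 ≤ k) (h1 : k < 1) :
    hyp2F1half (4 * k / (1 + k) ^ 2) = (1 + k) * hyp2F1half (k ^ 2) := by
  have h := (integral_inv_norm_eq_hyp_landen h0 h1).symm.trans (integral_inv_norm_eq_hyp h0 h1)
  have h2 := Complex.ofReal_injective h
  have : 1 + k ≠ 0 := by positivity
  rw [div_mul_eq_mul_div, mul_div_assoc] at h2
  have h3 := mul_left_cancel₀ pi_ne_zero h2
  rw [div_eq_iff this] at h3
  rw [h3, mul_comm]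

theorem tendsto_hyp2F1half_zero : Tendsto hyp2F1half (𝓝 0) (𝓝 1) := by
  have h1 : ∑' n : ℕ, (poch (1 / 2) n / (n.factorial : ℝ)) ^ 2 * (0 : ℝ) ^ n = 1 := by
    rw [tsum_eq_single 0 (fun n hn => by simp [hn])]
    simp [poch]
  rw [← h1]
  refine tendsto_tsum_of_dominated_convergence (bound := fun n : ℕ => (1 / 2 : ℝ) ^ n)
    (summable_geometric_of_lt_one (by norm_num) (by norm_num))
    (fun n => (tendsto_id.pow n).const_mul _) ?_
  have : ∀ᶠ z : ℝ in 𝓝 0, |z| < 1 / 2 := by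
    filter_upwards [Metric.ball_mem_nhds (0 : ℝ) (by norm_num : (0 : ℝ) < 1 / 2)] with z hz
    simpa using hz
  filter_upwards [this] with z hz n
  rw [norm_mul, norm_pow, norm_pow]
  have h2 : ‖poch (1 / 2) n / (n.factorial : ℝ)‖ ≤ 1 := by
    change ‖invSqrtCoeff n‖ ≤ 1
    rw [Real.norm_of_nonneg (invSqrtCoeff_nonneg n)]
    exact invSqrtCoeff_le_one n
  calc _ ≤ 1 ^ 2 * (1 / 2 : ℝ) ^ n := by
        gcongr
        exact hz.le
    _ = _ := by ring

/-- The complementary modulus `θ₄² / θ₃²` as a function of `x`, where the nome is `exp (-x)`. -/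
noncomputable def compModulus (x : ℝ) : ℝ := theta4 x ^ 2 / theta3 x ^ 2

theorem compModulus_pos {x : ℝ} (hx : 0 < x) : 0 < compModulus x := by
  have := theta4_pos hx
  have := theta3_pos hx
  unfold compModulus
  positivity

theorem compModulus_lt_one {x : ℝ} (hx : 0 < x) : compModulus x < 1 := by
  have h := theta2_pos (x := 2 * x) (by positivity)
  have h3 := theta3_pos hx
  rw [compModulus, div_lt_one (by positivity), theta4_sq hx, theta3_sq hx]
  have : 0 < theta2 (2 * x) ^ 2 := by positivity
  linarith

theorem tendsto_compModulus : Tendsto compModulus atTop (𝓝 1) := by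
  have := (tendsto_theta4.pow 2).div (tendsto_theta3.pow 2) (by norm_num)
  rw [one_pow, div_one] at this
  exact this

theorem theta3_two_mul_sq {x : ℝ} (hx : 0 < x) :
    theta3 (2 * x) ^ 2 = (theta3 x ^ 2 + theta4 x ^ 2) / 2 := by
  rw [theta3_sq hx, theta4_sq hx]
  ring

/-- The classical evaluation `₂F₁(1/2, 1/2; 1; k²) = θ₃²`. -/
theorem hyp2F1half_eq_theta3_sq {x : ℝ} (hx : 0 < x) :
    hyp2F1half (1 - compModulus x ^ 2) = theta3 x ^ 2 := by
  have key := eq_of_tendsto_of_two_mul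
    (f := fun x => hyp2F1half (1 - compModulus x ^ 2) / theta3 x ^ 2) (l := 1) ?_ ?_ hx
  · have := theta3_pos hx
    rwa [div_eq_one_iff_eq (by positivity)] at key
  · have h1 : Tendsto (fun x => 1 - compModulus x ^ 2) atTop (𝓝 0) := by
      simpa using (tendsto_compModulus.pow 2).const_sub 1
    have := (tendsto_hyp2F1half_zero.comp h1).div (tendsto_theta3.pow 2) (by norm_num)
    rw [one_pow, div_one] at this
    exact this
  · intro x hx
    have h3 := theta3_pos hx
    have h4 := theta4_pos hx
    have h3' := theta3_pos (x := 2 * x) (by positivity)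
    set u := compModulus x with hu
    have hu0 : 0 < u := compModulus_pos hx
    have hu1 : u < 1 := compModulus_lt_one hx
    have hL := hyp2F1half_landen (k := (1 - u) / (1 + u)) (div_nonneg (by linarith) (by linarith))
      ((div_lt_one (by positivity)).mpr (by linarith))
    have e1 : 4 * ((1 - u) / (1 + u)) / (1 + (1 - u) / (1 + u)) ^ 2 = 1 - u ^ 2 := by
      field_simp
      ring
    have e3 : theta3 (2 * x) ^ 2 = theta3 x ^ 2 * (1 + u) / 2 := by
      rw [theta3_two_mul_sq hx, hu, compModulus]
      field_simp
    have e2 : 1 - compModulus (2 * x) ^ 2 = ((1 - u) / (1 + u)) ^ 2 := by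
      rw [compModulus, ← theta3_mul_theta4 hx, e3]
      have : theta4 x ^ 2 = u * theta3 x ^ 2 := by
        rw [hu, compModulus]
        field_simp
      rw [div_pow, mul_pow, this]
      field_simp
      ring
    rw [e1] at hL
    rw [e2, hL, e3]
    field_simp
    ring

/-- The sign of an integer, with the convention that `0` has sign `1`. -/
noncomputable def sgnOne (n : ℤ) : ℝ := if 0 ≤ n then 1 else -1

theorem hasSum_sgnOne_sub (a b N : ℤ) (h : a = b + 2 * N) :
    HasSum (fun i : ℤ => sgnOne (2 * i + a) - sgnOne (2 * i + b)) (2 * N) := by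
  rcases le_or_gt 0 N with hN | hN
  · have : (∑ i ∈ Finset.Ico (-(a / 2)) (-(a / 2) + N),
        (sgnOne (2 * i + a) - sgnOne (2 * i + b))) = 2 * N := by
      rw [Finset.sum_congr rfl (g := fun _ => (2 : ℝ))]
      · have : ((N.toNat : ℤ) : ℝ) = N := by rw [Int.toNat_of_nonneg hN]
        rw [Finset.sum_const, Int.card_Ico, add_sub_cancel_left, nsmul_eq_mul]
        rw [show ((N.toNat : ℕ) : ℝ) = N from mod_cast this]
        ring
      · intro i hi
        rw [Finset.mem_Ico] at hi
        rw [sgnOne, sgnOne, if_pos (by omega), if_neg (by omega)]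
        norm_num
    rw [← this]
    refine hasSum_sum_of_ne_finset_zero fun i hi => ?_
    rw [Finset.mem_Ico, not_and_or] at hi
    rcases hi with hi | hi
    · rw [sgnOne, sgnOne, if_neg (by omega), if_neg (by omega), sub_self]
    · rw [sgnOne, sgnOne, if_pos (by omega), if_pos (by omega), sub_self]
  · have : (∑ i ∈ Finset.Ico (-(a / 2) + N) (-(a / 2)),
        (sgnOne (2 * i + a) - sgnOne (2 * i + b))) = 2 * N := by
      rw [Finset.sum_congr rfl (g := fun _ => (-2 : ℝ))]
      · have : (((-N).toNat : ℤ) : ℝ) = -N := by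
          rw [Int.toNat_of_nonneg (by omega)]
          simp
        rw [Finset.sum_const, Int.card_Ico, sub_add_cancel_left, nsmul_eq_mul]
        rw [show (((-N).toNat : ℕ) : ℝ) = -N from mod_cast this]
        ring
      · intro i hi
        rw [Finset.mem_Ico] at hi
        rw [sgnOne, sgnOne, if_neg (by omega), if_pos (by omega)]
        norm_num
    rw [← this]
    refine hasSum_sum_of_ne_finset_zero fun i hi => ?_
    rw [Finset.mem_Ico, not_and_or] at hi
    rcases hi with hi | hi
    · rw [sgnOne, sgnOne, if_neg (by omega), if_neg (by omega), sub_self]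
    · rw [sgnOne, sgnOne, if_pos (by omega), if_pos (by omega), sub_self]

theorem summable_sgnOne_sub (a b : ℤ) :
    Summable fun i : ℤ => sgnOne (2 * i + a) - sgnOne (2 * i + b) := by
  refine summable_of_ne_finset_zero (s := Finset.Icc (-(|a| + |b|)) (|a| + |b|)) fun i hi => ?_
  rw [Finset.mem_Icc, not_and_or] at hi
  have := neg_abs_le a
  have := neg_abs_le b
  have := le_abs_self a
  have := le_abs_self b
  rcases hi with hi | hi
  · rw [sgnOne, sgnOne, if_neg (by omega), if_neg (by omega), sub_self]
  · rw [sgnOne, sgnOne, if_pos (by omega), if_pos (by omega), sub_self]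

theorem injective_two_mul_add (a : ℤ) : Function.Injective fun i : ℤ => 2 * i + a :=
  fun i j h => by simpa using h

theorem tsum_odd_function_sub {φ γ : ℤ → ℝ} (hφ : ∀ n, φ (-n) = -φ n) (hγ : ∀ n, γ (-n) = -γ n)
    (sφ : Summable fun n => φ n - sgnOne n) (sγ : Summable fun n => γ n - sgnOne n) (e N : ℤ) :
    ∑' i : ℤ, (φ (2 * i + e) - γ (2 * i + e - N)) = N := by
  have hs : Summable fun i : ℤ => φ (2 * i + e) - γ (2 * i + e - N) := by
    have h1 := sφ.comp_injective (injective_two_mul_add e)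
    have h2 := sγ.comp_injective (injective_two_mul_add (e - N))
    refine ((h1.sub h2).add (summable_sgnOne_sub e (e - N))).congr fun i => ?_
    simp only [Function.comp, add_sub_assoc]
    ring
  have hgg : HasSum (fun i : ℤ => γ (2 * i + e + N) - γ (2 * i + e - N)) (2 * N) := by
    have h2 := sγ.comp_injective (injective_two_mul_add (e - N))
    have h3 := (Equiv.addRight N).hasSum_iff.mpr h2.hasSum
    have h4 := (h3.sub h2.hasSum).add (hasSum_sgnOne_sub (e + N) (e - N) N (by ring))
    rw [sub_self, zero_add] at h4
    refine h4.congr_fun fun i => ?_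
    simp only [Function.comp, Equiv.coe_addRight]
    rw [show 2 * (i + N) + (e - N) = 2 * i + e + N by ring,
      show 2 * i + (e - N) = 2 * i + e - N by ring, show 2 * i + (e + N) = 2 * i + e + N by ring]
    ring
  have h1 := hs.hasSum
  have h2 := ((Equiv.neg ℤ).trans (Equiv.addRight (-e))).hasSum_iff.mpr h1
  have h3 := h1.add h2
  have e3 : (fun i : ℤ => γ (2 * i + e + N) - γ (2 * i + e - N)) = fun i : ℤ =>
      (φ (2 * i + e) - γ (2 * i + e - N)) + ((fun i : ℤ => φ (2 * i + e) - γ (2 * i + e - N)) ∘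
        ((Equiv.neg ℤ).trans (Equiv.addRight (-e)))) i := by
    ext i
    simp only [Function.comp, Equiv.trans_apply, Equiv.neg_apply, Equiv.coe_addRight]
    rw [show 2 * (-i + -e) + e - N = -(2 * i + e + N) by ring,
      show 2 * (-i + -e) + e = -(2 * i + e) by ring, hφ, hγ]
    ring
  rw [e3] at hgg
  have := h3.unique hgg
  linarith

/-- Convolution of two sequences indexed by the integers. -/
noncomputable def conv (f g : ℤ → ℝ) (N : ℤ) : ℝ := ∑' j, f j * g (N - j)

theorem conv_eq_mul_of_odd_function_sub {f g φ γ : ℤ → ℝ} (hφ : ∀ n, φ (-n) = -φ n)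
    (hγ : ∀ n, γ (-n) = -γ n) (sφ : Summable fun n => φ n - sgnOne n)
    (sγ : Summable fun n => γ n - sgnOne n) {e N : ℤ} {c : ℝ}
    (h : ∀ i, f (2 * i + e) * g (N - (2 * i + e)) = c * (φ (2 * i + e) - γ (2 * i + e - N)))
    (h0 : ∀ i, f (2 * i + e + 1) * g (N - (2 * i + e + 1)) = 0) : conv f g N = N * c := by
  have : Function.support (fun j => f j * g (N - j)) ⊆ Set.range fun i : ℤ => 2 * i + e := by
    intro j hj
    rcases Int.even_or_odd' (j - e) with ⟨i, hi | hi⟩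
    · exact ⟨i, by simp only; omega⟩
    · refine (hj ?_).elim
      have := h0 i
      rwa [show 2 * i + e + 1 = j by omega] at this
  rw [conv, ← (injective_two_mul_add e).tsum_eq this]
  simp only [h]
  rw [tsum_mul_left, tsum_odd_function_sub hφ hγ sφ sγ, mul_comm]

theorem summable_tanh_sub_sgnOne {x : ℝ} (hx : 0 < x) :
    Summable fun n : ℤ => tanh (n * x) - sgnOne n := by
  have h := summable_int_pow_mul_exp_neg 0 hx
  simp only [pow_zero, one_mul] at h
  refine Summable.of_norm_bounded h fun n => ?_
  have hc := cosh_pos (n * x)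
  rw [tanh_eq_sinh_div_cosh, Real.norm_eq_abs]
  by_cases hn : 0 ≤ n
  · have hn' : (0 : ℝ) ≤ n := mod_cast hn
    rw [sgnOne, if_pos hn, abs_of_nonneg hn', div_sub_one hc.ne', ← neg_sub, cosh_sub_sinh,
      abs_div, abs_neg, abs_of_pos hc, abs_of_pos (exp_pos _), div_le_iff₀ hc]
    rw [show -x * n = -(n * x) by ring]
    exact le_mul_of_one_le_right (exp_pos _).le (one_le_cosh _)
  · have hn' : (n : ℝ) ≤ 0 := mod_cast (by omega)
    rw [sgnOne, if_neg hn, abs_of_nonpos hn', sub_neg_eq_add, div_add_one hc.ne', add_comm,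
      cosh_add_sinh, abs_div, abs_of_pos hc, abs_of_pos (exp_pos _), div_le_iff₀ hc]
    rw [show -x * -n = n * x by ring]
    exact le_mul_of_one_le_right (exp_pos _).le (one_le_cosh _)

theorem sinh_le_abs_sinh_int_mul {x : ℝ} (hx : 0 < x) {n : ℤ} (hn : n ≠ 0) :
    sinh x ≤ |sinh (n * x)| := by
  rw [Real.abs_sinh, Real.sinh_le_sinh, abs_mul, abs_of_pos hx]
  have : (1 : ℝ) ≤ |(n : ℝ)| := mod_cast Int.one_le_abs hn
  nlinarith

theorem summable_coth_sub_sgnOne {x : ℝ} (hx : 0 < x) :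
    Summable fun n : ℤ => cosh (n * x) / sinh (n * x) - sgnOne n := by
  have h := (summable_int_pow_mul_exp_neg 0 hx).mul_left (1 + 1 / sinh x)
  simp only [pow_zero, one_mul] at h
  have hs := sinh_pos_iff.mpr hx
  refine Summable.of_norm_bounded h fun n => ?_
  rw [Real.norm_eq_abs]
  rcases eq_or_ne n 0 with rfl | hn0
  · simp [sgnOne, hs.le]
  have hb := sinh_le_abs_sinh_int_mul hx hn0
  have hc : sinh (n * x) ≠ 0 := abs_pos.mp (hs.trans_le hb)
  have key : ∀ y, exp y / |sinh (n * x)| ≤ (1 + 1 / sinh x) * exp y := fun y => by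
    rw [div_eq_mul_inv, mul_comm]
    gcongr
    rw [inv_eq_one_div]
    have := one_div_le_one_div_of_le hs hb
    linarith
  by_cases hn : 0 ≤ n
  · have hn' : (0 : ℝ) ≤ n := mod_cast hn
    rw [sgnOne, if_pos hn, abs_of_nonneg hn', div_sub_one hc, cosh_sub_sinh,
      abs_div, abs_of_pos (exp_pos _), show -x * n = -(n * x) by ring]
    exact key _
  · have hn' : (n : ℝ) ≤ 0 := mod_cast (by omega)
    rw [sgnOne, if_neg hn, abs_of_nonpos hn', sub_neg_eq_add, div_add_one hc,
      cosh_add_sinh, abs_div, abs_of_pos (exp_pos _), show -x * -n = n * x by ring]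
    exact key _

/-- The hyperbolic secant sequence on odd integers. -/
noncomputable def sechOdd (x : ℝ) (n : ℤ) : ℝ := if Odd n then 1 / cosh (n * x) else 0

/-- The hyperbolic secant sequence on even integers. -/
noncomputable def sechEven (x : ℝ) (n : ℤ) : ℝ := if Even n then 1 / cosh (n * x) else 0

/-- The hyperbolic cosecant sequence on odd integers. -/
noncomputable def cschOdd (x : ℝ) (n : ℤ) : ℝ := if Odd n then 1 / sinh (n * x) else 0

theorem sinh_int_mul_ne_zero {x : ℝ} (hx : 0 < x) {n : ℤ} (hn : n ≠ 0) : sinh (n * x) ≠ 0 :=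
  abs_pos.mp ((sinh_pos_iff.mpr hx).trans_le (sinh_le_abs_sinh_int_mul hx hn))

theorem tanh_int_mul_neg (x : ℝ) (n : ℤ) : tanh (((-n : ℤ) : ℝ) * x) = -tanh (n * x) := by
  push_cast
  rw [neg_mul, tanh_neg]

theorem coth_int_mul_neg (x : ℝ) (n : ℤ) :
    cosh (((-n : ℤ) : ℝ) * x) / sinh (((-n : ℤ) : ℝ) * x) = -(cosh (n * x) / sinh (n * x)) := by
  push_cast
  rw [neg_mul, cosh_neg, sinh_neg, div_neg]

theorem sech_mul_sech {x : ℝ} (hx : 0 < x) {j N : ℤ} (hN : N ≠ 0) :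
    1 / cosh (j * x) * (1 / cosh ((N - j : ℤ) * x)) =
      1 / sinh (N * x) * (tanh (j * x) - tanh ((j - N : ℤ) * x)) := by
  have h := sinh_int_mul_ne_zero hx hN
  rw [← neg_sub N j, tanh_int_mul_neg, tanh_eq_sinh_div_cosh, tanh_eq_sinh_div_cosh, sub_neg_eq_add]
  have e : (N : ℝ) * x = j * x + (N - j : ℤ) * x := by
    push_cast
    ring
  have h1 := (cosh_pos (j * x)).ne'
  have h2 := (cosh_pos ((N - j : ℤ) * x)).ne'
  rw [div_add_div _ _ h1 h2, ← sinh_add, ← e]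
  field_simp

theorem csch_mul_sech {x : ℝ} (hx : 0 < x) {j N : ℤ} (hj : j ≠ 0) :
    1 / sinh (j * x) * (1 / cosh ((N - j : ℤ) * x)) =
      1 / cosh (N * x) * (cosh (j * x) / sinh (j * x) - tanh ((j - N : ℤ) * x)) := by
  rw [← neg_sub N j, tanh_int_mul_neg, tanh_eq_sinh_div_cosh, sub_neg_eq_add]
  have e : (N : ℝ) * x = j * x + (N - j : ℤ) * x := by
    push_cast
    ring
  have h := (cosh_pos (N * x)).ne'
  have h1 := sinh_int_mul_ne_zero hx hj
  have h2 := (cosh_pos ((N - j : ℤ) * x)).ne'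
  rw [div_add_div _ _ h1 h2, ← cosh_add, ← e]
  field_simp

theorem csch_mul_csch {x : ℝ} (hx : 0 < x) {j N : ℤ} (hN : N ≠ 0) (hj : j ≠ 0) (hj' : N - j ≠ 0) :
    1 / sinh (j * x) * (1 / sinh ((N - j : ℤ) * x)) =
      1 / sinh (N * x) * (cosh (j * x) / sinh (j * x) -
        cosh ((j - N : ℤ) * x) / sinh ((j - N : ℤ) * x)) := by
  have h := sinh_int_mul_ne_zero hx hN
  rw [← neg_sub N j, coth_int_mul_neg, sub_neg_eq_add]
  have e : (N : ℝ) * x = j * x + (N - j : ℤ) * x := by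
    push_cast
    ring
  have h1 := sinh_int_mul_ne_zero hx hj
  have h2 := sinh_int_mul_ne_zero hx hj'
  rw [div_add_div _ _ h1 h2, add_comm (cosh _ * _), ← sinh_add, ← e]
  field_simp

theorem conv_sechOdd_sechEven {x : ℝ} (hx : 0 < x) (N : ℤ) :
    conv (sechOdd x) (sechEven x) N = N * cschOdd x N := by
  refine conv_eq_mul_of_odd_function_sub (e := 1) (φ := fun n => tanh (n * x))
    (γ := fun n => tanh (n * x)) (tanh_int_mul_neg x) (tanh_int_mul_neg x)
    (summable_tanh_sub_sgnOne hx) (summable_tanh_sub_sgnOne hx) (fun i => ?_) fun i => ?_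
  · rw [sechOdd, if_pos (by grind), sechEven, cschOdd]
    by_cases hN : Odd N
    · rw [if_pos (by grind), if_pos hN]
      exact sech_mul_sech hx (by grind)
    · rw [if_neg (by grind), if_neg hN, mul_zero, zero_mul]
  · rw [sechOdd, if_neg (by grind), zero_mul]

theorem conv_cschOdd_sechEven {x : ℝ} (hx : 0 < x) (N : ℤ) :
    conv (cschOdd x) (sechEven x) N = N * sechOdd x N := by
  refine conv_eq_mul_of_odd_function_sub (e := 1) (φ := fun n => cosh (n * x) / sinh (n * x))
    (γ := fun n => tanh (n * x)) (coth_int_mul_neg x) (tanh_int_mul_neg x)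
    (summable_coth_sub_sgnOne hx) (summable_tanh_sub_sgnOne hx) (fun i => ?_) fun i => ?_
  · rw [cschOdd, if_pos (by grind), sechEven, sechOdd]
    by_cases hN : Odd N
    · rw [if_pos (by grind), if_pos hN]
      exact csch_mul_sech hx (by grind)
    · rw [if_neg (by grind), if_neg hN, mul_zero, zero_mul]
  · rw [cschOdd, if_neg (by grind), zero_mul]

theorem conv_cschOdd_sechOdd {x : ℝ} (hx : 0 < x) (N : ℤ) :
    conv (cschOdd x) (sechOdd x) N = N * sechEven x N := by
  refine conv_eq_mul_of_odd_function_sub (e := 1) (φ := fun n => cosh (n * x) / sinh (n * x))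
    (γ := fun n => tanh (n * x)) (coth_int_mul_neg x) (tanh_int_mul_neg x)
    (summable_coth_sub_sgnOne hx) (summable_tanh_sub_sgnOne hx) (fun i => ?_) fun i => ?_
  · rw [cschOdd, if_pos (by grind), sechEven, sechOdd]
    by_cases hN : Even N
    · rw [if_pos (by grind), if_pos hN]
      exact csch_mul_sech hx (by grind)
    · rw [if_neg (by grind), if_neg hN, mul_zero, zero_mul]
  · rw [cschOdd, if_neg (by grind), zero_mul]

theorem conv_sechOdd_self {x : ℝ} (hx : 0 < x) {N : ℤ} (hN0 : N ≠ 0) :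
    conv (sechOdd x) (sechOdd x) N = N * if Even N then 1 / sinh (N * x) else 0 := by
  refine conv_eq_mul_of_odd_function_sub (e := 1) (φ := fun n => tanh (n * x))
    (γ := fun n => tanh (n * x)) (tanh_int_mul_neg x) (tanh_int_mul_neg x)
    (summable_tanh_sub_sgnOne hx) (summable_tanh_sub_sgnOne hx) (fun i => ?_) fun i => ?_
  · rw [sechOdd, if_pos (by grind), sechOdd]
    by_cases hN : Even N
    · rw [if_pos (by grind), if_pos hN]
      exact sech_mul_sech hx hN0
    · rw [if_neg (by grind), if_neg hN, mul_zero, zero_mul]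
  · rw [sechOdd, if_neg (by grind), zero_mul]

theorem conv_sechEven_self {x : ℝ} (hx : 0 < x) {N : ℤ} (hN0 : N ≠ 0) :
    conv (sechEven x) (sechEven x) N = N * if Even N then 1 / sinh (N * x) else 0 := by
  refine conv_eq_mul_of_odd_function_sub (e := 0) (φ := fun n => tanh (n * x))
    (γ := fun n => tanh (n * x)) (tanh_int_mul_neg x) (tanh_int_mul_neg x)
    (summable_tanh_sub_sgnOne hx) (summable_tanh_sub_sgnOne hx) (fun i => ?_) fun i => ?_
  · rw [sechEven, if_pos (by grind), sechEven]
    by_cases hN : Even N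
    · rw [if_pos (by grind), if_pos hN]
      exact sech_mul_sech hx hN0
    · rw [if_neg (by grind), if_neg hN, mul_zero, zero_mul]
  · rw [sechEven, if_neg (by grind), zero_mul]

theorem conv_cschOdd_self {x : ℝ} (hx : 0 < x) {N : ℤ} (hN0 : N ≠ 0) :
    conv (cschOdd x) (cschOdd x) N = N * if Even N then 1 / sinh (N * x) else 0 := by
  refine conv_eq_mul_of_odd_function_sub (e := 1) (φ := fun n => cosh (n * x) / sinh (n * x))
    (γ := fun n => cosh (n * x) / sinh (n * x)) (coth_int_mul_neg x) (coth_int_mul_neg x)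
    (summable_coth_sub_sgnOne hx) (summable_coth_sub_sgnOne hx) (fun i => ?_) fun i => ?_
  · rw [cschOdd, if_pos (by grind), cschOdd]
    by_cases hN : Even N
    · rw [if_pos (by grind), if_pos hN]
      exact csch_mul_csch hx hN0 (by grind) (by grind)
    · rw [if_neg (by grind), if_neg hN, mul_zero, zero_mul]
  · rw [cschOdd, if_neg (by grind), zero_mul]

/-- Exponential decay at rate `x` of a sequence indexed by the integers. -/
def ExpDecay (x : ℝ) (w : ℤ → ℝ) : Prop := ∃ C, ∀ n : ℤ, |w n| ≤ C * exp (-x * |(n : ℝ)|)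

/-- The value at `z` of the Laurent series with coefficients `w`. -/
noncomputable def laurent (w : ℤ → ℝ) (z : ℂ) : ℂ := ∑' n : ℤ, (w n : ℂ) * z ^ n

theorem norm_zpow_le {z : ℂ} (hz : z ≠ 0) (n : ℤ) :
    ‖z ^ n‖ ≤ exp (|log ‖z‖| * |(n : ℝ)|) := by
  have h := norm_pos_iff.mpr hz
  rw [norm_zpow, ← Real.exp_log (zpow_pos h n), log_zpow, exp_le_exp, ← abs_mul, mul_comm]
  exact le_abs_self _

theorem ExpDecay.summable {x : ℝ} {w : ℤ → ℝ} (hw : ExpDecay x w) (k : ℕ) {z : ℂ} (hz : z ≠ 0)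
    (hzx : |log ‖z‖| < x) : Summable fun n : ℤ => ‖(((n : ℝ) ^ k * w n : ℝ) : ℂ) * z ^ n‖ := by
  obtain ⟨C, hC⟩ := hw
  have hC0 : 0 ≤ C := by simpa using (abs_nonneg _).trans (hC 0)
  refine Summable.of_nonneg_of_le (fun n => norm_nonneg _) (fun n => ?_)
    ((summable_int_pow_mul_exp_neg k (sub_pos.mpr hzx)).mul_left C)
  rw [norm_mul, Complex.norm_real, Real.norm_eq_abs, abs_mul, abs_pow]
  calc _ ≤ |(n : ℝ)| ^ k * (C * exp (-x * |(n : ℝ)|)) * exp (|log ‖z‖| * |(n : ℝ)|) := by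
        gcongr
        · exact hC n
        · exact norm_zpow_le hz n
    _ = C * (|(n : ℝ)| ^ k * (exp (-x * |(n : ℝ)|) * exp (|log ‖z‖| * |(n : ℝ)|))) := by ring
    _ = _ := by
        rw [← Real.exp_add]
        ring_nf

theorem ExpDecay.summable_pow {x : ℝ} {w : ℤ → ℝ} (hx : 0 < x) (hw : ExpDecay x w) (k : ℕ) :
    Summable fun n : ℤ => (n : ℝ) ^ k * w n := by
  have h := hw.summable k (z := 1) one_ne_zero (by simpa using hx)
  refine Summable.of_norm ?_
  simpa only [one_zpow, mul_one, Complex.norm_real] using h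

theorem hasSum_conv {f g : ℤ → ℝ} {z : ℂ} (hz : z ≠ 0)
    (hf : Summable fun n : ℤ => ‖(f n : ℂ) * z ^ n‖)
    (hg : Summable fun n : ℤ => ‖(g n : ℂ) * z ^ n‖) :
    HasSum (fun N : ℤ => (conv f g N : ℂ) * z ^ N) (laurent f z * laurent g z) := by
  have hs := summable_mul_of_summable_norm hf hg
  have h1 := hf.of_norm.hasSum.mul hg.of_norm.hasSum hs
  let e : ℤ × ℤ ≃ ℤ × ℤ :=
    { toFun := fun p => (p.2, p.1 - p.2)
      invFun := fun p => (p.1 + p.2, p.1)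
      left_inv := fun p => by simp
      right_inv := fun p => by simp }
  have h2 := e.hasSum_iff.mpr h1
  have h3 : HasSum (fun p : ℤ × ℤ => ((f p.2 * g (p.1 - p.2) : ℝ) : ℂ) * z ^ p.1)
      (laurent f z * laurent g z) := by
    refine h2.congr_fun fun p => ?_
    simp only [e, Function.comp, Equiv.coe_fn_mk]
    rw [show z ^ p.1 = z ^ p.2 * z ^ (p.1 - p.2) by rw [← zpow_add₀ hz]; ring_nf]
    push_cast
    ring
  have h4 := h3.prod_fiberwise fun N => (h3.summable.prod_factor N).hasSum
  refine h4.congr_fun fun N => ?_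
  rw [conv, Complex.ofReal_tsum, ← tsum_mul_right]

theorem laurent_conv {f g : ℤ → ℝ} {z : ℂ} (hz : z ≠ 0)
    (hf : Summable fun n : ℤ => ‖(f n : ℂ) * z ^ n‖)
    (hg : Summable fun n : ℤ => ‖(g n : ℂ) * z ^ n‖) :
    laurent (conv f g) z = laurent f z * laurent g z :=
  (hasSum_conv hz hf hg).tsum_eq

theorem one_div_cosh_le (y : ℝ) : 1 / cosh y ≤ 2 * exp (-|y|) := by
  rw [div_le_iff₀ (cosh_pos y), ← cosh_abs y, cosh_eq]
  have : exp (-|y|) * exp |y| = 1 := by rw [← Real.exp_add]; simp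
  nlinarith [exp_pos (-|y|)]

theorem expDecay_sech {x : ℝ} (hx : 0 < x) : ExpDecay x fun n => 1 / cosh (n * x) := by
  refine ⟨2, fun n => ?_⟩
  have := one_div_cosh_le (n * x)
  rw [abs_mul, abs_of_pos hx] at this
  rw [abs_of_pos (one_div_pos.mpr (cosh_pos _)), neg_mul, mul_comm x]
  exact this

theorem expDecay_sechOdd {x : ℝ} (hx : 0 < x) : ExpDecay x (sechOdd x) := by
  obtain ⟨C, hC⟩ := expDecay_sech hx
  refine ⟨C, fun n => (?_ : _ ≤ _).trans (hC n)⟩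
  unfold sechOdd
  split_ifs <;> simp

theorem expDecay_sechEven {x : ℝ} (hx : 0 < x) : ExpDecay x (sechEven x) := by
  obtain ⟨C, hC⟩ := expDecay_sech hx
  refine ⟨C, fun n => (?_ : _ ≤ _).trans (hC n)⟩
  unfold sechEven
  split_ifs <;> simp

theorem expDecay_cschOdd {x : ℝ} (hx : 0 < x) : ExpDecay x (cschOdd x) := by
  obtain ⟨C, hC⟩ := expDecay_sech hx
  have hs := sinh_pos_iff.mpr hx
  refine ⟨(1 + 1 / sinh x) * C, fun n => ?_⟩
  have hn := hC n
  rw [mul_assoc]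
  refine le_trans ?_ (mul_le_mul_of_nonneg_left hn (by positivity))
  unfold cschOdd
  split_ifs with h
  · have hb := sinh_le_abs_sinh_int_mul hx (n := n) (by rintro rfl; simp at h)
    have hpos := hs.trans_le hb
    rw [abs_div, abs_one, abs_of_pos (one_div_pos.mpr (cosh_pos _)), ← mul_div_assoc, mul_one,
      div_le_div_iff₀ hpos (cosh_pos _), one_mul, ← cosh_abs, add_mul, one_mul]
    have h1 : cosh |n * x| = |sinh (n * x)| + exp (-|n * x|) := by
      rw [abs_sinh, ← cosh_sub_sinh]
      ring
    have h2 : exp (-|n * x|) ≤ 1 := exp_le_one_iff.mpr (neg_nonpos.mpr (abs_nonneg _))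
    have h3 : 1 ≤ 1 / sinh x * |sinh (n * x)| := by
      rw [one_div_mul_eq_div, one_le_div hs]
      exact hb
    linarith
  · simp only [abs_zero]
    positivity

theorem intCast_mul_conv {x : ℝ} (hx : 0 < x) {f g : ℤ → ℝ} (hf : ExpDecay x f)
    (hg : ExpDecay x g) (N : ℤ) :
    N * conv f g N = conv (fun n => n * f n) g N + conv f (fun n => n * g n) N := by
  have hb : ∀ h : ℤ → ℝ, ExpDecay x h → ∃ C, ∀ n, |h n| ≤ C := by
    rintro h ⟨C, hC⟩
    have hC0 : 0 ≤ C := by simpa using (abs_nonneg _).trans (hC 0)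
    exact ⟨C, fun n => (hC n).trans (mul_le_of_le_one_right hC0
      (exp_le_one_iff.mpr (by nlinarith [abs_nonneg (n : ℝ)])))⟩
  obtain ⟨C, hC⟩ := hb g hg
  have s1 : Summable fun j : ℤ => j * f j * g (N - j) := by
    have := (hf.summable_pow hx 1).abs.mul_right C
    refine Summable.of_norm_bounded this fun j => ?_
    rw [pow_one, norm_mul, Real.norm_eq_abs, Real.norm_eq_abs]
    gcongr
    exact hC _
  have s0 : Summable fun j : ℤ => f j * g (N - j) := by
    have := (hf.summable_pow hx 0).abs.mul_right C
    refine Summable.of_norm_bounded this fun j => ?_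
    rw [pow_zero, one_mul, norm_mul, Real.norm_eq_abs, Real.norm_eq_abs]
    gcongr
    exact hC _
  have s2 : Summable fun j : ℤ => f j * ((N - j : ℤ) * g (N - j)) := by
    refine ((s0.mul_left (N : ℝ)).sub s1).congr fun j => ?_
    push_cast
    ring
  rw [conv, conv, conv, ← s1.tsum_add s2, ← tsum_mul_left]
  congr 1
  ext j
  push_cast
  ring

section LambertODE

variable {x : ℝ} {z : ℂ}

theorem ExpDecay.summable_zero {w : ℤ → ℝ} (hw : ExpDecay x w) (hz : z ≠ 0)
    (hzx : |log ‖z‖| < x) : Summable fun n : ℤ => ‖(w n : ℂ) * z ^ n‖ := by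
  simpa using hw.summable 0 hz hzx

theorem ExpDecay.summable_one {w : ℤ → ℝ} (hw : ExpDecay x w) (hz : z ≠ 0)
    (hzx : |log ‖z‖| < x) : Summable fun n : ℤ => ‖((n * w n : ℝ) : ℂ) * z ^ n‖ := by
  simpa using hw.summable 1 hz hzx

theorem laurent_sq_sub_sq {f g : ℤ → ℝ} (hf : ExpDecay x f) (hg : ExpDecay x g) (hz : z ≠ 0)
    (hzx : |log ‖z‖| < x) (h : ∀ N ≠ 0, conv f f N = conv g g N) :
    laurent f z ^ 2 - laurent g z ^ 2 = ((conv f f 0 - conv g g 0 : ℝ) : ℂ) := by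
  have h1 := hasSum_conv hz (hf.summable_zero hz hzx) (hf.summable_zero hz hzx)
  have h2 := hasSum_conv hz (hg.summable_zero hz hzx) (hg.summable_zero hz hzx)
  have h3 := h1.sub h2
  have h4 : HasSum (fun N : ℤ => (conv f f N : ℂ) * z ^ N - (conv g g N : ℂ) * z ^ N) _ :=
    hasSum_single 0 fun N hN => by rw [h N hN, sub_self]
  rw [pow_two, pow_two, h3.unique h4]
  simp

theorem laurent_cschOdd_one : laurent (cschOdd x) 1 = 0 := by
  have h : laurent (cschOdd x) 1 = -laurent (cschOdd x) 1 := by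
    conv_lhs => rw [laurent, ← (Equiv.neg ℤ).tsum_eq]
    rw [laurent, ← tsum_neg]
    congr 1
    ext n
    simp only [cschOdd, Equiv.neg_apply, one_zpow, mul_one, odd_neg]
    split_ifs
    · simp [div_neg]
    · simp
  exact self_eq_neg.mp h

theorem laurent_sechOdd_ode (hx : 0 < x) (hz : z ≠ 0) (hzx : |log ‖z‖| < x) :
    laurent (fun n => (n : ℝ) ^ 2 * sechOdd x n) z = laurent (sechOdd x) z *
      (2 * laurent (sechOdd x) z ^ 2 + laurent (sechEven x) 1 ^ 2 -
        2 * laurent (sechOdd x) 1 ^ 2) := by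
  have ds := expDecay_sechOdd hx
  have dd := expDecay_sechEven hx
  have dc := expDecay_cschOdd hx
  have one0 : (1 : ℂ) ≠ 0 := one_ne_zero
  have one1 : |log ‖(1 : ℂ)‖| < x := by simpa using hx
  have e1 : (fun n : ℤ => (n : ℝ) ^ 2 * sechOdd x n) = fun N => conv (fun n => n * cschOdd x n)
      (sechEven x) N + conv (cschOdd x) (fun n => n * sechEven x n) N := by
    ext N
    rw [← intCast_mul_conv hx dc dd, conv_cschOdd_sechEven hx]
    ring
  have h1 := hasSum_conv hz (dc.summable_one hz hzx) (dd.summable_zero hz hzx)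
  have h2 := hasSum_conv hz (dc.summable_zero hz hzx) (dd.summable_one hz hzx)
  have h3 := (h1.add h2).tsum_eq
  have h4 : laurent (fun n => n * cschOdd x n) z =
      laurent (sechOdd x) z * laurent (sechEven x) z := by
    rw [← laurent_conv hz (ds.summable_zero hz hzx) (dd.summable_zero hz hzx)]
    congr 1
    exact (funext (conv_sechOdd_sechEven hx)).symm
  have h5 : laurent (fun n => n * sechEven x n) z =
      laurent (cschOdd x) z * laurent (sechOdd x) z := by
    rw [← laurent_conv hz (dc.summable_zero hz hzx) (ds.summable_zero hz hzx)]
    congr 1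
    exact (funext (conv_cschOdd_sechOdd hx)).symm
  have hsd : ∀ N ≠ 0, conv (sechOdd x) (sechOdd x) N = conv (sechEven x) (sechEven x) N :=
    fun N hN => by rw [conv_sechOdd_self hx hN, conv_sechEven_self hx hN]
  have hsc : ∀ N ≠ 0, conv (sechOdd x) (sechOdd x) N = conv (cschOdd x) (cschOdd x) N :=
    fun N hN => by rw [conv_sechOdd_self hx hN, conv_cschOdd_self hx hN]
  have a1 := laurent_sq_sub_sq ds dd hz hzx hsd
  have a2 := laurent_sq_sub_sq ds dc hz hzx hsc
  rw [← laurent_sq_sub_sq ds dd one0 one1 hsd] at a1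
  rw [← laurent_sq_sub_sq ds dc one0 one1 hsc, laurent_cschOdd_one] at a2
  rw [e1, laurent]
  simp only [Complex.ofReal_add, add_mul]
  rw [h3, h4, h5]
  linear_combination (-laurent (sechOdd x) z) * (a1 + a2)

theorem laurent_sechEven_ode (hx : 0 < x) :
    laurent (fun n => (n : ℝ) ^ 2 * sechEven x n) 1 =
      laurent (sechEven x) 1 * laurent (sechOdd x) 1 ^ 2 := by
  have ds := expDecay_sechOdd hx
  have dd := expDecay_sechEven hx
  have dc := expDecay_cschOdd hx
  have hz : (1 : ℂ) ≠ 0 := one_ne_zero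
  have hzx : |log ‖(1 : ℂ)‖| < x := by simpa using hx
  have e1 : (fun n : ℤ => (n : ℝ) ^ 2 * sechEven x n) = fun N => conv (fun n => n * cschOdd x n)
      (sechOdd x) N + conv (cschOdd x) (fun n => n * sechOdd x n) N := by
    ext N
    rw [← intCast_mul_conv hx dc ds, conv_cschOdd_sechOdd hx]
    ring
  have h1 := hasSum_conv hz (dc.summable_one hz hzx) (ds.summable_zero hz hzx)
  have h2 := hasSum_conv hz (dc.summable_zero hz hzx) (ds.summable_one hz hzx)
  have h3 := (h1.add h2).tsum_eq
  have h4 : laurent (fun n => n * cschOdd x n) 1 =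
      laurent (sechOdd x) 1 * laurent (sechEven x) 1 := by
    rw [← laurent_conv hz (ds.summable_zero hz hzx) (dd.summable_zero hz hzx)]
    congr 1
    exact (funext (conv_sechOdd_sechEven hx)).symm
  rw [e1, laurent]
  simp only [Complex.ofReal_add, add_mul]
  rw [h3, h4, laurent_cschOdd_one]
  ring

end LambertODE

/-- The theta series with characteristic `c`. -/
noncomputable def thetaChar (c x : ℝ) : ℝ := ∑' n : ℤ, exp (-((n : ℝ) + c) ^ 2 * x)

/-- The alternating theta series with characteristic `c`. -/
noncomputable def thetaCharAlt (c x : ℝ) : ℝ :=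
  ∑' n : ℤ, (-1 : ℝ) ^ n * exp (-((n : ℝ) + c) ^ 2 * x)

theorem summable_thetaChar (c : ℝ) {x : ℝ} (hx : 0 < x) :
    Summable fun n : ℤ => exp (-((n : ℝ) + c) ^ 2 * x) := by
  simpa using summable_pow_mul_exp_neg_sq 0 c hx

theorem summable_thetaCharAlt (c : ℝ) {x : ℝ} (hx : 0 < x) :
    Summable fun n : ℤ => (-1 : ℝ) ^ n * exp (-((n : ℝ) + c) ^ 2 * x) := by
  refine Summable.of_norm ?_
  simpa [abs_neg_one_zpow] using summable_thetaChar c hx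

theorem thetaChar_neg (c x : ℝ) : thetaChar (-c) x = thetaChar c x := by
  rw [thetaChar, ← (Equiv.neg ℤ).tsum_eq, thetaChar]
  congr 1
  ext n
  simp only [Equiv.neg_apply, Int.cast_neg]
  ring_nf

theorem thetaChar_add_one (c x : ℝ) : thetaChar (c + 1) x = thetaChar c x := by
  conv_rhs => rw [thetaChar, ← (Equiv.addRight (1 : ℤ)).tsum_eq]
  rw [thetaChar]
  congr 1
  ext n
  simp only [Equiv.coe_addRight, Int.cast_add, Int.cast_one]
  ring_nf

theorem thetaCharAlt_half (x : ℝ) : thetaCharAlt (1 / 2) x = 0 :=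
  tsum_neg_one_zpow_theta2

theorem tsum_int_even_odd {E : Type*} [NormedAddCommGroup E] [CompleteSpace E] {f : ℤ → E}
    (hf : Summable f) :
    ∑' n, f n = ∑' n, f (2 * n) + ∑' n, f (2 * n + 1) := by
  have i0 : Function.Injective (fun n : ℤ => 2 * n) := fun a b h => by
    simp only at h
    omega
  have i1 : Function.Injective (fun n : ℤ => 2 * n + 1) := fun a b h => by
    simp only at h
    omega
  have hc : IsCompl (Set.range (fun n : ℤ => 2 * n)) (Set.range (fun n : ℤ => 2 * n + 1)) := by
    rw [isCompl_iff, Set.disjoint_left, codisjoint_iff]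
    refine ⟨?_, Set.eq_univ_iff_forall.2 ?_⟩
    · rintro m ⟨a, h⟩ ⟨b, h'⟩
      simp only at h h'
      omega
    · intro m
      rcases Int.even_or_odd' m with ⟨k, hk | hk⟩
      · exact Or.inl ⟨k, hk.symm⟩
      · exact Or.inr ⟨k, hk.symm⟩
  have h0 := (i0.hasSum_range_iff (f := f)).2 (hf.comp_injective i0).hasSum
  have h1 := (i1.hasSum_range_iff (f := f)).2 (hf.comp_injective i1).hasSum
  exact (h0.add_isCompl hc h1).tsum_eq

theorem thetaChar_eq_add (c : ℝ) {x : ℝ} (hx : 0 < x) :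
    thetaChar c x = thetaChar (c / 2) (4 * x) + thetaChar ((c + 1) / 2) (4 * x) := by
  rw [thetaChar, tsum_int_even_odd (summable_thetaChar c hx), thetaChar, thetaChar]
  congr 2 <;> ext n <;> push_cast <;> ring_nf

theorem thetaCharAlt_eq_sub (c : ℝ) {x : ℝ} (hx : 0 < x) :
    thetaCharAlt c x = thetaChar (c / 2) (4 * x) - thetaChar ((c + 1) / 2) (4 * x) := by
  rw [thetaCharAlt, tsum_int_even_odd (summable_thetaCharAlt c hx), thetaChar, thetaChar,
    sub_eq_add_neg, ← tsum_neg]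
  congr 2 <;> ext n
  · rw [zpow_mul]
    push_cast
    norm_num
    ring_nf
  · rw [zpow_add₀ (by norm_num), zpow_mul]
    push_cast
    norm_num
    ring_nf

theorem thetaCharAlt_mul (c d : ℝ) {x : ℝ} (hx : 0 < x) :
    thetaCharAlt c x * thetaCharAlt d x =
      thetaChar ((c + d) / 2) (2 * x) * thetaChar ((c - d) / 2) (2 * x) -
      thetaChar ((c + d + 1) / 2) (2 * x) * thetaChar ((c - d + 1) / 2) (2 * x) := by
  have h2 : 0 < 2 * x := by positivity
  rw [thetaCharAlt, thetaCharAlt,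
    tsum_mul_tsum_int_parity (summable_thetaCharAlt c hx) (summable_thetaCharAlt d hx),
    thetaChar, thetaChar, thetaChar, thetaChar, sub_eq_add_neg, ← neg_mul, ← tsum_neg,
    tsum_mul_tsum_int (summable_thetaChar _ h2) (summable_thetaChar _ h2),
    tsum_mul_tsum_int (summable_thetaChar _ h2).neg (summable_thetaChar _ h2)]
  congr 2 <;> ext ⟨a, b⟩
  · rw [mul_mul_mul_comm, neg_one_zpow_add_mul_sub, one_mul, ← Real.exp_add, ← Real.exp_add]
    push_cast
    ring_nf
  · have hs : (-1 : ℝ) ^ (a + b + 1) * (-1) ^ (a - b) = -1 := by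
      rw [zpow_add_one₀ (by norm_num), mul_right_comm, neg_one_zpow_add_mul_sub, one_mul]
    rw [mul_mul_mul_comm, hs, neg_mul (rexp _), neg_mul (1 : ℝ), one_mul, ← Real.exp_add,
      ← Real.exp_add]
    push_cast
    ring_nf

theorem thetaChar_mul_thetaCharAlt (c d : ℝ) {x : ℝ} (hx : 0 < x) :
    thetaChar c x * thetaCharAlt d x =
      thetaCharAlt ((c + d) / 2) (2 * x) * thetaCharAlt ((c - d) / 2) (2 * x) +
      thetaCharAlt ((c + d + 1) / 2) (2 * x) * thetaCharAlt ((c - d + 1) / 2) (2 * x) := by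
  have h2 : 0 < 2 * x := by positivity
  have e : ∀ a b : ℤ, (-1 : ℝ) ^ (a - b) = (-1) ^ a * (-1) ^ b := fun a b => by
    rw [zpow_sub₀ (by norm_num), div_eq_mul_inv, ← inv_zpow]
    norm_num
  rw [thetaChar, thetaCharAlt,
    tsum_mul_tsum_int_parity (summable_thetaChar c hx) (summable_thetaCharAlt d hx),
    thetaCharAlt, thetaCharAlt, thetaCharAlt, thetaCharAlt,
    tsum_mul_tsum_int (summable_thetaCharAlt _ h2) (summable_thetaCharAlt _ h2),
    tsum_mul_tsum_int (summable_thetaCharAlt _ h2) (summable_thetaCharAlt _ h2)]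
  congr 2 <;> ext ⟨a, b⟩
  · rw [mul_mul_mul_comm, mul_left_comm, ← Real.exp_add, ← Real.exp_add, e]
    push_cast
    ring_nf
  · rw [mul_mul_mul_comm, mul_left_comm, ← Real.exp_add, ← Real.exp_add, e]
    push_cast
    ring_nf

theorem theta2_eq_thetaChar (x : ℝ) : theta2 x = thetaChar (1 / 2) x := rfl

theorem theta4_eq_thetaCharAlt (x : ℝ) : theta4 x = thetaCharAlt 0 x := by
  simp [theta4, thetaCharAlt]

theorem theta2_eq_two_mul_thetaChar_quarter {x : ℝ} (hx : 0 < x) :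
    theta2 x = 2 * thetaChar (1 / 4) (4 * x) := by
  rw [theta2_eq_thetaChar, thetaChar_eq_add _ hx, ← thetaChar_neg ((1 / 2 + 1) / 2),
    ← thetaChar_add_one (-_)]
  norm_num
  ring

theorem tendsto_tsum_int_of_le {F : ℝ → ℤ → ℝ} (C : ℝ) (h0 : ∀ t, F t 0 = 1)
    (h : ∀ t, 0 < t → ∀ n, |F t n| ≤ C * exp (-t * |(n : ℝ)|)) :
    Tendsto (fun t => ∑' n, F t n) atTop (𝓝 1) := by
  have hC : 0 ≤ C := by
    have := (abs_nonneg _).trans (h 1 one_pos 0)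
    simpa using this
  have hs : ∑' n : ℤ, (if n = 0 then (1 : ℝ) else 0) = 1 := tsum_ite_eq 0 _
  rw [← hs]
  have hb := (summable_int_pow_mul_exp_neg 0 one_pos).mul_left C
  refine tendsto_tsum_of_dominated_convergence hb (fun n => ?_) ?_
  · split_ifs with hn
    · simp [hn, h0]
    · have hn' : 0 < |(n : ℝ)| := by positivity
      have : Tendsto (fun t => C * exp (-t * |(n : ℝ)|)) atTop (𝓝 0) := by
        have h1 : Tendsto (fun t : ℝ => -t * |(n : ℝ)|) atTop atBot :=
          (tendsto_neg_atTop_atBot).atBot_mul_const hn'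
        simpa using (tendsto_exp_atBot.comp h1).const_mul C
      refine squeeze_zero_norm' ?_ this
      filter_upwards [eventually_gt_atTop 0] with t ht
      exact h t ht n
  · filter_upwards [eventually_ge_atTop 1] with t ht n
    refine (h t (by linarith) n).trans ?_
    rw [pow_zero, one_mul]
    gcongr

theorem abs_int_le_two_sq_add (n : ℤ) : |(n : ℝ)| ≤ 2 * n ^ 2 + n := by
  have h : |n| ≤ 2 * n ^ 2 + n := by
    rcases abs_cases n with ⟨h, h'⟩ | ⟨h, h'⟩ <;> rw [h] <;> nlinarith
  exact_mod_cast h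

theorem tendsto_thetaChar_quarter :
    Tendsto (fun x => exp (x / 16) * thetaChar (1 / 4) x) atTop (𝓝 1) := by
  have h := tendsto_tsum_int_of_le (F := fun t n => exp (-t * (2 * (n : ℝ) ^ 2 + n))) 1
    (by simp) fun t ht n => by
      rw [abs_of_pos (exp_pos _), one_mul, exp_le_exp]
      nlinarith [abs_int_le_two_sq_add n]
  refine (h.comp (tendsto_id.atTop_div_const (two_pos : (0 : ℝ) < 2))).congr fun x => ?_
  rw [Function.comp_apply, thetaChar, ← tsum_mul_left]
  refine tsum_congr fun n => ?_
  rw [← Real.exp_add, id]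
  ring_nf

theorem tendsto_thetaCharAlt_quarter :
    Tendsto (fun x => exp (x / 16) * thetaCharAlt (1 / 4) x) atTop (𝓝 1) := by
  have h := tendsto_tsum_int_of_le
    (F := fun t n => (-1 : ℝ) ^ n * exp (-t * (2 * (n : ℝ) ^ 2 + n))) 1
    (by simp) fun t ht n => by
      rw [abs_mul, abs_neg_one_zpow, abs_of_pos (exp_pos _), one_mul, one_mul, exp_le_exp]
      nlinarith [abs_int_le_two_sq_add n]
  refine (h.comp (tendsto_id.atTop_div_const (two_pos : (0 : ℝ) < 2))).congr fun x => ?_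
  rw [Function.comp_apply, thetaCharAlt, ← tsum_mul_left]
  refine tsum_congr fun n => ?_
  rw [mul_left_comm, ← Real.exp_add, id]
  ring_nf

theorem thetaChar_pos (c : ℝ) {x : ℝ} (hx : 0 < x) : 0 < thetaChar c x :=
  (summable_thetaChar c hx).tsum_pos (fun _ => (exp_pos _).le) 0 (exp_pos _)

theorem thetaCharAlt_quarter_mul_theta3 {x : ℝ} (hx : 0 < x) :
    thetaCharAlt (1 / 4) (2 * x) * theta3 x = theta4 (2 * x) * thetaChar (1 / 4) (2 * x) := by
  have key : (fun x => thetaCharAlt (1 / 4) (2 * x) * theta3 x /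
      (theta4 (2 * x) * thetaChar (1 / 4) (2 * x))) x = 1 := by
    refine eq_of_tendsto_of_two_mul (f := fun x => thetaCharAlt (1 / 4) (2 * x) * theta3 x /
      (theta4 (2 * x) * thetaChar (1 / 4) (2 * x))) ?_ (fun x hx => ?_) hx
    · have t2 : Tendsto (fun x : ℝ => 2 * x) atTop atTop :=
        tendsto_id.const_mul_atTop two_pos
      have h := ((tendsto_thetaCharAlt_quarter.comp t2).mul tendsto_theta3).div
        ((tendsto_theta4.comp t2).mul (tendsto_thetaChar_quarter.comp t2)) (by norm_num)
      simp only [mul_one, div_one] at h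
      refine h.congr fun x => ?_
      simp only [Function.comp_apply, Pi.div_apply]
      rw [mul_assoc, mul_left_comm (theta4 _), mul_div_mul_left _ _ (exp_pos _).ne']
    · have h2 : 0 < 2 * x := by positivity
      have h4 : 0 < 2 * (2 * x) := by positivity
      have e1 := thetaChar_mul_thetaCharAlt (1 / 4) (1 / 4) h2
      norm_num at e1
      rw [thetaCharAlt_half, mul_zero, add_zero,
        ← theta4_eq_thetaCharAlt] at e1
      have e2 := theta2_sq (half_pos hx)
      rw [theta2_eq_two_mul_thetaChar_quarter (half_pos hx), mul_div_cancel₀ x two_ne_zero,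
        theta2_eq_two_mul_thetaChar_quarter hx,
        show 4 * (x / 2) = 2 * x by ring, show 4 * x = 2 * (2 * x) by ring] at e2
      have e3 := theta3_mul_theta4 h2
      have p1 := thetaChar_pos (1 / 4) h2
      have p2 := thetaChar_pos (1 / 4) h4
      have p3 := theta4_pos h2
      have p4 := theta4_pos h4
      have p5 := theta3_pos hx
      rw [div_eq_div_iff (by positivity) (by positivity)]
      apply mul_right_cancel₀ (mul_pos p4 p1).ne'
      linear_combination
        (-theta3 (2 * x) * theta4 (2 * x) * thetaChar (1 / 4) (2 * x) ^ 2) * e1 +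
        thetaCharAlt (1 / 4) (2 * x) * theta4 (2 * (2 * x)) ^ 2 *
          thetaChar (1 / 4) (2 * x) * e2 / 4 +
        (thetaChar (1 / 4) (2 * x) ^ 3 * thetaCharAlt (1 / 4) (2 * x)) * e3
  rwa [div_eq_one_iff_eq] at key
  exact (mul_pos (theta4_pos (by positivity)) (thetaChar_pos _ (by positivity))).ne'

/-- The hyperbolic secant sequence. -/
noncomputable def sechInt (x : ℝ) (n : ℤ) : ℝ := 1 / cosh (n * x)

/-- The Gaussian sequence. -/
noncomputable def gaussInt (x : ℝ) (n : ℤ) : ℝ := exp (-(n : ℝ) ^ 2 * x)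

/-- The alternating Gaussian sequence. -/
noncomputable def gaussIntAlt (x : ℝ) (n : ℤ) : ℝ := (-1) ^ n * exp (-(n : ℝ) ^ 2 * x)

theorem expDecay_sechInt {x : ℝ} (hx : 0 < x) : ExpDecay x (sechInt x) := expDecay_sech hx

theorem expDecay_gaussInt {x : ℝ} (hx : 0 < x) : ExpDecay x (gaussInt x) := by
  refine ⟨1, fun n => ?_⟩
  rw [gaussInt, abs_of_pos (exp_pos _), one_mul, exp_le_exp]
  have h : |(n : ℝ)| ≤ (n : ℝ) ^ 2 := by
    rw [← sq_abs]
    have : |n| ≤ |n| ^ 2 := by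
      rcases eq_or_ne n 0 with rfl | h
      · simp
      · nlinarith [Int.one_le_abs h]
    exact_mod_cast this
  nlinarith

theorem expDecay_gaussIntAlt {x : ℝ} (hx : 0 < x) : ExpDecay x (gaussIntAlt x) := by
  obtain ⟨C, hC⟩ := expDecay_gaussInt hx
  refine ⟨C, fun n => ?_⟩
  rw [gaussIntAlt, abs_mul, abs_neg_one_zpow, one_mul]
  exact hC n

theorem ExpDecay.bounded {x : ℝ} (hx : 0 < x) {h : ℤ → ℝ} (hh : ExpDecay x h) :
    ∃ C, ∀ n, |h n| ≤ C := by
  obtain ⟨C, hC⟩ := hh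
  have hC0 : 0 ≤ C := by simpa using (abs_nonneg _).trans (hC 0)
  exact ⟨C, fun n => (hC n).trans (mul_le_of_le_one_right hC0
    (exp_le_one_iff.mpr (by nlinarith [abs_nonneg (n : ℝ)])))⟩

theorem ExpDecay.summable_conv {x : ℝ} (hx : 0 < x) {f g : ℤ → ℝ} (hf : ExpDecay x f)
    (hg : ExpDecay x g) (N : ℤ) : Summable fun j : ℤ => f j * g (N - j) := by
  obtain ⟨C, hC⟩ := hg.bounded hx
  have := (hf.summable_pow hx 0).abs.mul_right C
  refine Summable.of_norm_bounded this fun j => ?_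
  rw [pow_zero, one_mul, norm_mul, Real.norm_eq_abs, Real.norm_eq_abs]
  gcongr
  exact hC _

theorem conv_sechInt_gaussIntAlt_sub_one {x : ℝ} (hx : 0 < x) (N : ℤ) :
    conv (sechInt x) (gaussIntAlt x) N =
      exp (-(2 * N - 1) * x) * conv (sechInt x) (gaussIntAlt x) (N - 1) := by
  have hd := expDecay_sechInt hx
  have hg := expDecay_gaussIntAlt hx
  rw [← sub_eq_zero, conv, conv, ← tsum_mul_left,
    ← (hd.summable_conv hx hg N).tsum_sub ((hd.summable_conv hx hg (N - 1)).mul_left _)]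
  have h0 := tsum_neg_one_zpow_theta2 (x := x)
  rw [← (Equiv.addLeft N).tsum_eq]
  have e : ∀ m : ℤ, sechInt x (Equiv.addLeft N m) * gaussIntAlt x (N - Equiv.addLeft N m) -
      exp (-(2 * N - 1) * x) * (sechInt x (Equiv.addLeft N m) *
        gaussIntAlt x (N - 1 - Equiv.addLeft N m)) =
      2 * exp (-(N - 1 / 4) * x) * ((-1) ^ m * exp (-((m : ℝ) + 1 / 2) ^ 2 * x)) := fun m => by
    have s0 : (-1 : ℝ) ^ (-m) = (-1) ^ m := by
      rw [zpow_neg, ← inv_zpow]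
      norm_num
    have s1 : (-1 : ℝ) ^ (-m - 1) = -(-1) ^ m := by
      rw [zpow_sub_one₀ (by norm_num), s0]
      norm_num
    have hc : (exp ((N + m) * x) + exp (-((N + m) * x))) ≠ 0 := by positivity
    rw [Equiv.coe_addLeft, show N - (N + m) = -m by ring, show N - 1 - (N + m) = -m - 1 by ring,
      sechInt, gaussIntAlt, gaussIntAlt, s0, s1, cosh_eq]
    push_cast
    field_simp
    simp only [sub_neg_eq_add, add_mul (rexp _), ← Real.exp_add]
    congr 2 <;> ring
  rw [tsum_congr e, tsum_mul_left, h0, mul_zero]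

theorem conv_sechInt_gaussIntAlt {x : ℝ} (hx : 0 < x) (N : ℤ) :
    conv (sechInt x) (gaussIntAlt x) N =
      conv (sechInt x) (gaussIntAlt x) 0 * gaussInt x N := by
  induction N using Int.induction_on with
  | zero => simp [gaussInt]
  | succ i ih =>
    rw [conv_sechInt_gaussIntAlt_sub_one hx, add_sub_cancel_right, ih, mul_left_comm, gaussInt,
      gaussInt, ← Real.exp_add]
    push_cast
    ring_nf
  | pred i ih =>
    have h := conv_sechInt_gaussIntAlt_sub_one hx (-i)
    rw [ih] at h
    have : exp (-(2 * (-i : ℤ) - 1) * x) ≠ 0 := (exp_pos _).ne'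
    apply mul_left_cancel₀ this
    rw [← h, mul_left_comm, gaussInt, gaussInt, ← Real.exp_add]
    push_cast
    ring_nf

theorem laurent_sechInt_mul {x : ℝ} (hx : 0 < x) {z : ℂ} (hz : z ≠ 0) (hzx : |log ‖z‖| < x) :
    laurent (sechInt x) z * laurent (gaussIntAlt x) z =
      conv (sechInt x) (gaussIntAlt x) 0 * laurent (gaussInt x) z := by
  have s : ∀ {w}, ExpDecay x w → Summable fun n : ℤ => ‖(w n : ℂ) * z ^ n‖ := fun hw => by
    simpa using hw.summable 0 hz hzx
  rw [← laurent_conv hz (s (expDecay_sechInt hx)) (s (expDecay_gaussIntAlt hx)), laurent, laurent,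
    ← tsum_mul_left]
  refine tsum_congr fun n => ?_
  rw [conv_sechInt_gaussIntAlt hx n]
  push_cast
  ring

theorem laurent_one (w : ℤ → ℝ) : laurent w 1 = ((∑' n, w n : ℝ) : ℂ) := by
  simp [laurent, Complex.ofReal_tsum]

theorem laurent_neg_one (w : ℤ → ℝ) : laurent w (-1) = ((∑' n, (-1) ^ n * w n : ℝ) : ℂ) := by
  rw [laurent, Complex.ofReal_tsum]
  refine tsum_congr fun n => ?_
  push_cast
  ring

theorem tendsto_tsum_sechInt : Tendsto (fun x => ∑' n, sechInt x n) atTop (𝓝 1) := by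
  refine tendsto_tsum_int_of_le 2 (fun t => by simp [sechInt]) fun t ht n => ?_
  have := one_div_cosh_le (n * t)
  rw [abs_mul, abs_of_pos ht] at this
  rw [sechInt, abs_of_pos (one_div_pos.mpr (cosh_pos _)), neg_mul, mul_comm t]
  exact this

theorem tsum_gaussInt (x : ℝ) : ∑' n, gaussInt x n = theta3 x := rfl

theorem tsum_gaussIntAlt (x : ℝ) : ∑' n, gaussIntAlt x n = theta4 x := rfl

theorem neg_one_zpow_mul_gaussIntAlt (x : ℝ) (n : ℤ) :
    (-1 : ℝ) ^ n * gaussIntAlt x n = gaussInt x n := by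
  rw [gaussIntAlt, ← mul_assoc, ← mul_zpow, gaussInt]
  norm_num

theorem tsum_sechInt_mul_theta4 {x : ℝ} (hx : 0 < x) :
    (∑' n, sechInt x n) * theta4 x = conv (sechInt x) (gaussIntAlt x) 0 * theta3 x := by
  have h := laurent_sechInt_mul hx one_ne_zero (by simpa using hx)
  rw [laurent_one, laurent_one, laurent_one, tsum_gaussInt, tsum_gaussIntAlt] at h
  exact_mod_cast h

theorem tsum_alt_sechInt_mul_theta3 {x : ℝ} (hx : 0 < x) :
    (∑' n : ℤ, (-1) ^ n * sechInt x n) * theta3 x =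
      conv (sechInt x) (gaussIntAlt x) 0 * theta4 x := by
  have h := laurent_sechInt_mul hx (z := -1) (by norm_num) (by simpa using hx)
  rw [laurent_neg_one, laurent_neg_one, laurent_neg_one] at h
  simp_rw [neg_one_zpow_mul_gaussIntAlt] at h
  rw [tsum_gaussInt, show ∑' n : ℤ, (-1 : ℝ) ^ n * gaussInt x n = theta4 x from rfl] at h
  exact_mod_cast h

theorem tsum_sechInt_add_alt {x : ℝ} (hx : 0 < x) :
    (∑' n, sechInt x n) + (∑' n : ℤ, (-1) ^ n * sechInt x n) = 2 * ∑' n, sechInt (2 * x) n := by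
  have hs : Summable (sechInt x) := by simpa using (expDecay_sechInt hx).summable_pow hx 0
  have hs' : Summable fun n : ℤ => (-1) ^ n * sechInt x n := by
    refine Summable.of_norm ?_
    simpa [abs_neg_one_zpow] using hs.norm
  rw [← hs.tsum_add hs', tsum_int_even_odd (hs.add hs'), ← tsum_mul_left]
  have h1 : ∀ n : ℤ, sechInt x (2 * n + 1) + (-1) ^ (2 * n + 1) * sechInt x (2 * n + 1) = 0 :=
    fun n => by
      rw [zpow_add₀ (by norm_num), zpow_mul]
      norm_num
  have h2 : ∀ n : ℤ, sechInt x (2 * n) + (-1) ^ (2 * n) * sechInt x (2 * n) =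
      2 * sechInt (2 * x) n := fun n => by
    rw [zpow_mul, sechInt, sechInt]
    push_cast
    rw [show 2 * n * x = n * (2 * x) by ring]
    norm_num
    ring
  rw [tsum_congr h1, tsum_congr h2, tsum_zero, add_zero]

theorem tsum_sechInt {x : ℝ} (hx : 0 < x) : ∑' n, sechInt x n = theta3 x ^ 2 := by
  have key : (fun x => (∑' n, sechInt x n) / theta3 x ^ 2) x = 1 := by
    refine eq_of_tendsto_of_two_mul (f := fun x => (∑' n, sechInt x n) / theta3 x ^ 2) ?_
      (fun x hx => ?_) hx
    · have h := tendsto_tsum_sechInt.div (tendsto_theta3.pow 2) (by norm_num)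
      rw [one_pow, div_one] at h
      exact h
    · have e1 := tsum_sechInt_mul_theta4 hx
      have e2 := tsum_alt_sechInt_mul_theta3 hx
      have e3 := tsum_sechInt_add_alt hx
      have e4 := theta3_two_mul_sq hx
      have p3 := theta3_pos hx
      have p4 := theta4_pos hx
      rw [div_eq_div_iff (pow_pos (theta3_pos (by positivity)) 2).ne' (by positivity), e4]
      linear_combination -theta3 x ^ 2 / 2 * e3 + theta3 x / 2 * e2 - theta4 x / 2 * e1
  rwa [div_eq_one_iff_eq (pow_pos (theta3_pos hx) 2).ne'] at key

theorem conv_sechInt_gaussIntAlt_zero {x : ℝ} (hx : 0 < x) :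
    conv (sechInt x) (gaussIntAlt x) 0 = theta3 x * theta4 x := by
  have h := tsum_sechInt_mul_theta4 hx
  rw [tsum_sechInt hx] at h
  apply mul_right_cancel₀ (theta3_pos hx).ne'
  linear_combination -h

theorem tsum_sechEven {x : ℝ} (hx : 0 < x) : ∑' n, sechEven x n = theta3 (2 * x) ^ 2 := by
  have hs : Summable (sechEven x) := by simpa using (expDecay_sechEven hx).summable_pow hx 0
  rw [tsum_int_even_odd hs, ← tsum_sechInt (x := 2 * x) (by positivity)]
  simp only [sechEven, sechInt, even_two_mul, Int.not_even_two_mul_add_one, if_true, if_false,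
    tsum_zero, add_zero]
  refine tsum_congr fun n => ?_
  push_cast
  ring_nf

theorem tsum_sechOdd {x : ℝ} (hx : 0 < x) : ∑' n, sechOdd x n = theta2 (2 * x) ^ 2 := by
  have hs : Summable (sechEven x) := by simpa using (expDecay_sechEven hx).summable_pow hx 0
  have hs' : Summable (sechOdd x) := by simpa using (expDecay_sechOdd hx).summable_pow hx 0
  have h : ∑' n, sechInt x n = ∑' n, sechOdd x n + ∑' n, sechEven x n := by
    rw [← hs'.tsum_add hs]
    refine tsum_congr fun n => ?_
    unfold sechInt sechOdd sechEven
    rcases Int.even_or_odd n with h | h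
    · simp [h, Int.not_odd_iff_even.mpr h]
    · simp [h, Int.not_even_iff_odd.mpr h]
  rw [tsum_sechInt hx, theta3_sq hx, tsum_sechEven hx] at h
  linarith

/-- The sum of `n² / cosh (n x)`. -/
theorem tsum_sq_mul_sechInt {x : ℝ} (hx : 0 < x) :
    ∑' n : ℤ, (n : ℝ) ^ 2 * sechInt x n = theta3 x ^ 2 * theta2 x ^ 4 / 4 := by
  have h2 := half_pos hx
  have h := laurent_sechEven_ode h2
  rw [laurent_one, laurent_one, laurent_one, tsum_sechEven h2, tsum_sechOdd h2,
    mul_div_cancel₀ x two_ne_zero] at h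
  have hs := (expDecay_sechEven h2).summable_pow h2 2
  rw [tsum_int_even_odd hs] at h
  have e : ∀ n : ℤ, ((2 * n : ℤ) : ℝ) ^ 2 * sechEven (x / 2) (2 * n) =
      4 * ((n : ℝ) ^ 2 * sechInt x n) := fun n => by
    simp [sechEven, sechInt]
    ring_nf
  have e' : ∀ n : ℤ, ((2 * n + 1 : ℤ) : ℝ) ^ 2 * sechEven (x / 2) (2 * n + 1) = 0 := fun n => by
    simp [sechEven]
  rw [tsum_congr e, tsum_congr e', tsum_zero, add_zero, tsum_mul_left] at h
  have h' : 4 * ∑' n : ℤ, (n : ℝ) ^ 2 * sechInt x n = theta3 x ^ 2 * (theta2 x ^ 2) ^ 2 := by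
    exact_mod_cast h
  linarith

theorem ExpDecay.mono {x y : ℝ} (hxy : y ≤ x) {f : ℤ → ℝ} (hf : ExpDecay x f) : ExpDecay y f := by
  obtain ⟨C, hC⟩ := hf
  have hC0 : 0 ≤ C := by simpa using (abs_nonneg _).trans (hC 0)
  refine ⟨C, fun n => (hC n).trans ?_⟩
  gcongr

theorem ExpDecay.intCast_mul {x y : ℝ} (hxy : y < x) {f : ℤ → ℝ} (hf : ExpDecay x f) :
    ExpDecay y fun n => n * f n := by
  obtain ⟨C, hC⟩ := hf
  have hC0 : 0 ≤ C := by simpa using (abs_nonneg _).trans (hC 0)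
  refine ⟨C / (x - y), fun n => ?_⟩
  have h1 : (x - y) * |(n : ℝ)| ≤ exp ((x - y) * |(n : ℝ)|) := by
    linarith [add_one_le_exp ((x - y) * |(n : ℝ)|)]
  have hxy' := sub_pos.mpr hxy
  have h2 : |(n : ℝ)| ≤ exp ((x - y) * |(n : ℝ)|) / (x - y) := by
    rwa [le_div_iff₀ hxy', mul_comm]
  calc |n * f n| = |(n : ℝ)| * |f n| := abs_mul _ _
    _ ≤ exp ((x - y) * |(n : ℝ)|) / (x - y) * (C * exp (-x * |(n : ℝ)|)) := by
        gcongr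
        exact hC n
    _ = C / (x - y) * (exp ((x - y) * |(n : ℝ)|) * exp (-x * |(n : ℝ)|)) := by ring
    _ = _ := by
        rw [← Real.exp_add]
        ring_nf

theorem hasSum_conv_real {x : ℝ} (hx : 0 < x) {f g : ℤ → ℝ} (hf : ExpDecay x f)
    (hg : ExpDecay x g) : HasSum (conv f g) ((∑' n, f n) * ∑' n, g n) := by
  have hz : |log ‖(1 : ℂ)‖| < x := by simpa using hx
  have h := hasSum_conv one_ne_zero (hf.summable_zero one_ne_zero hz)
    (hg.summable_zero one_ne_zero hz)
  simp only [one_zpow, mul_one, laurent_one, ← Complex.ofReal_mul] at h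
  exact Complex.hasSum_ofReal.mp h

theorem tsum_intCast_mul_eq_zero {f : ℤ → ℝ} (hf : ∀ n, f (-n) = f n) :
    ∑' n : ℤ, (n : ℝ) * f n = 0 := by
  have h : ∑' n : ℤ, (n : ℝ) * f n = -∑' n : ℤ, (n : ℝ) * f n := by
    conv_lhs => rw [← (Equiv.neg ℤ).tsum_eq]
    rw [← tsum_neg]
    refine tsum_congr fun n => ?_
    simp [hf]
  exact self_eq_neg.mp h

theorem sq_mul_conv {x : ℝ} (hx : 0 < x) {f g : ℤ → ℝ} (hf : ExpDecay x f) (hg : ExpDecay x g)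
    (N : ℤ) : (N : ℝ) ^ 2 * conv f g N = conv (fun n => n * (n * f n)) g N +
      2 * conv (fun n => n * f n) (fun n => n * g n) N + conv f (fun n => n * (n * g n)) N := by
  have hx2 := half_pos hx
  have hlt := half_lt_self hx
  rw [sq, mul_assoc, intCast_mul_conv hx hf hg, mul_add,
    intCast_mul_conv hx2 (hf.intCast_mul hlt) (hg.mono hlt.le),
    intCast_mul_conv hx2 (hf.mono hlt.le) (hg.intCast_mul hlt)]
  ring

theorem tsum_sq_mul_conv {x : ℝ} (hx : 0 < x) {f g : ℤ → ℝ} (hf : ExpDecay x f)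
    (hg : ExpDecay x g) (hf' : ∀ n, f (-n) = f n) :
    ∑' N : ℤ, (N : ℝ) ^ 2 * conv f g N = (∑' n : ℤ, (n : ℝ) ^ 2 * f n) * ∑' n, g n +
      (∑' n, f n) * ∑' n : ℤ, (n : ℝ) ^ 2 * g n := by
  have hx2 := half_pos hx
  have hlt := half_lt_self hx
  have hx3 : 0 < x / 3 := by positivity
  have hlt3 : x / 3 < x / 2 := by linarith
  have hlt3' : x / 3 < x := by linarith
  have h1 := hasSum_conv_real hx3 ((hf.intCast_mul hlt).intCast_mul hlt3) (hg.mono hlt3'.le)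
  have h2 := hasSum_conv_real hx2 (hf.intCast_mul hlt) (hg.intCast_mul hlt)
  have h3 := hasSum_conv_real hx3 (hf.mono hlt3'.le) ((hg.intCast_mul hlt).intCast_mul hlt3)
  have h := ((h1.add (h2.mul_left 2)).add h3).tsum_eq
  rw [tsum_intCast_mul_eq_zero hf', zero_mul, mul_zero, add_zero] at h
  simp only [sq_mul_conv hx hf hg, h]
  simp only [sq, mul_assoc]

theorem theta4_mul_sub_theta3_mul {x : ℝ} (hx : 0 < x) :
    theta4 x * (∑' n : ℤ, (n : ℝ) ^ 2 * exp (-(n : ℝ) ^ 2 * x)) -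
      theta3 x * (∑' n : ℤ, (n : ℝ) ^ 2 * ((-1) ^ n * exp (-(n : ℝ) ^ 2 * x))) =
      theta3 x * theta4 x * theta2 x ^ 4 / 4 := by
  have h := tsum_sq_mul_conv hx (expDecay_sechInt hx) (expDecay_gaussIntAlt hx)
    (fun n => by simp [sechInt])
  have hc : ∀ N : ℤ, conv (sechInt x) (gaussIntAlt x) N = theta3 x * theta4 x * gaussInt x N :=
    fun N => by rw [conv_sechInt_gaussIntAlt hx, conv_sechInt_gaussIntAlt_zero hx]
  simp only [hc] at h
  rw [tsum_sechInt hx, tsum_gaussIntAlt, tsum_sq_mul_sechInt hx] at h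
  have e : ∀ N : ℤ, (N : ℝ) ^ 2 * (theta3 x * theta4 x * gaussInt x N) =
      theta3 x * theta4 x * ((N : ℝ) ^ 2 * gaussInt x N) := fun N => by ring
  rw [tsum_congr e, tsum_mul_left] at h
  simp only [gaussInt, gaussIntAlt] at h
  apply mul_left_cancel₀ (theta3_pos hx).ne'
  linear_combination h

theorem hasDerivAt_compModulus {x : ℝ} (hx : 0 < x) :
    HasDerivAt compModulus (compModulus x * theta2 x ^ 4 / 2) x := by
  have h3 := hasDerivAt_theta3 hx
  have h4 := hasDerivAt_theta4 hx
  have hp := (theta3_pos hx).ne'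
  have h := (h4.pow 2).div (h3.pow 2) (pow_ne_zero 2 hp)
  refine h.congr_deriv ?_
  have hk := theta4_mul_sub_theta3_mul hx
  simp only [compModulus]
  generalize (∑' n : ℤ, (n : ℝ) ^ 2 * exp (-(n : ℝ) ^ 2 * x)) = A at *
  generalize (∑' n : ℤ, (n : ℝ) ^ 2 * ((-1 : ℝ) ^ n * exp (-(n : ℝ) ^ 2 * x))) = B at *
  simp only [Pi.pow_apply]
  rw [div_mul_eq_mul_div, div_div, div_eq_div_iff (by positivity) (by positivity)]
  push_cast
  linear_combination 4 * theta3 x ^ 3 * theta4 x * hk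

theorem laurent_I_mul_exp {t : ℝ} {w : ℤ → ℝ} (hw : Summable fun n : ℤ =>
      ‖(w n : ℂ) * (Complex.I * (exp t : ℝ)) ^ n‖) :
    laurent w (Complex.I * (exp t : ℝ)) =
      ((∑' m : ℤ, (-1) ^ m * (w (2 * m) * exp ((2 * m) * t)) : ℝ) : ℂ) +
      Complex.I * ((∑' m : ℤ, (-1) ^ m * (w (2 * m + 1) * exp ((2 * m + 1) * t)) : ℝ) : ℂ) := by
  rw [laurent, tsum_int_even_odd hw.of_norm, Complex.ofReal_tsum, Complex.ofReal_tsum,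
    ← tsum_mul_left]
  have hI : ∀ m : ℤ, Complex.I ^ (2 * m) = (-1) ^ m := fun m => by
    rw [zpow_mul]
    congr 1
    simp
  have he : ∀ n : ℤ, ((exp t : ℝ) : ℂ) ^ n = (exp (n * t) : ℝ) := fun n => by
    rw [mul_comm, Real.exp_mul, Real.rpow_intCast, Complex.ofReal_zpow]
  congr 1
  · refine tsum_congr fun m => ?_
    rw [mul_zpow, hI, he]
    push_cast
    ring
  · refine tsum_congr fun m => ?_
    rw [mul_zpow, zpow_add_one₀ Complex.I_ne_zero, hI, he]
    push_cast
    ring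

theorem abs_log_norm_I_mul_exp {t : ℝ} (ht : 0 < t) :
    |log ‖Complex.I * ((exp t : ℝ) : ℂ)‖| < 2 * t := by
  rw [norm_mul, Complex.norm_I, one_mul, Complex.norm_real, Real.norm_eq_abs,
    abs_of_pos (exp_pos _), log_exp, abs_of_pos ht]
  linarith

theorem I_mul_exp_ne_zero (t : ℝ) : Complex.I * ((exp t : ℝ) : ℂ) ≠ 0 :=
  mul_ne_zero Complex.I_ne_zero (Complex.ofReal_ne_zero.mpr (exp_pos t).ne')

theorem thetaCharAlt_neg_eighth_mul {x : ℝ} (hx : 0 < x) :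
    thetaCharAlt (-(1 / 8)) (2 * x) * thetaCharAlt (3 / 8) (2 * x) =
      theta2 x / 2 * thetaCharAlt (1 / 4) x := by
  rw [thetaCharAlt_mul _ _ (by positivity), thetaCharAlt_eq_sub _ hx,
    theta2_eq_two_mul_thetaChar_quarter hx]
  norm_num
  rw [thetaChar_neg, show 2 * (2 * x) = 4 * x by ring]
  ring

theorem thetaCharAlt_neg_eighth_sq_add {x : ℝ} (hx : 0 < x) :
    thetaCharAlt (-(1 / 8)) (2 * x) ^ 2 + thetaCharAlt (3 / 8) (2 * x) ^ 2 =
      theta4 x * thetaChar (1 / 4) x := by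
  have h5 : thetaChar (5 / 8) (4 * x) = thetaChar (3 / 8) (4 * x) := by
    rw [← thetaChar_neg, ← thetaChar_add_one]
    norm_num
  have h7 : thetaChar (7 / 8) (4 * x) = thetaChar (1 / 8) (4 * x) := by
    rw [← thetaChar_neg, ← thetaChar_add_one]
    norm_num
  have h1 := thetaChar_neg (1 / 8) (4 * x)
  rw [sq, sq, thetaCharAlt_mul _ _ (by positivity), thetaCharAlt_mul _ _ (by positivity),
    theta4_eq_thetaCharAlt, thetaCharAlt_eq_sub _ hx, thetaChar_eq_add _ hx,
    show 2 * (2 * x) = 4 * x by ring]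
  norm_num at h1 ⊢
  rw [h5, h7, h1]
  ring

theorem tsum_alt_gaussInt_even (t : ℝ) :
    ∑' m : ℤ, (-1 : ℝ) ^ m * (gaussInt (2 * t) (2 * m) * exp ((2 * m) * t)) =
      exp (t / 8) * thetaCharAlt (-(1 / 8)) (8 * t) := by
  rw [thetaCharAlt, ← tsum_mul_left]
  refine tsum_congr fun m => ?_
  rw [gaussInt, mul_left_comm (exp (t / 8)), ← Real.exp_add, ← Real.exp_add]
  push_cast
  ring_nf

theorem tsum_alt_gaussInt_odd (t : ℝ) :
    ∑' m : ℤ, (-1 : ℝ) ^ m * (gaussInt (2 * t) (2 * m + 1) * exp ((2 * m + 1) * t)) =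
      exp (t / 8) * thetaCharAlt (3 / 8) (8 * t) := by
  rw [thetaCharAlt, ← tsum_mul_left]
  refine tsum_congr fun m => ?_
  rw [gaussInt, mul_left_comm (exp (t / 8)), ← Real.exp_add, ← Real.exp_add]
  push_cast
  ring_nf

theorem gaussIntAlt_two_mul (x : ℝ) (m : ℤ) : gaussIntAlt x (2 * m) = gaussInt x (2 * m) := by
  rw [gaussIntAlt, gaussInt, zpow_mul]
  norm_num

theorem gaussIntAlt_two_mul_add_one (x : ℝ) (m : ℤ) :
    gaussIntAlt x (2 * m + 1) = -gaussInt x (2 * m + 1) := by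
  rw [gaussIntAlt, gaussInt, zpow_add_one₀ (by norm_num), zpow_mul]
  norm_num

theorem tsum_alt_sechInt_odd {t : ℝ} (ht : 0 < t) :
    ∑' m : ℤ, (-1 : ℝ) ^ m * (sechInt (2 * t) (2 * m + 1) * exp ((2 * m + 1) * t)) =
      theta2 (4 * t) * theta4 (2 * t) := by
  have h2 : 0 < 2 * t := by positivity
  have h4 : 0 < 4 * t := by positivity
  have hz := I_mul_exp_ne_zero t
  have hl := abs_log_norm_I_mul_exp ht
  have h := laurent_sechInt_mul h2 hz hl
  rw [laurent_I_mul_exp ((expDecay_sechInt h2).summable_zero hz hl),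
    laurent_I_mul_exp ((expDecay_gaussInt h2).summable_zero hz hl),
    laurent_I_mul_exp ((expDecay_gaussIntAlt h2).summable_zero hz hl),
    conv_sechInt_gaussIntAlt_zero h2] at h
  simp only [gaussIntAlt_two_mul, gaussIntAlt_two_mul_add_one, neg_mul, mul_neg, tsum_neg,
    tsum_alt_gaussInt_even, tsum_alt_gaussInt_odd] at h
  have e1 := thetaCharAlt_neg_eighth_mul h4
  have e2 := thetaCharAlt_neg_eighth_sq_add h4
  have e3 := thetaCharAlt_quarter_mul_theta3 h2
  rw [show 2 * (4 * t) = 8 * t by ring] at e1 e2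
  rw [show 2 * (2 * t) = 4 * t by ring] at e3
  have hX := thetaChar_pos (1 / 4) h4
  have hθ := theta4_pos h4
  generalize (∑' m : ℤ, (-1 : ℝ) ^ m * (sechInt (2 * t) (2 * m + 1) * exp ((2 * m + 1) * t))) = Q
    at *
  generalize (∑' m : ℤ, (-1 : ℝ) ^ m * (sechInt (2 * t) (2 * m) * exp ((2 * m) * t))) = P at *
  have hre := congrArg Complex.re h
  have him := congrArg Complex.im h
  simp only [Complex.mul_re, Complex.mul_im, Complex.add_re, Complex.add_im, Complex.ofReal_re,
    Complex.ofReal_im, Complex.I_re, Complex.I_im, Complex.neg_re, Complex.neg_im,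
    Complex.ofReal_neg] at hre him
  generalize thetaCharAlt (-(1 / 8)) (8 * t) = A at *
  generalize thetaCharAlt (3 / 8) (8 * t) = B at *
  have hE := exp_pos (t / 8)
  generalize exp (t / 8) = E at *
  apply mul_right_cancel₀ (mul_pos (pow_pos hE 2) (mul_pos hθ hX)).ne'
  linear_combination -Q * E ^ 2 * e2 + E * A * him + E * B * hre +
    2 * theta3 (2 * t) * theta4 (2 * t) * E ^ 2 * e1 +
    theta4 (2 * t) * E ^ 2 * theta2 (4 * t) * e3

/-- The Lambert series with numerators `χ₋₄(j) j²`, in closed form. -/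
theorem tsum_alt_sq_mul_sechInt_odd {t : ℝ} (ht : 0 < t) :
    ∑' m : ℤ, (-1 : ℝ) ^ m * ((2 * m + 1) ^ 2 * sechInt (2 * t) (2 * m + 1) *
        exp ((2 * m + 1) * t)) =
      theta2 (4 * t) * theta4 (2 * t) * theta3 (4 * t) ^ 2 *
        (theta3 (4 * t) ^ 2 - 2 * theta2 (4 * t) ^ 2) := by
  have h2 : 0 < 2 * t := by positivity
  have hz := I_mul_exp_ne_zero t
  have hl := abs_log_norm_I_mul_exp ht
  have h := laurent_sechOdd_ode h2 hz hl
  have e0 : ∀ m : ℤ, sechOdd (2 * t) (2 * m) = 0 := fun m => by simp [sechOdd]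
  have e1 : ∀ m : ℤ, sechOdd (2 * t) (2 * m + 1) = sechInt (2 * t) (2 * m + 1) := fun m => by
    simp [sechOdd, sechInt]
  rw [laurent_I_mul_exp ((expDecay_sechOdd h2).summable 2 hz hl),
    laurent_I_mul_exp ((expDecay_sechOdd h2).summable_zero hz hl), laurent_one, laurent_one,
    tsum_sechEven h2, tsum_sechOdd h2] at h
  simp only [e0, e1, zero_mul, mul_zero, tsum_zero, tsum_alt_sechInt_odd ht] at h
  push_cast at h
  have e4 := theta4_sq h2
  rw [show 2 * (2 * t) = 4 * t by ring] at e4 h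
  apply Complex.ofReal_injective
  apply mul_left_cancel₀ Complex.I_ne_zero
  have e4' : (theta4 (2 * t) : ℂ) ^ 2 = theta3 (4 * t) ^ 2 - theta2 (4 * t) ^ 2 := by
    exact_mod_cast e4
  push_cast
  linear_combination h + 2 * Complex.I * (theta2 (4 * t) * theta4 (2 * t)) ^ 3 * Complex.I_sq -
    2 * Complex.I * (theta2 (4 * t) * theta4 (2 * t)) * theta2 (4 * t) ^ 2 * e4'

/-- The Lambert series `∑ χ₋₄(j) j² sinh (j t) / cosh (2 j t)` over the positive odd integers. -/
theorem tsum_alt_sq_mul_sinh_div_cosh {t : ℝ} (ht : 0 < t) :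
    2 * ∑' n : ℕ, (-1 : ℝ) ^ n * ((2 * n + 1) ^ 2 *
        (sinh ((2 * n + 1) * t) / cosh (2 * ((2 * n + 1) * t)))) =
      theta2 (4 * t) * theta4 (2 * t) * theta3 (4 * t) ^ 2 *
        (theta3 (4 * t) ^ 2 - 2 * theta2 (4 * t) ^ 2) := by
  have h2 : 0 < 2 * t := by positivity
  have hs : Summable fun m : ℤ => (-1 : ℝ) ^ m * ((2 * m + 1) ^ 2 *
      sechInt (2 * t) (2 * m + 1) * exp ((2 * m + 1) * t)) := by
    have h := (expDecay_sechInt h2).summable 2 (I_mul_exp_ne_zero t) (abs_log_norm_I_mul_exp ht)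
    have h' := h.comp_injective (i := fun m : ℤ => 2 * m + 1) fun a b h => by
      simp only at h
      omega
    refine Summable.of_norm (h'.congr fun m => ?_)
    have hp : ‖(Complex.I * ((exp t : ℝ) : ℂ)) ^ (2 * m + 1)‖ = ‖exp ((2 * m + 1) * t)‖ := by
      rw [norm_zpow, norm_mul, Complex.norm_I, one_mul, Complex.norm_real, ← norm_zpow,
        ← Real.rpow_intCast, ← Real.exp_mul]
      push_cast
      ring_nf
    rw [Function.comp_apply, norm_mul, Complex.norm_real, hp, norm_mul ((-1 : ℝ) ^ m), norm_zpow,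
      norm_neg, norm_one, one_zpow, one_mul, ← norm_mul]
    push_cast
    rfl
  rw [← tsum_alt_sq_mul_sechInt_odd ht, ← tsum_mul_left, ← tsum_nat_add_neg_add_one hs]
  refine tsum_congr fun n => ?_
  have s1 : (-1 : ℝ) ^ (-((n : ℤ) + 1)) = -(-1) ^ n := by
    rw [zpow_neg, ← inv_zpow, zpow_add_one₀ (by norm_num), zpow_natCast]
    norm_num
  rw [s1, zpow_natCast, sinh_eq, sechInt, sechInt]
  push_cast
  rw [show (2 * -((n : ℝ) + 1) + 1) = -(2 * n + 1) by ring, neg_mul (2 * (n : ℝ) + 1) (2 * t),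
    cosh_neg, neg_mul (2 * (n : ℝ) + 1) t,
    show (2 * (n : ℝ) + 1) * (2 * t) = 2 * ((2 * n + 1) * t) by ring]
  ring

/-- The partial products of the Euler product at the nome `exp (-s)`. -/
noncomputable def eulerProd (s : ℝ) (N : ℕ) : ℝ := ∏ m ∈ Finset.range N, (1 - exp (-(m + 1) * s))

/-- The Euler product at the nome `exp (-s)`. -/
noncomputable def eulerLim (s : ℝ) : ℝ := ∏' m : ℕ, (1 - exp (-((m : ℝ) + 1) * s))

/-- The reciprocal of the Euler product, extended by zero to negative indices. -/
noncomputable def eulerInv (s : ℝ) (k : ℤ) : ℝ := if k < 0 then 0 else 1 / eulerProd s k.toNat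

theorem eulerFactor_pos {s : ℝ} (hs : 0 < s) (m : ℕ) : 0 < 1 - exp (-((m : ℝ) + 1) * s) := by
  rw [sub_pos, exp_lt_one_iff]
  have : (0 : ℝ) ≤ m := m.cast_nonneg
  nlinarith

theorem eulerProd_pos {s : ℝ} (hs : 0 < s) (N : ℕ) : 0 < eulerProd s N :=
  Finset.prod_pos fun m _ => eulerFactor_pos hs m

theorem eulerProd_le_one {s : ℝ} (hs : 0 < s) (N : ℕ) : eulerProd s N ≤ 1 :=
  Finset.prod_le_one (fun m _ => (eulerFactor_pos hs m).le) fun m _ => by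
    linarith [exp_pos (-((m : ℝ) + 1) * s)]

theorem eulerProd_succ (s : ℝ) (N : ℕ) :
    eulerProd s (N + 1) = eulerProd s N * (1 - exp (-(N + 1) * s)) := Finset.prod_range_succ _ _

theorem summable_exp_nat {s : ℝ} (hs : 0 < s) :
    Summable fun m : ℕ => exp (-((m : ℝ) + 1) * s) := by
  have h := (Real.summable_exp_nat_mul_iff.mpr (neg_neg_of_pos hs)).mul_left (exp (-s))
  refine h.congr fun m => ?_
  rw [← Real.exp_add]
  ring_nf

theorem multipliable_eulerFactor {s : ℝ} (hs : 0 < s) :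
    Multipliable fun m : ℕ => 1 - exp (-((m : ℝ) + 1) * s) := by
  simpa only [sub_eq_add_neg] using Real.multipliable_one_add_of_summable (summable_exp_nat hs).neg

theorem tendsto_eulerProd {s : ℝ} (hs : 0 < s) :
    Tendsto (eulerProd s) atTop (𝓝 (eulerLim s)) :=
  (multipliable_eulerFactor hs).hasProd.tendsto_prod_nat

theorem eulerLim_ne_zero {s : ℝ} (hs : 0 < s) : eulerLim s ≠ 0 := by
  have h := tprod_one_add_ne_zero_of_summable (f := fun m : ℕ => -exp (-((m : ℝ) + 1) * s))
    (fun m => by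
      rw [← sub_eq_add_neg]
      exact (eulerFactor_pos hs m).ne') (summable_exp_nat hs).neg.norm
  simp only [← sub_eq_add_neg] at h
  exact h

theorem antitone_eulerProd {s : ℝ} (hs : 0 < s) : Antitone (eulerProd s) := by
  refine antitone_nat_of_succ_le fun N => ?_
  rw [eulerProd_succ]
  exact mul_le_of_le_one_right (eulerProd_pos hs N).le (by linarith [exp_pos (-((N : ℝ) + 1) * s)])

theorem eulerLim_pos {s : ℝ} (hs : 0 < s) : 0 < eulerLim s :=
  lt_of_le_of_ne (ge_of_tendsto' (tendsto_eulerProd hs) fun N => (eulerProd_pos hs N).le)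
    (eulerLim_ne_zero hs).symm

theorem eulerLim_le {s : ℝ} (hs : 0 < s) (N : ℕ) : eulerLim s ≤ eulerProd s N :=
  (antitone_eulerProd hs).le_of_tendsto (tendsto_eulerProd hs) N

theorem eulerInv_sub_one {s : ℝ} (hs : 0 < s) (k : ℤ) :
    eulerInv s (k - 1) = (1 - exp (-k * s)) * eulerInv s k := by
  rcases lt_trichotomy k 0 with h | rfl | h
  · rw [eulerInv, eulerInv, if_pos (by omega), if_pos h, mul_zero]
  · simp [eulerInv]
  · obtain ⟨N, rfl⟩ : ∃ N : ℕ, k = N + 1 := ⟨(k - 1).toNat, by omega⟩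
    rw [eulerInv, eulerInv, if_neg (by omega), if_neg (by omega), add_sub_cancel_right,
      Int.toNat_natCast, show ((N : ℤ) + 1).toNat = N + 1 by omega, eulerProd_succ]
    have := (eulerProd_pos hs N).ne'
    have h2 := (eulerFactor_pos hs N).ne'
    push_cast
    generalize 1 - exp (-((N : ℝ) + 1) * s) = y at h2
    field_simp

theorem eulerInv_nonneg {s : ℝ} (hs : 0 < s) (k : ℤ) : 0 ≤ eulerInv s k := by
  unfold eulerInv
  split_ifs
  · exact le_rfl
  · exact (one_div_pos.mpr (eulerProd_pos hs _)).le

theorem eulerInv_le {s : ℝ} (hs : 0 < s) (k : ℤ) : eulerInv s k ≤ 1 / eulerLim s := by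
  unfold eulerInv
  split_ifs
  · exact (one_div_pos.mpr (eulerLim_pos hs)).le
  · exact one_div_le_one_div_of_le (eulerLim_pos hs) (eulerLim_le hs _)

theorem tendsto_eulerInv {s : ℝ} (hs : 0 < s) :
    Tendsto (eulerInv s) atTop (𝓝 (1 / eulerLim s)) := by
  have h1 : Tendsto Int.toNat atTop atTop := by
    refine tendsto_atTop.mpr fun b => ?_
    filter_upwards [eventually_ge_atTop (b : ℤ)] with k hk
    omega
  have h := (tendsto_const_nhds (x := (1 : ℝ))).div ((tendsto_eulerProd hs).comp h1)
    (eulerLim_ne_zero hs)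
  refine h.congr' ?_
  filter_upwards [eventually_ge_atTop 0] with k hk
  rw [eulerInv, if_neg (by omega)]
  rfl

/-- The Laurent coefficients of the finite form of the Jacobi triple product. -/
noncomputable def tripleCoeff (s : ℝ) (N : ℕ) (n : ℤ) : ℝ :=
  (-1) ^ n * exp (-(n * (n - 1) / 2) * s) *
    (eulerProd s (2 * N) * eulerInv s (N + n) * eulerInv s (N - n))

theorem tripleCoeff_succ {s : ℝ} (hs : 0 < s) (N : ℕ) (n : ℤ) :
    tripleCoeff s (N + 1) n = (1 + exp (-(2 * N + 1) * s)) * tripleCoeff s N n -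
      exp (-N * s) * tripleCoeff s N (n - 1) - exp (-(N + 1) * s) * tripleCoeff s N (n + 1) := by
  have r1 : eulerInv s (N + n) = (1 - exp (-(N + 1 + n) * s)) * eulerInv s (N + 1 + n) := by
    have := eulerInv_sub_one hs (N + 1 + n)
    rw [show (N : ℤ) + 1 + n - 1 = N + n by ring] at this
    rw [this]
    push_cast
    ring
  have r2 : eulerInv s (N - n) = (1 - exp (-(N + 1 - n) * s)) * eulerInv s (N + 1 - n) := by
    have := eulerInv_sub_one hs (N + 1 - n)
    rw [show (N : ℤ) + 1 - n - 1 = N - n by ring] at this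
    rw [this]
    push_cast
    ring
  have r3 : eulerInv s (N + (n - 1)) = (1 - exp (-(N + n) * s)) * eulerInv s (N + n) := by
    have := eulerInv_sub_one hs (N + n)
    rw [show (N : ℤ) + n - 1 = N + (n - 1) by ring] at this
    rw [this]
    push_cast
    ring
  have r4 : eulerInv s (N - (n + 1)) = (1 - exp (-(N - n) * s)) * eulerInv s (N - n) := by
    have := eulerInv_sub_one hs (N - n)
    rw [show (N : ℤ) - n - 1 = N - (n + 1) by ring] at this
    rw [this]
    push_cast
    ring
  have s1 : (-1 : ℝ) ^ (n - 1) = -(-1) ^ n := by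
    rw [zpow_sub_one₀ (by norm_num)]
    norm_num
  have s2 : (-1 : ℝ) ^ (n + 1) = -(-1) ^ n := by
    rw [zpow_add_one₀ (by norm_num)]
    norm_num
  have hP : eulerProd s (2 * (N + 1)) = eulerProd s (2 * N) * (1 - exp (-(2 * N + 1) * s)) *
      (1 - exp (-(2 * N + 2) * s)) := by
    rw [show 2 * (N + 1) = 2 * N + 1 + 1 by ring, eulerProd_succ, eulerProd_succ]
    push_cast
    ring_nf
  unfold tripleCoeff
  rw [hP, s1, s2, show (N : ℤ) - (n - 1) = N + 1 - n by ring,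
    show (N : ℤ) + (n + 1) = N + 1 + n by ring, r4, r3, r1, r2]
  push_cast
  generalize eulerInv s (N + 1 + n) = A
  generalize eulerInv s (N + 1 - n) = B
  generalize eulerProd s (2 * N) = P
  have q1 : exp (-(((n : ℝ) - 1) * (n - 1 - 1) / 2) * s) =
      exp (-(n * (n - 1) / 2) * s) * exp (n * s) * exp (-s) := by
    simp only [← Real.exp_add]
    ring_nf
  have q2 : exp (-(((n : ℝ) + 1) * (n + 1 - 1) / 2) * s) =
      exp (-(n * (n - 1) / 2) * s) * (exp (n * s))⁻¹ := by
    rw [← Real.exp_neg, ← Real.exp_add]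
    ring_nf
  have x1 : exp (-(2 * N + 1) * s) = exp (-N * s) ^ 2 * exp (-s) := by
    rw [sq]
    simp only [← Real.exp_add]
    ring_nf
  have x2 : exp (-(2 * N + 2) * s) = exp (-N * s) ^ 2 * exp (-s) ^ 2 := by
    rw [sq, sq]
    simp only [← Real.exp_add]
    ring_nf
  have x3 : exp (-(N + 1 + n) * s) = exp (-N * s) * exp (-s) * (exp (n * s))⁻¹ := by
    rw [← Real.exp_neg]
    simp only [← Real.exp_add]
    ring_nf
  have x4 : exp (-(N + 1 - n) * s) = exp (-N * s) * exp (-s) * exp (n * s) := by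
    simp only [← Real.exp_add]
    ring_nf
  have x5 : exp (-(N + n) * s) = exp (-N * s) * (exp (n * s))⁻¹ := by
    rw [← Real.exp_neg, ← Real.exp_add]
    ring_nf
  have x6 : exp (-(N - n) * s) = exp (-N * s) * exp (n * s) := by
    rw [← Real.exp_add]
    ring_nf
  have x7 : exp (-(N + 1) * s) = exp (-N * s) * exp (-s) := by
    rw [← Real.exp_add]
    ring_nf
  rw [q1, q2, x1, x2, x3, x4, x5, x6, x7]
  have hV := (exp_pos (n * s)).ne'
  generalize exp (n * s) = V at *
  generalize exp (-N * s) = X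
  generalize exp (-s) = q
  generalize exp (-(n * (n - 1) / 2) * s) = W
  generalize (-1 : ℝ) ^ n = σ
  field_simp
  ring

theorem tripleCoeff_zero (s : ℝ) (n : ℤ) : tripleCoeff s 0 n = if n = 0 then 1 else 0 := by
  rcases lt_trichotomy n 0 with h | rfl | h
  · have h1 : eulerInv s ((0 : ℕ) + n) = 0 := if_pos (by push_cast; omega)
    rw [tripleCoeff, h1, if_neg h.ne]
    ring
  · simp [tripleCoeff, eulerInv, eulerProd]
  · have h1 : eulerInv s ((0 : ℕ) - n) = 0 := if_pos (by push_cast; omega)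
    rw [tripleCoeff, h1, if_neg h.ne']
    ring

/-- The finite form of the Jacobi triple product. -/
theorem hasSum_tripleCoeff {s : ℝ} (hs : 0 < s) {z : ℝ} (hz : z ≠ 0) (N : ℕ) :
    HasSum (fun n : ℤ => tripleCoeff s N n * z ^ n)
      (∏ m ∈ Finset.range N, (1 - z * exp (-m * s)) * (1 - z⁻¹ * exp (-(m + 1) * s))) := by
  induction N with
  | zero =>
    simp only [tripleCoeff_zero, Finset.range_zero, Finset.prod_empty]
    have h := hasSum_single (f := fun n : ℤ => (if n = 0 then (1 : ℝ) else 0) * z ^ n) 0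
      fun n hn => by simp [hn]
    simpa using h
  | succ N ih =>
    rw [Finset.prod_range_succ]
    set S := ∏ m ∈ Finset.range N, (1 - z * exp (-m * s)) * (1 - z⁻¹ * exp (-(m + 1) * s))
    have h1 := (Equiv.subRight (1 : ℤ)).hasSum_iff.mpr ih
    have h2 := (Equiv.addRight (1 : ℤ)).hasSum_iff.mpr ih
    have h := ((ih.mul_left (1 + exp (-(2 * N + 1) * s))).sub
      (h1.mul_left (exp (-N * s) * z))).sub (h2.mul_left (exp (-(N + 1) * s) * z⁻¹))
    have e : (1 + exp (-(2 * N + 1) * s)) * S - exp (-N * s) * z * S -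
        exp (-(N + 1) * s) * z⁻¹ * S =
        S * ((1 - z * exp (-N * s)) * (1 - z⁻¹ * exp (-(N + 1) * s))) := by
      have : exp (-(2 * N + 1) * s) = exp (-N * s) * exp (-(N + 1) * s) := by
        rw [← Real.exp_add]
        ring_nf
      rw [this]
      field_simp
      ring
    rw [e] at h
    refine h.congr_fun fun n => ?_
    rw [tripleCoeff_succ hs]
    simp only [Function.comp_apply, Equiv.subRight_apply, Equiv.coe_addRight]
    rw [zpow_sub_one₀ hz, zpow_add_one₀ hz]
    field_simp

theorem hasSum_tripleCoeff_one {s : ℝ} (hs : 0 < s) (N : ℕ) :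
    HasSum (fun n : ℤ => tripleCoeff s N n) (if N = 0 then 1 else 0) := by
  have h := hasSum_tripleCoeff hs one_ne_zero N
  simp only [one_zpow, mul_one, one_mul] at h
  rcases N with _ | N
  · simpa using h
  · rw [Finset.prod_range_succ'] at h
    simpa using h

/-- The derivative at one of the finite form of the Jacobi triple product. -/
theorem hasSum_intCast_mul_tripleCoeff {s : ℝ} (hs : 0 < s) (N : ℕ) :
    HasSum (fun n : ℤ => n * tripleCoeff s (N + 1) n) (-(eulerProd s N * eulerProd s (N + 1))) := by
  have step : ∀ (N : ℕ) (H : ℝ), HasSum (fun n : ℤ => n * tripleCoeff s N n) H →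
      HasSum (fun n : ℤ => n * tripleCoeff s (N + 1) n)
        ((1 - exp (-N * s)) * (1 - exp (-(N + 1) * s)) * H -
          (exp (-N * s) - exp (-(N + 1) * s)) * (if N = 0 then 1 else 0)) := by
    intro N H hH
    have hS := hasSum_tripleCoeff_one hs N
    set S : ℝ := if N = 0 then 1 else 0
    have h1 := (Equiv.subRight (1 : ℤ)).hasSum_iff.mpr (hH.add hS)
    have h2 := (Equiv.addRight (1 : ℤ)).hasSum_iff.mpr (hH.sub hS)
    have h := ((hH.mul_left (1 + exp (-(2 * N + 1) * s))).sub
      (h1.mul_left (exp (-N * s)))).sub (h2.mul_left (exp (-(N + 1) * s)))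
    have e : (1 + exp (-(2 * N + 1) * s)) * H - exp (-N * s) * (H + S) -
        exp (-(N + 1) * s) * (H - S) = (1 - exp (-N * s)) * (1 - exp (-(N + 1) * s)) * H -
          (exp (-N * s) - exp (-(N + 1) * s)) * S := by
      have : exp (-(2 * N + 1) * s) = exp (-N * s) * exp (-(N + 1) * s) := by
        rw [← Real.exp_add]
        ring_nf
      rw [this]
      ring
    rw [e] at h
    refine h.congr_fun fun n => ?_
    rw [tripleCoeff_succ hs]
    simp only [Function.comp_apply, Equiv.subRight_apply, Equiv.coe_addRight]
    push_cast
    ring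
  induction N with
  | zero =>
    have h0 : HasSum (fun n : ℤ => n * tripleCoeff s 0 n) 0 := by
      refine hasSum_zero.congr_fun fun n => ?_
      rw [tripleCoeff_zero]
      split_ifs with h <;> simp [h]
    have h := step 0 0 h0
    simpa [eulerProd] using h
  | succ N ih =>
    have h := step (N + 1) _ ih
    rw [if_neg (by omega), mul_zero, sub_zero] at h
    rw [eulerProd_succ s (N + 1), eulerProd_succ s N]
    rw [eulerProd_succ s N] at h
    push_cast at h ⊢
    convert h using 1
    ring

/-- Tannery's theorem for the finite form of the Jacobi triple product. -/
theorem tendsto_tsum_tripleCoeff {s : ℝ} (hs : 0 < s) {w : ℤ → ℝ}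
    (hw : Summable fun n : ℤ => |w n| * exp (-(n * (n - 1) / 2) * s)) :
    Tendsto (fun N => ∑' n, w n * tripleCoeff s N n) atTop
      (𝓝 ((∑' n : ℤ, w n * ((-1) ^ n * exp (-(n * (n - 1) / 2) * s))) / eulerLim s)) := by
  have hE := eulerLim_pos hs
  rw [← tsum_div_const]
  refine tendsto_tsum_of_dominated_convergence (hw.mul_left (1 / eulerLim s ^ 2)) (fun n => ?_) ?_
  · have h1 : Tendsto (fun N : ℕ => eulerInv s (N + n)) atTop (𝓝 (1 / eulerLim s)) :=
      (tendsto_eulerInv hs).comp (tendsto_atTop_add_const_right _ n tendsto_natCast_atTop_atTop)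
    have h2 : Tendsto (fun N : ℕ => eulerInv s (N - n)) atTop (𝓝 (1 / eulerLim s)) :=
      (tendsto_eulerInv hs).comp (tendsto_atTop_add_const_right _ (-n) tendsto_natCast_atTop_atTop)
    have h3 : Tendsto (fun N : ℕ => eulerProd s (2 * N)) atTop (𝓝 (eulerLim s)) :=
      (tendsto_eulerProd hs).comp (tendsto_id.const_mul_atTop' two_pos)
    have h := (((h3.mul h1).mul h2).const_mul
      ((-1 : ℝ) ^ n * exp (-(n * (n - 1) / 2) * s))).const_mul
      (w n)
    have e : w n * ((-1 : ℝ) ^ n * exp (-(n * (n - 1) / 2) * s) *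
        (eulerLim s * (1 / eulerLim s) * (1 / eulerLim s))) =
        w n * ((-1) ^ n * exp (-(n * (n - 1) / 2) * s)) / eulerLim s := by
      field_simp
    rw [e] at h
    exact h
  · refine Eventually.of_forall fun N n => ?_
    have a1 := eulerInv_le hs (N + n)
    have a2 := eulerInv_le hs (N - n)
    have b1 := eulerInv_nonneg hs (N + n)
    have b2 := eulerInv_nonneg hs (N - n)
    have c1 := eulerProd_le_one hs (2 * N)
    have c2 := (eulerProd_pos hs (2 * N)).le
    rw [tripleCoeff, Real.norm_eq_abs, abs_mul, abs_mul, abs_mul, abs_neg_one_zpow, one_mul,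
      abs_of_pos (exp_pos _), abs_of_nonneg (mul_nonneg (mul_nonneg c2 b1) b2)]
    calc _ ≤ |w n| *
          (exp (-(n * (n - 1) / 2) * s) * (1 * (1 / eulerLim s) * (1 / eulerLim s))) := by
          gcongr
      _ = _ := by
          field_simp

theorem summable_pow_mul_exp_neg_choose_two (k : ℕ) {s : ℝ} (hs : 0 < s) (c : ℝ) :
    Summable fun n : ℤ => |(n : ℝ)| ^ k * exp (-(n * (n - 1) / 2 * s + c * n)) := by
  have h := (summable_pow_mul_exp_neg_sq k (c / s - 1 / 2) (half_pos hs)).mul_left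
    (exp ((c / s - 1 / 2) ^ 2 * (s / 2)))
  refine h.congr fun n => ?_
  rw [mul_left_comm, ← Real.exp_add]
  congr 2
  field_simp
  ring

theorem tendsto_prod_triple {s : ℝ} (hs : 0 < s) (c : ℝ) :
    Tendsto (fun N => ∏ m ∈ Finset.range N,
        (1 - exp (-(m * s + c))) * (1 - exp (-((m + 1) * s - c)))) atTop
      (𝓝 ((∑' n : ℤ, (-1) ^ n * exp (-(n * (n - 1) / 2 * s + c * n))) / eulerLim s)) := by
  have e : ∀ n : ℤ, exp (-c) ^ n * exp (-(n * (n - 1) / 2) * s) =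
      exp (-(n * (n - 1) / 2 * s + c * n)) := fun n => by
    rw [← Real.rpow_intCast, ← Real.exp_mul, ← Real.exp_add]
    ring_nf
  have hw : Summable fun n : ℤ => |exp (-c) ^ n| * exp (-(n * (n - 1) / 2) * s) := by
    refine (summable_pow_mul_exp_neg_choose_two 0 hs c).congr fun n => ?_
    rw [abs_of_pos (zpow_pos (exp_pos _) n), e, pow_zero, one_mul]
  have h := tendsto_tsum_tripleCoeff hs hw
  have e2 : ∀ n : ℤ, exp (-c) ^ n * ((-1 : ℝ) ^ n * exp (-(n * (n - 1) / 2) * s)) =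
      (-1) ^ n * exp (-(n * (n - 1) / 2 * s + c * n)) := fun n => by
    rw [mul_left_comm, e]
  simp only [e2] at h
  refine h.congr fun N => ?_
  have h3 := (hasSum_tripleCoeff hs (exp_pos (-c)).ne' N).tsum_eq
  simp only [mul_comm (tripleCoeff _ _ _)] at h3
  rw [h3]
  refine Finset.prod_congr rfl fun m _ => ?_
  rw [← Real.exp_neg, ← Real.exp_add, ← Real.exp_add]
  ring_nf

/-- The pentagonal number theorem. -/
theorem tsum_pentagonal {r : ℝ} (hr : 0 < r) :
    ∑' n : ℤ, (-1 : ℝ) ^ n * exp (-((3 * n ^ 2 + n) / 2 * r)) = eulerLim r := by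
  have hs : 0 < 3 * r := by positivity
  have h := (tendsto_prod_triple hs (2 * r)).mul (tendsto_eulerProd hs)
  have h2 : Tendsto (fun N : ℕ => eulerProd r (3 * N)) atTop (𝓝 (eulerLim r)) :=
    (tendsto_eulerProd hr).comp (tendsto_id.const_mul_atTop' three_pos)
  rw [div_mul_cancel₀ _ (eulerLim_ne_zero hs)] at h
  have key : ∀ N, (∏ m ∈ Finset.range N, (1 - exp (-(m * (3 * r) + 2 * r))) *
      (1 - exp (-((m + 1) * (3 * r) - 2 * r)))) * eulerProd (3 * r) N = eulerProd r (3 * N) := by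
    intro N
    induction N with
    | zero => simp [eulerProd]
    | succ N ih =>
      generalize hT : ∏ m ∈ Finset.range N, (1 - exp (-(m * (3 * r) + 2 * r))) *
        (1 - exp (-((m + 1) * (3 * r) - 2 * r))) = T at ih
      rw [show 3 * (N + 1) = 3 * N + 1 + 1 + 1 by ring, eulerProd_succ r, eulerProd_succ r,
        eulerProd_succ r, ← ih, Finset.prod_range_succ, hT, eulerProd_succ]
      push_cast
      ring_nf
  have := tendsto_nhds_unique (h.congr key) h2
  rw [← this]
  refine tsum_congr fun n => ?_
  ring_nf

theorem tsum_neg_one_mul_exp_triangular {r : ℝ} (hr : 0 < r) :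
    (∑' n : ℤ, (-1 : ℝ) ^ n * exp (-((2 * n ^ 2 + n) * r))) * eulerLim (2 * r) =
      eulerLim r * eulerLim (4 * r) := by
  have hs : 0 < 4 * r := by positivity
  have hs2 : 0 < 2 * r := by positivity
  have h := (tendsto_prod_triple hs (3 * r)).mul
    ((tendsto_eulerProd hs2).comp (tendsto_id.const_mul_atTop' two_pos))
  have h2 : Tendsto (fun N : ℕ => eulerProd r (4 * N)) atTop (𝓝 (eulerLim r)) :=
    (tendsto_eulerProd hr).comp (tendsto_id.const_mul_atTop' four_pos)
  have key : ∀ N, (∏ m ∈ Finset.range N, (1 - exp (-(m * (4 * r) + 3 * r))) *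
      (1 - exp (-((m + 1) * (4 * r) - 3 * r)))) * eulerProd (2 * r) (2 * N) =
        eulerProd r (4 * N) := by
    intro N
    induction N with
    | zero => simp [eulerProd]
    | succ N ih =>
      generalize hT : ∏ m ∈ Finset.range N, (1 - exp (-(m * (4 * r) + 3 * r))) *
        (1 - exp (-((m + 1) * (4 * r) - 3 * r))) = T at ih
      rw [show 4 * (N + 1) = 4 * N + 1 + 1 + 1 + 1 by ring, eulerProd_succ r, eulerProd_succ r,
        eulerProd_succ r, eulerProd_succ r, ← ih, Finset.prod_range_succ, hT,
        show 2 * (N + 1) = 2 * N + 1 + 1 by ring, eulerProd_succ, eulerProd_succ]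
      push_cast
      ring_nf
  have := tendsto_nhds_unique (h.congr key) h2
  rw [← this]
  have h4 := eulerLim_ne_zero hs
  rw [div_mul_eq_mul_div, div_mul_cancel₀ _ h4]
  congr 1
  refine tsum_congr fun n => ?_
  ring_nf

/-- Jacobi's identity for the cube of the Euler product. -/
theorem tsum_mul_exp_triangular {s : ℝ} (hs : 0 < s) :
    ∑' n : ℤ, (4 * n + 1 : ℝ) * exp (-((2 * n ^ 2 + n) * s)) = eulerLim s ^ 3 := by
  have hw : Summable fun n : ℤ => |(n : ℝ)| * exp (-(n * (n - 1) / 2) * s) := by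
    refine (summable_pow_mul_exp_neg_choose_two 1 hs 0).congr fun n => ?_
    rw [pow_one]
    ring_nf
  have h := (tendsto_tsum_tripleCoeff hs hw).comp (tendsto_add_atTop_nat 1)
  have h2 :=
    ((tendsto_eulerProd hs).mul ((tendsto_eulerProd hs).comp (tendsto_add_atTop_nat 1))).neg
  have e := tendsto_nhds_unique (h.congr fun N => (hasSum_intCast_mul_tripleCoeff hs N).tsum_eq) h2
  rw [div_eq_iff (eulerLim_ne_zero hs)] at e
  have hsum : Summable fun n : ℤ => (n : ℝ) * ((-1) ^ n * exp (-(n * (n - 1) / 2) * s)) := by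
    refine Summable.of_norm (hw.congr fun n => ?_)
    rw [Real.norm_eq_abs, abs_mul, abs_mul, abs_neg_one_zpow, one_mul, abs_of_pos (exp_pos _)]
  have i0 : Function.Injective (fun n : ℤ => 2 * n) := fun a b h => by
    simp only at h
    omega
  have i1 : Function.Injective (fun n : ℤ => 2 * n + 1) := fun a b h => by
    simp only at h
    omega
  have s0 := (Equiv.neg ℤ).summable_iff.mpr (hsum.comp_injective i0)
  have s1 := hsum.comp_injective i1
  rw [tsum_int_even_odd hsum, ← (Equiv.neg ℤ).tsum_eq] at e
  have e3 : eulerLim s ^ 3 = -(-(eulerLim s * eulerLim s) * eulerLim s) := by ring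
  rw [e3, ← e]
  refine Eq.trans ?_ (congrArg Neg.neg (Summable.tsum_add s0 s1))
  rw [← tsum_neg]
  refine tsum_congr fun n => ?_
  have p1 : (-1 : ℝ) ^ (2 * (Equiv.neg ℤ n)) = 1 := Even.neg_one_zpow (even_two_mul _)
  have p2 : (-1 : ℝ) ^ (2 * n + 1) = -1 := Odd.neg_one_zpow (odd_two_mul_add_one _)
  simp only [p1, p2]
  rw [Equiv.neg_apply]
  push_cast
  rw [show (-(2 * -(n : ℝ) * (2 * -n - 1) / 2) * s) = -((2 * n ^ 2 + n) * s) by ring,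
    show (-((2 * (n : ℝ) + 1) * (2 * n + 1 - 1) / 2) * s) = -((2 * n ^ 2 + n) * s) by ring]
  ring

/-- The eta-type theta series `∑ (-1) ^ n exp (-(6 n + 1) ^ 2 t)`. -/
noncomputable def etaTheta (t : ℝ) : ℝ := ∑' n : ℤ, (-1 : ℝ) ^ n * exp (-(6 * n + 1) ^ 2 * t)

theorem etaTheta_eq {t : ℝ} (ht : 0 < t) : etaTheta t = exp (-t) * eulerLim (24 * t) := by
  rw [← tsum_pentagonal (by positivity : 0 < 24 * t), ← tsum_mul_left, etaTheta]
  refine tsum_congr fun n => ?_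
  rw [mul_left_comm, ← Real.exp_add]
  ring_nf

theorem etaTheta_mul {t : ℝ} (ht : 0 < t) :
    etaTheta t * etaTheta (2 * t) * etaTheta (2 * t) * etaTheta (4 * t) =
      (∑' k : ℤ, (-1 : ℝ) ^ k * exp (-3 * (4 * k + 1) ^ 2 * t)) *
        ∑' l : ℤ, (4 * l + 1 : ℝ) * exp (-6 * (4 * l + 1) ^ 2 * t) := by
  have a1 : ∑' k : ℤ, (-1 : ℝ) ^ k * exp (-3 * (4 * k + 1) ^ 2 * t) =
      exp (-3 * t) * ∑' n : ℤ, (-1 : ℝ) ^ n * exp (-((2 * n ^ 2 + n) * (24 * t))) := by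
    rw [← tsum_mul_left]
    refine tsum_congr fun n => ?_
    rw [mul_left_comm, ← Real.exp_add]
    ring_nf
  have a2 : ∑' l : ℤ, (4 * l + 1 : ℝ) * exp (-6 * (4 * l + 1) ^ 2 * t) =
      exp (-6 * t) * ∑' n : ℤ, (4 * n + 1 : ℝ) * exp (-((2 * n ^ 2 + n) * (48 * t))) := by
    rw [← tsum_mul_left]
    refine tsum_congr fun n => ?_
    rw [mul_left_comm, ← Real.exp_add]
    ring_nf
  have b1 := tsum_neg_one_mul_exp_triangular (by positivity : 0 < 24 * t)
  rw [show 2 * (24 * t) = 48 * t by ring, show 4 * (24 * t) = 96 * t by ring] at b1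
  have b2 := tsum_mul_exp_triangular (by positivity : 0 < 48 * t)
  have hx : exp (-t) * exp (-(2 * t)) * exp (-(2 * t)) * exp (-(4 * t)) =
      exp (-3 * t) * exp (-6 * t) := by
    simp only [← Real.exp_add]
    ring_nf
  rw [a1, a2, b2, etaTheta_eq ht, etaTheta_eq (by positivity), etaTheta_eq (by positivity),
    show 24 * (2 * t) = 48 * t by ring, show 24 * (4 * t) = 96 * t by ring]
  linear_combination (eulerLim (24 * t) * eulerLim (48 * t) ^ 2 * eulerLim (96 * t)) * hx -
    exp (-3 * t) * exp (-6 * t) * eulerLim (48 * t) ^ 2 * b1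

open MeasureTheory in
theorem integrableOn_mul_exp_neg {X : ℝ} (hX : 0 < X) :
    IntegrableOn (fun t : ℝ => t * exp (-X * t)) (Set.Ioi 0) := by
  simpa using integrableOn_rpow_mul_exp_neg_mul_rpow (s := 1) (p := 1) (by norm_num) one_pos hX

theorem integral_mul_exp_neg {X : ℝ} (hX : 0 < X) :
    ∫ t in Set.Ioi (0 : ℝ), t * exp (-X * t) = 1 / X ^ 2 := by
  have h := Real.integral_rpow_mul_exp_neg_mul_Ioi (a := 2) two_pos hX
  norm_num [Real.Gamma_two] at h
  simpa using h

theorem alternating_sum_mem_Icc (n : ℕ) : ∀ f : ℕ → ℝ, Antitone f → (∀ i, 0 ≤ f i) →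
    0 ≤ ∑ i ∈ Finset.range n, (-1) ^ i * f i ∧ ∑ i ∈ Finset.range n, (-1) ^ i * f i ≤ f 0 := by
  induction n with
  | zero => exact fun f _ h => by simpa using h 0
  | succ n ih =>
    intro f hf h
    have := ih (fun i => f (i + 1)) (fun i j hij => hf (by omega)) fun i => h _
    have e : ∑ i ∈ Finset.range (n + 1), (-1) ^ i * f i =
        f 0 - ∑ i ∈ Finset.range n, (-1) ^ i * f (i + 1) := by
      rw [Finset.sum_range_succ']
      simp only [pow_succ, mul_neg_one, neg_mul, Finset.sum_neg_distrib, pow_zero, one_mul]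
      ring
    have h1 := hf (zero_le_one)
    simp only [zero_add] at this
    rw [e]
    constructor <;> linarith [this.1, this.2]

/-- The symmetric partial sums of `etaTheta`. -/
noncomputable def etaPartial (v : ℕ) (t : ℝ) : ℝ :=
  ∑ n ∈ Finset.Icc (-(v : ℤ)) v, (-1 : ℝ) ^ n * exp (-(6 * n + 1) ^ 2 * t)

theorem etaPartial_eq (v : ℕ) (t : ℝ) : etaPartial v t = exp (-t) -
    ∑ i ∈ Finset.range v, (-1) ^ i *
      (exp (-(6 * i + 5) ^ 2 * t) + exp (-(6 * i + 7) ^ 2 * t)) := by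
  induction v with
  | zero => simp [etaPartial]
  | succ v ih =>
    rw [etaPartial] at ih ⊢
    push_cast
    rw [Finset.Icc_succ_succ, Finset.sum_union (by simp), ih, Finset.sum_range_succ,
      Finset.sum_pair (by omega)]
    have h1 : (-1 : ℝ) ^ (-((v : ℤ) + 1)) = -(-1) ^ v := by
      rw [zpow_neg, zpow_add_one₀ (by norm_num), zpow_natCast, mul_neg_one, inv_neg, ← inv_pow]
      norm_num
    have h2 : (-1 : ℝ) ^ ((v : ℤ) + 1) = -(-1) ^ v := by
      rw [zpow_add_one₀ (by norm_num), zpow_natCast, mul_neg_one]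
    rw [h1, h2]
    push_cast
    ring_nf

theorem abs_etaPartial_le (v : ℕ) {t : ℝ} (ht : 0 < t) : |etaPartial v t| ≤ exp (-t) := by
  rw [etaPartial_eq]
  have h := alternating_sum_mem_Icc v
    (fun i : ℕ => exp (-(6 * i + 5) ^ 2 * t) + exp (-(6 * i + 7) ^ 2 * t))
    (fun i j hij => by
      have : (i : ℝ) ≤ j := by exact_mod_cast hij
      simp only [neg_mul]
      gcongr) fun i => by positivity
  have h1 : exp (-(6 * (0 : ℕ) + 5) ^ 2 * t) ≤ exp (-t) := by
    rw [Real.exp_le_exp]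
    push_cast
    nlinarith
  have h2 : exp (-(6 * (0 : ℕ) + 7) ^ 2 * t) ≤ exp (-t) := by
    rw [Real.exp_le_exp]
    push_cast
    nlinarith
  rw [abs_le]
  constructor <;> linarith [h.1, h.2]

theorem summable_etaTheta {t : ℝ} (ht : 0 < t) :
    Summable fun n : ℤ => (-1 : ℝ) ^ n * exp (-(6 * n + 1) ^ 2 * t) := by
  refine Summable.of_norm ((summable_pow_mul_exp_neg_sq 0 (1 / 6)
    (by positivity : 0 < 36 * t)).congr fun n => ?_)
  rw [Real.norm_eq_abs, abs_mul, abs_neg_one_zpow, one_mul, abs_of_pos (exp_pos _), pow_zero,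
    one_mul]
  ring_nf

theorem tendsto_etaPartial {t : ℝ} (ht : 0 < t) :
    Tendsto (fun v => etaPartial v t) atTop (𝓝 (etaTheta t)) :=
  (summable_etaTheta ht).hasSum.comp Finset.tendsto_Icc_neg

theorem continuous_etaPartial (v : ℕ) : Continuous (etaPartial v) := by
  unfold etaPartial
  fun_prop

open MeasureTheory in
theorem boxSum_eq_integral {a b c d : ℝ} (ha : 0 < a) (hb : 0 < b) (hc : 0 < c) (hd : 0 < d)
    (v : ℕ) : boxSum a b c d v = ∫ t in Set.Ioi (0 : ℝ), t * (etaPartial v (a * t) *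
      etaPartial v (b * t) * etaPartial v (c * t) * etaPartial v (d * t)) := by
  set Q : ℤ → ℤ → ℤ → ℤ → ℝ := fun n₁ n₂ n₃ n₄ => a * ((6 * n₁ + 1 : ℤ) : ℝ) ^ 2 +
    b * ((6 * n₂ + 1 : ℤ) : ℝ) ^ 2 + c * ((6 * n₃ + 1 : ℤ) : ℝ) ^ 2 +
    d * ((6 * n₄ + 1 : ℤ) : ℝ) ^ 2 with hQ
  have hQp : ∀ n₁ n₂ n₃ n₄, 0 < Q n₁ n₂ n₃ n₄ := fun n₁ n₂ n₃ n₄ => by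
    have : 0 < ((6 * n₁ + 1 : ℤ) : ℝ) ^ 2 := by
      have : (6 * n₁ + 1 : ℤ) ≠ 0 := by omega
      positivity
    positivity
  have e : ∀ t : ℝ, t * (etaPartial v (a * t) *
      etaPartial v (b * t) * etaPartial v (c * t) * etaPartial v (d * t)) =
      ∑ n₁ ∈ Finset.Icc (-(v:ℤ)) (v:ℤ), ∑ n₂ ∈ Finset.Icc (-(v:ℤ)) (v:ℤ),
        ∑ n₃ ∈ Finset.Icc (-(v:ℤ)) (v:ℤ), ∑ n₄ ∈ Finset.Icc (-(v:ℤ)) (v:ℤ),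
          (-1 : ℝ) ^ (n₁ + n₂ + n₃ + n₄) * (t * exp (-Q n₁ n₂ n₃ n₄ * t)) := fun t => by
    refine Eq.trans (b := ∑ n₁ ∈ Finset.Icc (-(v:ℤ)) (v:ℤ), ∑ n₂ ∈ Finset.Icc (-(v:ℤ)) (v:ℤ),
        ∑ n₃ ∈ Finset.Icc (-(v:ℤ)) (v:ℤ), ∑ n₄ ∈ Finset.Icc (-(v:ℤ)) (v:ℤ),
          t * (((-1 : ℝ) ^ n₁ * exp (-(6 * n₁ + 1) ^ 2 * (a * t))) *
            (((-1 : ℝ) ^ n₂ * exp (-(6 * n₂ + 1) ^ 2 * (b * t))) *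
            (((-1 : ℝ) ^ n₃ * exp (-(6 * n₃ + 1) ^ 2 * (c * t))) *
            ((-1 : ℝ) ^ n₄ * exp (-(6 * n₄ + 1) ^ 2 * (d * t))))))) ?_ ?_
    · simp only [← Finset.mul_sum, ← Finset.sum_mul, etaPartial]
      ring
    refine Finset.sum_congr rfl fun n₁ _ => Finset.sum_congr rfl fun n₂ _ =>
      Finset.sum_congr rfl fun n₃ _ => Finset.sum_congr rfl fun n₄ _ => ?_
    have x : exp (-Q n₁ n₂ n₃ n₄ * t) = exp (-(6 * n₁ + 1) ^ 2 * (a * t)) *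
        exp (-(6 * n₂ + 1) ^ 2 * (b * t)) * exp (-(6 * n₃ + 1) ^ 2 * (c * t)) *
        exp (-(6 * n₄ + 1) ^ 2 * (d * t)) := by
      simp only [← Real.exp_add, hQ]
      push_cast
      ring_nf
    have h1 : (-1 : ℝ) ≠ 0 := by norm_num
    rw [x, zpow_add₀ h1, zpow_add₀ h1, zpow_add₀ h1]
    ring
  have hi : ∀ n₁ n₂ n₃ n₄, IntegrableOn
      (fun t : ℝ => (-1 : ℝ) ^ (n₁ + n₂ + n₃ + n₄) * (t * exp (-Q n₁ n₂ n₃ n₄ * t))) (Set.Ioi 0) :=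
    fun n₁ n₂ n₃ n₄ => (integrableOn_mul_exp_neg (hQp n₁ n₂ n₃ n₄)).const_mul _
  simp only [e]
  rw [integral_finsetSum _ fun n₁ _ => integrable_finsetSum _ fun n₂ _ =>
    integrable_finsetSum _ fun n₃ _ => integrable_finsetSum _ fun n₄ _ => hi n₁ n₂ n₃ n₄]
  refine Finset.sum_congr rfl fun n₁ _ => ?_
  rw [integral_finsetSum _ fun n₂ _ => integrable_finsetSum _ fun n₃ _ =>
    integrable_finsetSum _ fun n₄ _ => hi n₁ n₂ n₃ n₄]
  refine Finset.sum_congr rfl fun n₂ _ => ?_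
  rw [integral_finsetSum _ fun n₃ _ => integrable_finsetSum _ fun n₄ _ => hi n₁ n₂ n₃ n₄]
  refine Finset.sum_congr rfl fun n₃ _ => ?_
  rw [integral_finsetSum _ fun n₄ _ => hi n₁ n₂ n₃ n₄]
  refine Finset.sum_congr rfl fun n₄ _ => ?_
  rw [integral_const_mul, integral_mul_exp_neg (hQp n₁ n₂ n₃ n₄), mul_one_div]

open MeasureTheory in
theorem tendsto_boxSum {a b c d : ℝ} (ha : 0 < a) (hb : 0 < b) (hc : 0 < c) (hd : 0 < d) :
    Tendsto (boxSum a b c d) atTop (𝓝 (∫ t in Set.Ioi (0 : ℝ), t * (etaTheta (a * t) *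
      etaTheta (b * t) * etaTheta (c * t) * etaTheta (d * t)))) := by
  simp only [funext fun v => boxSum_eq_integral ha hb hc hd v]
  refine tendsto_integral_of_dominated_convergence
    (fun t => t * exp (-(a + b + c + d) * t)) (fun v => ?_)
    (integrableOn_mul_exp_neg (by positivity)) (fun v => ?_) ?_
  · have := continuous_etaPartial v
    exact Continuous.aestronglyMeasurable (by fun_prop)
  · refine (ae_restrict_iff' measurableSet_Ioi).mpr (Eventually.of_forall fun t ht => ?_)
    have ht : 0 < t := ht
    have x : exp (-(a + b + c + d) * t) =
        exp (-(a * t)) * exp (-(b * t)) * exp (-(c * t)) * exp (-(d * t)) := by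
      simp only [← Real.exp_add]
      ring_nf
    rw [x, Real.norm_eq_abs, abs_mul, abs_mul, abs_mul, abs_mul, abs_of_pos ht]
    gcongr <;> exact abs_etaPartial_le v (by positivity)
  · refine (ae_restrict_iff' measurableSet_Ioi).mpr (Eventually.of_forall fun t ht => ?_)
    have ht : 0 < t := ht
    exact ((((tendsto_etaPartial (mul_pos ha ht)).mul (tendsto_etaPartial (mul_pos hb ht))).mul
      (tendsto_etaPartial (mul_pos hc ht))).mul (tendsto_etaPartial (mul_pos hd ht))).const_mul t

theorem summable_odd_mul_exp_neg {x : ℝ} (hx : 0 < x) (k : ℕ) :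
    Summable fun j : ℕ => (2 * j + 1 : ℝ) ^ k * exp (-(2 * j + 1) * x) := by
  have h := (Real.summable_pow_mul_exp_neg_nat_mul k hx).comp_injective
    (i := fun j : ℕ => 2 * j + 1) fun a b h => by
      simp only at h
      omega
  refine h.congr fun j => ?_
  simp only [Function.comp_apply]
  push_cast
  ring_nf

/-- A Lipschitz-type summation formula. -/
theorem tsum_div_sq_add_sq {y : ℝ} (hy : 0 < y) :
    ∑' l : ℤ, (4 * l + 1 : ℝ) / ((4 * l + 1) ^ 2 + y ^ 2) ^ 2 =
      π ^ 2 / (8 * y) * ∑' j : ℕ, (-1) ^ j * ((2 * j + 1) * exp (-(2 * j + 1) * (π * y / 2))) := by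
  let z : UpperHalfPlane := ⟨⟨1 / 4, y / 4⟩, by simpa using hy⟩
  have hz : (z : ℂ) = (1 + y * Complex.I) / 4 := by
    apply Complex.ext <;> simp [z]
  have h := EisensteinSeries.qExpansion_identity le_rfl z
  have hs : Summable fun n : ℤ => 1 / ((z : ℂ) + n) ^ (1 + 1) := by
    simpa using EisensteinSeries.linear_right_summable (z : ℂ) 1 (k := 2) le_rfl
  have him := congrArg Complex.im h
  rw [Complex.im_tsum hs] at him
  have t1 : ∀ n : ℤ, (1 / ((z : ℂ) + n) ^ (1 + 1)).im =
      -(32 * y) * ((4 * n + 1 : ℝ) / ((4 * n + 1) ^ 2 + y ^ 2) ^ 2) := fun n => by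
    have hr : ((z : ℂ) + n).re = (4 * n + 1) / 4 := by
      simp [z]
      ring
    have hi : ((z : ℂ) + n).im = y / 4 := by simp [z]
    have hp : 0 < (4 * n + 1 : ℝ) ^ 2 + y ^ 2 := by positivity
    rw [one_div, Complex.inv_im, map_pow, Complex.normSq_apply, pow_succ, pow_one, Complex.mul_im,
      hr, hi]
    field_simp
    ring
  have hq : Complex.exp (2 * π * Complex.I * z) = Complex.I * (exp (-(π * y / 2)) : ℝ) := by
    rw [hz, show 2 * π * Complex.I * ((1 + y * Complex.I) / 4) =
      π / 2 * Complex.I + ((-(π * y / 2) : ℝ) : ℂ) by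
        push_cast
        linear_combination (π * y / 2 : ℂ) * Complex.I_sq, Complex.exp_add,
      Complex.exp_pi_div_two_mul_I, Complex.ofReal_exp]
  have hs2 := summable_pow_mul_cexp 1 1 z
  simp only [PNat.one_coe, Nat.cast_one, mul_one, hq] at hs2
  have hc : ((-2 * π * Complex.I) ^ (1 + 1) / (Nat.factorial 1 : ℂ)) = ((-4 * π ^ 2 : ℝ) : ℂ) := by
    simp only [Nat.factorial_one]
    push_cast
    linear_combination (4 * π ^ 2 : ℂ) * Complex.I_sq
  simp only [hq, t1, tsum_mul_left, hc] at him
  rw [Complex.im_ofReal_mul, Complex.im_tsum hs2] at him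
  set g : ℕ → ℝ := fun n =>
    ((n : ℂ) ^ 1 * (Complex.I * (exp (-(π * y / 2)) : ℝ)) ^ n).im with hg
  have hpow : ∀ n : ℕ, g n = n * exp (-n * (π * y / 2)) * (Complex.I ^ n).im := fun n => by
    have : (n : ℂ) ^ 1 * (Complex.I * (exp (-(π * y / 2)) : ℝ)) ^ n =
        ((n * exp (-n * (π * y / 2)) : ℝ) : ℂ) * Complex.I ^ n := by
      rw [mul_pow, ← Complex.ofReal_pow, ← Real.exp_nat_mul]
      push_cast
      ring_nf
    rw [hg]
    simp only
    rw [this, Complex.im_ofReal_mul]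
  have h0 : HasSum (fun j : ℕ => g (2 * j)) 0 := by
    refine hasSum_zero.congr_fun fun j => ?_
    rw [hpow, pow_mul, Complex.I_sq]
    have : ((-1 : ℂ) ^ j).im = 0 := by
      rcases neg_one_pow_eq_or ℂ j with h | h <;> simp [h]
    rw [this, mul_zero]
  have h1 : HasSum (fun j : ℕ => g (2 * j + 1))
      (∑' j : ℕ, (-1) ^ j * ((2 * j + 1) * exp (-(2 * j + 1) * (π * y / 2)))) := by
    have hodd : Summable fun j : ℕ =>
        (-1 : ℝ) ^ j * ((2 * j + 1) * exp (-(2 * j + 1) * (π * y / 2))) := by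
      refine Summable.of_norm ((summable_odd_mul_exp_neg
        (by positivity : 0 < π * y / 2) 1).congr fun j => ?_)
      rw [Real.norm_eq_abs, abs_mul, abs_neg_one_pow, one_mul, pow_one,
        abs_of_pos (by positivity)]
    refine hodd.hasSum.congr_fun fun j => ?_
    rw [hpow, pow_succ, pow_mul, Complex.I_sq]
    have : ((-1 : ℂ) ^ j * Complex.I).im = (-1) ^ j := by
      rcases Nat.even_or_odd j with h | h <;> simp [h.neg_one_pow]
    rw [this]
    push_cast
    ring
  rw [(h0.even_add_odd h1).tsum_eq, zero_add] at him
  rw [div_mul_eq_mul_div, eq_div_iff (by positivity)]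
  linear_combination -him / 4

theorem one_le_abs_four_mul_add_one (k : ℤ) : 1 ≤ |(4 * k + 1 : ℝ)| := by
  have : (1 : ℤ) ≤ |4 * k + 1| := Int.one_le_abs (by omega)
  exact_mod_cast this

theorem summable_lattice_abs : Summable fun p : ℤ × ℤ =>
    |(4 * p.2 + 1 : ℝ)| / ((4 * p.1 + 1) ^ 2 + 2 * (4 * p.2 + 1) ^ 2) ^ 2 := by
  have h := (Real.summable_abs_int_rpow (by norm_num : (1 : ℝ) < 3 / 2)).comp_injective
    (i := fun k : ℤ => 4 * k + 1) fun a b h => by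
      simp only at h
      omega
  have h2 := h.mul_of_nonneg h (fun _ => by simp only [Function.comp_apply]; positivity)
    fun _ => by simp only [Function.comp_apply]; positivity
  refine Summable.of_nonneg_of_le (fun p => by positivity) (fun p => ?_) h2
  have ha := one_le_abs_four_mul_add_one p.1
  have hb := one_le_abs_four_mul_add_one p.2
  simp only [Function.comp_apply]
  push_cast
  rw [← sq_abs (4 * (p.1 : ℝ) + 1), ← sq_abs (4 * (p.2 : ℝ) + 1)]
  generalize |4 * (p.1 : ℝ) + 1| = a at *
  generalize |4 * (p.2 : ℝ) + 1| = b at *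
  have ha0 : 0 < a := by linarith
  have hb0 : 0 < b := by linarith
  set R := a ^ 2 + 2 * b ^ 2 with hR
  have hR0 : 0 < R := by positivity
  rw [rpow_neg ha0.le, rpow_neg hb0.le, ← mul_inv, ← one_div, div_le_div_iff₀ (by positivity)
    (by positivity), one_mul]
  have e1 : a ^ (3 / 2 : ℝ) ≤ R ^ (3 / 4 : ℝ) := by
    rw [show a ^ (3 / 2 : ℝ) = (a ^ 2) ^ (3 / 4 : ℝ) by
      rw [← rpow_natCast, ← rpow_mul ha0.le]
      norm_num]
    gcongr
    rw [hR]
    nlinarith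
  have e2 : b ^ (3 / 2 : ℝ) ≤ R ^ (3 / 4 : ℝ) := by
    rw [show b ^ (3 / 2 : ℝ) = (b ^ 2) ^ (3 / 4 : ℝ) by
      rw [← rpow_natCast, ← rpow_mul hb0.le]
      norm_num]
    gcongr
    rw [hR]
    nlinarith
  have e3 : b ≤ R ^ (1 / 2 : ℝ) := by
    rw [← Real.sqrt_eq_rpow]
    apply Real.le_sqrt_of_sq_le
    rw [hR]
    nlinarith
  calc b * (a ^ (3 / 2 : ℝ) * b ^ (3 / 2 : ℝ))
      ≤ R ^ (1 / 2 : ℝ) * (R ^ (3 / 4 : ℝ) * R ^ (3 / 4 : ℝ)) := by gcongr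
    _ = R ^ 2 := by
      rw [← rpow_add hR0, ← rpow_add hR0, ← rpow_natCast]
      norm_num

open MeasureTheory in
theorem integral_etaTheta : ∫ t in Set.Ioi (0 : ℝ), t * (etaTheta (1 * t) *
      etaTheta (2 * t) * etaTheta (2 * t) * etaTheta (4 * t)) =
    1 / 9 * ∑' p : ℤ × ℤ,
      (-1) ^ p.1 * ((4 * p.2 + 1 : ℝ) / ((4 * p.1 + 1) ^ 2 + 2 * (4 * p.2 + 1) ^ 2) ^ 2) := by
  set Q : ℤ × ℤ → ℝ := fun p => 3 * (4 * p.1 + 1) ^ 2 + 6 * (4 * p.2 + 1) ^ 2 with hQ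
  have hQp : ∀ p, 0 < Q p := fun p => by
    have h1 := one_le_abs_four_mul_add_one p.1
    have : (4 * (p.1 : ℝ) + 1) ≠ 0 := abs_pos.mp (by linarith)
    positivity
  set F : ℤ × ℤ → ℝ → ℝ := fun p t => ((-1) ^ p.1 * (4 * p.2 + 1)) * (t * exp (-Q p * t)) with hF
  have hFi : ∀ p, IntegrableOn (F p) (Set.Ioi 0) := fun p =>
    (integrableOn_mul_exp_neg (hQp p)).const_mul _
  have hFn : ∀ p, ∫ t in Set.Ioi (0 : ℝ), ‖F p t‖ = 1 / 9 * (|(4 * p.2 + 1 : ℝ)| /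
      ((4 * p.1 + 1) ^ 2 + 2 * (4 * p.2 + 1) ^ 2) ^ 2) := fun p => by
    have e : ∀ t ∈ Set.Ioi (0 : ℝ), ‖F p t‖ = |(4 * p.2 + 1 : ℝ)| * (t * exp (-Q p * t)) := by
      intro t ht
      have ht : 0 < t := ht
      rw [hF, Real.norm_eq_abs, abs_mul, abs_mul, abs_neg_one_zpow, one_mul,
        abs_of_pos (a := t * exp (-Q p * t)) (by positivity)]
    rw [setIntegral_congr_fun measurableSet_Ioi e, integral_const_mul,
      integral_mul_exp_neg (hQp p)]
    have : Q p = 3 * ((4 * p.1 + 1) ^ 2 + 2 * (4 * p.2 + 1) ^ 2) := by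
      rw [hQ]
      ring
    rw [this]
    generalize (4 * (p.1 : ℝ) + 1) ^ 2 + 2 * (4 * p.2 + 1) ^ 2 = X
    ring
  have hFs : Summable fun p => ∫ t in Set.Ioi (0 : ℝ), ‖F p t‖ := by
    simp only [hFn]
    exact summable_lattice_abs.mul_left _
  have h := hasSum_integral_of_summable_integral_norm hFi hFs
  have hL : ∫ t in Set.Ioi (0 : ℝ), t * (etaTheta (1 * t) *
      etaTheta (2 * t) * etaTheta (2 * t) * etaTheta (4 * t)) =
      ∫ t in Set.Ioi (0 : ℝ), ∑' p, F p t := by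
    refine setIntegral_congr_fun measurableSet_Ioi fun t ht => ?_
    have ht : 0 < t := ht
    have s1 : Summable fun k : ℤ => (-1 : ℝ) ^ k * exp (-3 * (4 * k + 1) ^ 2 * t) := by
      refine Summable.of_norm ((summable_pow_mul_exp_neg_sq 0 (1 / 4)
        (by positivity : 0 < 48 * t)).congr fun n => ?_)
      rw [Real.norm_eq_abs, abs_mul, abs_neg_one_zpow, one_mul, abs_of_pos (exp_pos _), pow_zero,
        one_mul]
      ring_nf
    have s2 : Summable fun l : ℤ => (4 * l + 1 : ℝ) * exp (-6 * (4 * l + 1) ^ 2 * t) := by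
      have a0 := summable_pow_mul_exp_neg_sq 0 (1 / 4) (by positivity : 0 < 96 * t)
      have a1 := summable_pow_mul_exp_neg_sq 1 (1 / 4) (by positivity : 0 < 96 * t)
      refine Summable.of_norm_bounded ((a1.mul_left 4).add a0) fun n => ?_
      rw [Real.norm_eq_abs, abs_mul, abs_of_pos (exp_pos _), pow_zero, pow_one,
        show -6 * (4 * (n : ℝ) + 1) ^ 2 * t = -(n + 1 / 4) ^ 2 * (96 * t) by ring,
        ← mul_assoc 4, ← add_mul]
      gcongr
      calc |4 * (n : ℝ) + 1| ≤ |4 * (n : ℝ)| + |1| := abs_add_le _ _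
        _ = _ := by rw [abs_mul]; norm_num
    simp only [one_mul]
    rw [etaTheta_mul ht, tsum_mul_tsum_of_summable_norm s1.norm s2.norm, ← tsum_mul_left]
    refine tsum_congr fun p => ?_
    have x : exp (-Q p * t) =
        exp (-3 * (4 * p.1 + 1) ^ 2 * t) * exp (-6 * (4 * p.2 + 1) ^ 2 * t) := by
      rw [← Real.exp_add, hQ]
      ring_nf
    rw [hF]
    simp only [x]
    ring
  rw [hL, ← h.tsum_eq, ← tsum_mul_left]
  refine tsum_congr fun p => ?_
  rw [hF]
  simp only
  rw [integral_const_mul, integral_mul_exp_neg (hQp p)]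
  have : Q p = 3 * ((4 * p.1 + 1) ^ 2 + 2 * (4 * p.2 + 1) ^ 2) := by
    rw [hQ]
    ring
  rw [this]
  generalize (4 * (p.1 : ℝ) + 1) ^ 2 + 2 * (4 * p.2 + 1) ^ 2 = X
  ring

theorem tsum_lattice : ∑' p : ℤ × ℤ,
      (-1) ^ p.1 * ((4 * p.2 + 1 : ℝ) / ((4 * p.1 + 1) ^ 2 + 2 * (4 * p.2 + 1) ^ 2) ^ 2) =
    √2 * π ^ 2 / 32 * ∑' k : ℤ, ∑' j : ℕ, (-1 : ℝ) ^ k * ((-1) ^ j * ((2 * j + 1) /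
      |(4 * k + 1 : ℝ)| * exp (-((2 * j + 1) * |(4 * k + 1 : ℝ)|) * (π / (2 * √2))))) := by
  have hs : Summable fun p : ℤ × ℤ =>
      (-1) ^ p.1 * ((4 * p.2 + 1 : ℝ) / ((4 * p.1 + 1) ^ 2 + 2 * (4 * p.2 + 1) ^ 2) ^ 2) := by
    refine Summable.of_norm (summable_lattice_abs.congr fun p => ?_)
    rw [Real.norm_eq_abs, abs_mul, abs_neg_one_zpow, one_mul, abs_div, abs_of_nonneg
      (a := ((4 * (p.1 : ℝ) + 1) ^ 2 + 2 * (4 * p.2 + 1) ^ 2) ^ 2) (by positivity)]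
  rw [hs.tsum_prod, ← tsum_mul_left]
  refine tsum_congr fun k => ?_
  have hk := one_le_abs_four_mul_add_one k
  have hsq := sq_abs (4 * (k : ℝ) + 1)
  simp only [tsum_mul_left, ← hsq]
  generalize |4 * (k : ℝ) + 1| = m at *
  have hm : 0 < m := by linarith
  have h2 : √2 ^ 2 = (2 : ℝ) := Real.sq_sqrt (by norm_num)
  have h := tsum_div_sq_add_sq (by positivity : 0 < m / √2)
  have e : ∀ l : ℤ, (4 * l + 1 : ℝ) / (m ^ 2 + 2 * (4 * l + 1) ^ 2) ^ 2 =
      1 / 4 * ((4 * l + 1) / ((4 * l + 1) ^ 2 + (m / √2) ^ 2) ^ 2) := fun l => by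
    rw [div_pow, h2]
    field_simp
    ring
  simp only [e, tsum_mul_left, h]
  have e2 : ∀ j : ℕ, (-1 : ℝ) ^ j * ((2 * j + 1) / m *
      exp (-((2 * j + 1) * m) * (π / (2 * √2)))) =
      1 / m * ((-1) ^ j * ((2 * j + 1) * exp (-(2 * j + 1) * (π * (m / √2) / 2)))) := fun j => by
    rw [show -((2 * (j : ℝ) + 1) * m) * (π / (2 * √2)) =
      -(2 * j + 1) * (π * (m / √2) / 2) by ring]
    ring
  simp only [e2, tsum_mul_left]
  have h3 : √2 ≠ 0 := by positivity
  generalize ∑' j : ℕ, (-1 : ℝ) ^ j * ((2 * j + 1) * exp (-(2 * j + 1) * (π * (m / √2) / 2))) = T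
  field_simp
  ring

theorem summable_exp_neg_abs_four_mul_add_one {x : ℝ} (hx : 0 < x) :
    Summable fun k : ℤ => exp (-|(4 * k + 1 : ℝ)| * x) := by
  have h := (summable_int_pow_mul_exp_neg 0 hx).comp_injective
    (i := fun k : ℤ => 4 * k + 1) fun a b h => by
      simp only at h
      omega
  refine h.congr fun k => ?_
  simp only [Function.comp_apply, pow_zero, one_mul]
  push_cast
  ring_nf

theorem tsum_neg_one_mul_exp_neg_abs {x : ℝ} (hx : 0 < x) :
    ∑' k : ℤ, (-1 : ℝ) ^ k * exp (-|(4 * k + 1 : ℝ)| * x) = sinh x / cosh (2 * x) := by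
  have hr : ‖-exp (-4 * x)‖ < 1 := by
    rw [norm_neg, Real.norm_eq_abs, abs_of_pos (exp_pos _), exp_lt_one_iff]
    linarith
  have hg := hasSum_geometric_of_norm_lt_one hr
  have hpow : ∀ n : ℕ, (-exp (-4 * x)) ^ n = (-1) ^ n * exp (-(4 * n) * x) := fun n => by
    rw [neg_pow, ← Real.exp_nat_mul]
    ring_nf
  have h1 : HasSum (fun n : ℕ => (-1 : ℝ) ^ (n : ℤ) * exp (-|(4 * (n : ℤ) + 1 : ℝ)| * x))
      (exp (-x) * (1 - -exp (-4 * x))⁻¹) := by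
    refine (hg.mul_left (exp (-x))).congr_fun fun n => ?_
    rw [hpow, zpow_natCast, mul_left_comm, ← Real.exp_add, Int.cast_natCast,
      abs_of_pos (by positivity)]
    ring_nf
  have h2 : HasSum (fun n : ℕ => (-1 : ℝ) ^ (-((n : ℤ) + 1)) *
      exp (-|(4 * (-((n : ℤ) + 1) : ℤ) + 1 : ℝ)| * x))
      (-exp (-3 * x) * (1 - -exp (-4 * x))⁻¹) := by
    refine (hg.mul_left (-exp (-3 * x))).congr_fun fun n => ?_
    have e1 : (-1 : ℝ) ^ (-((n : ℤ) + 1)) = -(-1) ^ n := by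
      rw [zpow_neg, zpow_add_one₀ (by norm_num), zpow_natCast, mul_neg_one, inv_neg, ← inv_pow]
      norm_num
    have e2 : |(4 * (-((n : ℤ) + 1) : ℤ) + 1 : ℝ)| = 4 * n + 3 := by
      push_cast
      rw [abs_of_neg (by linarith [(n.cast_nonneg : (0 : ℝ) ≤ n)])]
      ring
    have e3 : exp (-(4 * (n : ℝ) + 3) * x) = exp (-3 * x) * exp (-(4 * n) * x) := by
      rw [← Real.exp_add]
      ring_nf
    rw [hpow, e1, e2, e3]
    ring
  have h := (HasSum.of_nat_of_neg_add_one
    (f := fun k : ℤ => (-1 : ℝ) ^ k * exp (-|(4 * k + 1 : ℝ)| * x)) h1 h2).tsum_eq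
  rw [h, sinh_eq, cosh_eq]
  have e1 : exp (-x) = (exp x)⁻¹ := Real.exp_neg x
  have e2 : exp (2 * x) = exp x ^ 2 := by
    rw [← Real.exp_nat_mul]
    norm_num
  have e3 : exp (-3 * x) = (exp x ^ 3)⁻¹ := by
    rw [← Real.exp_nat_mul, ← Real.exp_neg]
    norm_num
  have e4 : exp (-4 * x) = (exp x ^ 4)⁻¹ := by
    rw [← Real.exp_nat_mul, ← Real.exp_neg]
    norm_num
  rw [Real.exp_neg (2 * x), e1, e2, e3, e4]
  have := exp_pos x
  generalize exp x = w at *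
  have h3 : (1 - -(w ^ 4)⁻¹)⁻¹ = w ^ 4 / (w ^ 4 + 1) := by
    rw [sub_neg_eq_add]
    field_simp
  rw [h3]
  field_simp
  ring

theorem summable_odd_pow_mul_exp_neg {t : ℝ} (ht : 0 < t) (k : ℕ) : Summable fun p : ℕ × ℤ =>
    (2 * p.1 + 1 : ℝ) ^ k * exp (-((2 * p.1 + 1) * |(4 * p.2 + 1 : ℝ)|) * t) := by
  have h := (summable_odd_mul_exp_neg (half_pos ht) k).mul_of_nonneg
    (summable_exp_neg_abs_four_mul_add_one (half_pos ht)) (fun _ => by positivity)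
    fun _ => by positivity
  refine Summable.of_nonneg_of_le (fun p => by positivity) (fun p => ?_) h
  rw [mul_assoc, ← Real.exp_add]
  gcongr
  have h1 := one_le_abs_four_mul_add_one p.2
  have h2 : (0 : ℝ) ≤ p.1 := p.1.cast_nonneg
  generalize |4 * (p.2 : ℝ) + 1| = m at *
  nlinarith [mul_nonneg h2 (sub_nonneg.mpr h1), mul_nonneg ht.le h2,
    mul_nonneg ht.le (mul_nonneg h2 (sub_nonneg.mpr h1)), mul_nonneg ht.le (sub_nonneg.mpr h1)]

open MeasureTheory in
theorem tsum_eq_integral_sinh_div_cosh {t₀ : ℝ} (ht₀ : 0 < t₀) :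
    ∑' k : ℤ, ∑' j : ℕ, (-1 : ℝ) ^ k * ((-1) ^ j * ((2 * j + 1) /
      |(4 * k + 1 : ℝ)| * exp (-((2 * j + 1) * |(4 * k + 1 : ℝ)|) * t₀))) =
    ∫ t in Set.Ioi t₀, ∑' n : ℕ, (-1 : ℝ) ^ n *
      ((2 * n + 1) ^ 2 * (sinh ((2 * n + 1) * t) / cosh (2 * ((2 * n + 1) * t)))) := by
  set Q : ℕ × ℤ → ℝ := fun p => (2 * p.1 + 1) * |(4 * p.2 + 1 : ℝ)| with hQ
  have hm : ∀ k : ℤ, 0 < |(4 * k + 1 : ℝ)| := fun k => by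
    linarith [one_le_abs_four_mul_add_one k]
  have hQp : ∀ p, -Q p < 0 := fun p => by
    have := hm p.2
    rw [neg_lt_zero]
    positivity
  set F : ℕ × ℤ → ℝ → ℝ := fun p t =>
    ((-1) ^ p.2 * ((-1) ^ p.1 * (2 * p.1 + 1) ^ 2)) * exp (-Q p * t) with hF
  have hFi : ∀ p, IntegrableOn (F p) (Set.Ioi t₀) := fun p =>
    (integrableOn_exp_mul_Ioi (hQp p) t₀).const_mul _
  have hval : ∀ p : ℕ × ℤ, (2 * p.1 + 1 : ℝ) ^ 2 * (-exp (-Q p * t₀) / -Q p) =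
      (2 * p.1 + 1) / |(4 * p.2 + 1 : ℝ)| * exp (-Q p * t₀) := fun p => by
    have := hm p.2
    rw [neg_div_neg_eq]
    generalize exp (-Q p * t₀) = E
    rw [hQ]
    field_simp
  have hFn : ∀ p, ∫ t in Set.Ioi t₀, ‖F p t‖ =
      (2 * p.1 + 1) / |(4 * p.2 + 1 : ℝ)| * exp (-Q p * t₀) := fun p => by
    have e : ∀ t, ‖F p t‖ = (2 * p.1 + 1 : ℝ) ^ 2 * exp (-Q p * t) := fun t => by
      rw [hF, Real.norm_eq_abs, abs_mul, abs_mul, abs_mul, abs_neg_one_zpow, abs_neg_one_pow,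
        one_mul, one_mul, abs_of_pos (exp_pos _), abs_of_pos (by positivity)]
    simp only [e]
    rw [integral_const_mul, integral_exp_mul_Ioi (hQp p), hval]
  have hFs : Summable fun p => ∫ t in Set.Ioi t₀, ‖F p t‖ := by
    simp only [hFn]
    refine Summable.of_nonneg_of_le (fun p => by positivity) (fun p => ?_)
      (summable_odd_pow_mul_exp_neg ht₀ 1)
    rw [pow_one]
    gcongr
    exact div_le_self (by positivity) (one_le_abs_four_mul_add_one p.2)
  have h := hasSum_integral_of_summable_integral_norm hFi hFs
  have hR : ∫ t in Set.Ioi t₀, ∑' p, F p t = ∫ t in Set.Ioi t₀, ∑' n : ℕ, (-1 : ℝ) ^ n *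
      ((2 * n + 1) ^ 2 * (sinh ((2 * n + 1) * t) / cosh (2 * ((2 * n + 1) * t)))) := by
    refine setIntegral_congr_fun measurableSet_Ioi fun t ht => ?_
    have ht : 0 < t := ht₀.trans ht
    have hs : Summable fun p => F p t := by
      refine Summable.of_norm ((summable_odd_pow_mul_exp_neg ht 2).congr fun p => ?_)
      rw [hF, Real.norm_eq_abs, abs_mul, abs_mul, abs_mul, abs_neg_one_zpow, abs_neg_one_pow,
        one_mul, one_mul, abs_of_pos (exp_pos _),
        abs_of_pos (by positivity : (0 : ℝ) < (2 * (p.1 : ℝ) + 1) ^ 2)]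
    rw [hs.tsum_prod]
    refine tsum_congr fun n => ?_
    rw [← tsum_neg_one_mul_exp_neg_abs (by positivity : 0 < (2 * n + 1) * t), ← mul_assoc,
      ← tsum_mul_left]
    refine tsum_congr fun k => ?_
    rw [hF, hQ]
    simp only
    rw [show -((2 * (n : ℝ) + 1) * |4 * (k : ℝ) + 1|) * t =
      -|4 * (k : ℝ) + 1| * ((2 * n + 1) * t) by ring]
    ring
  have hterm : ∀ p, ∫ t in Set.Ioi t₀, F p t = (-1 : ℝ) ^ p.2 * ((-1) ^ p.1 * ((2 * p.1 + 1) /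
      |(4 * p.2 + 1 : ℝ)| * exp (-Q p * t₀))) := fun p => by
    rw [hF]
    simp only
    rw [integral_const_mul, integral_exp_mul_Ioi (hQp p), ← hval]
    ring
  rw [← hR]
  simp only [hterm] at h
  have h2 := (Equiv.prodComm ℤ ℕ).hasSum_iff.mpr h
  rw [← h2.tsum_eq, h2.summable.tsum_prod]
  rfl

theorem compModulus_pi_div_sqrt_two : compModulus (π / √2) = √2 - 1 := by
  have hx : 0 < π / √2 := by positivity
  have h1 := theta3_pi_div_sqrt_two
  have h2 := theta3_two_mul_sq hx
  have h3 := theta3_pos hx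
  have h4 : √2 * √2 = (2 : ℝ) := Real.mul_self_sqrt (by norm_num)
  rw [compModulus, div_eq_iff (by positivity)]
  linear_combination (-√2) * h1 - 2 * h2 - theta3 (2 * (π / √2)) ^ 2 * h4

theorem strictMonoOn_compModulus : StrictMonoOn compModulus (Set.Ioi 0) := by
  refine strictMonoOn_of_deriv_pos (convex_Ioi 0)
    (fun x hx => (hasDerivAt_compModulus hx).continuousAt.continuousWithinAt) fun x hx => ?_
  rw [interior_Ioi] at hx
  have hx : 0 < x := hx
  rw [(hasDerivAt_compModulus hx).deriv]
  have := compModulus_pos hx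
  have := theta2_pos hx
  positivity

theorem image_compModulus_Ioi {x : ℝ} (hx : 0 < x) :
    compModulus '' Set.Ioi x = Set.Ioo (compModulus x) 1 := by
  apply Set.Subset.antisymm
  · rintro _ ⟨y, hy, rfl⟩
    exact ⟨strictMonoOn_compModulus hx (hx.trans hy) hy, compModulus_lt_one (hx.trans hy)⟩
  · intro w hw
    obtain ⟨y, hy1, hy2⟩ := ((tendsto_compModulus.eventually_const_lt hw.2).and
      (eventually_gt_atTop x)).exists
    have hc : ContinuousOn compModulus (Set.Icc x y) := fun z hz =>
      (hasDerivAt_compModulus (hx.trans_le hz.1)).continuousAt.continuousWithinAt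
    obtain ⟨z, hz, rfl⟩ := intermediate_value_Ioo hy2.le hc ⟨hw.1, hy1⟩
    exact ⟨z, hz.1, rfl⟩

theorem integrand_compModulus {x : ℝ} (hx : 0 < x) :
    compModulus x * theta2 x ^ 4 * ((3 * compModulus x - 1) /
      √(compModulus x * (1 - compModulus x)) * hyp2F1half (1 - compModulus x ^ 2)) =
    4 * √2 * (theta2 (2 * x) * theta4 x * theta3 (2 * x) ^ 2 *
      (theta3 (2 * x) ^ 2 - 2 * theta2 (2 * x) ^ 2)) := by
  rw [hyp2F1half_eq_theta3_sq hx]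
  have h2 := theta2_sq hx
  have h3 := theta3_sq hx
  have h4 := theta4_sq hx
  have p3 := theta3_pos hx
  have p4 := theta4_pos hx
  have pb := theta2_pos (by positivity : 0 < 2 * x)
  have pa := theta3_pos (by positivity : 0 < 2 * x)
  have hs2 : √2 * √2 = (2 : ℝ) := Real.mul_self_sqrt (by norm_num)
  have hs0 : 0 < √(2 : ℝ) := by positivity
  have hsq : √(compModulus x * (1 - compModulus x)) =
      √2 * theta4 x * theta2 (2 * x) / theta3 x ^ 2 := by
    rw [Real.sqrt_eq_iff_mul_self_eq_of_pos (by positivity), compModulus]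
    field_simp
    linear_combination theta2 (2 * x) ^ 2 * hs2 - h3 + h4
  rw [hsq, compModulus, show theta2 x ^ 4 = (theta2 x ^ 2) ^ 2 by ring, h2]
  field_simp
  linear_combination 12 * h4 - 4 * h3 -
    4 * (theta3 (2 * x) ^ 2 - 2 * theta2 (2 * x) ^ 2) * hs2

open MeasureTheory in
theorem integral_hyp2F1half_eq_integral_tsum :
    ∫ u in (√2 - 1)..1, (3 * u - 1) / √(u * (1 - u)) * hyp2F1half (1 - u ^ 2) =
    8 * √2 * ∫ t in Set.Ioi (π / (2 * √2)), ∑' n : ℕ, (-1 : ℝ) ^ n *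
      ((2 * n + 1) ^ 2 * (sinh ((2 * n + 1) * t) / cosh (2 * ((2 * n + 1) * t)))) := by
  have hpos : 0 < π / √2 := by positivity
  have hle : √2 - 1 ≤ 1 := by
    rw [← compModulus_pi_div_sqrt_two]
    exact (compModulus_lt_one hpos).le
  have hderiv : ∀ x ∈ Set.Ioi (π / √2),
      HasDerivWithinAt compModulus (compModulus x * theta2 x ^ 4 / 2) (Set.Ioi (π / √2)) x :=
    fun x hx => (hasDerivAt_compModulus (hpos.trans hx)).hasDerivWithinAt
  have hinj : Set.InjOn compModulus (Set.Ioi (π / √2)) :=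
    (strictMonoOn_compModulus.mono (Set.Ioi_subset_Ioi hpos.le)).injOn
  rw [intervalIntegral.integral_of_le hle, integral_Ioc_eq_integral_Ioo,
    ← compModulus_pi_div_sqrt_two, ← image_compModulus_Ioi hpos,
    integral_image_eq_integral_abs_deriv_smul measurableSet_Ioi hderiv hinj,
    show π / √2 = 2 * (π / (2 * √2)) by field_simp,
    ← integral_comp_mul_left_Ioi' _ _ two_pos, smul_eq_mul, ← integral_const_mul,
    ← integral_const_mul]
  refine setIntegral_congr_fun measurableSet_Ioi fun t ht => ?_
  have ht : 0 < t := lt_trans (by positivity) ht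
  have ht2 : 0 < 2 * t := by positivity
  have h1 := integrand_compModulus ht2
  have h2 := tsum_alt_sq_mul_sinh_div_cosh ht
  have hc := compModulus_pos ht2
  rw [show 2 * (2 * t) = 4 * t by ring, ← h2] at h1
  rw [smul_eq_mul, abs_of_nonneg (by positivity)]
  linear_combination h1

/-- The box limit defining `F(2,2) = F(1,2,2,4)` exists and
`(256/(9π²)) F(2,2) = ∫_{√2-1}^1 (3u-1)/√(u(1-u)) · ₂F₁(1/2,1/2;1;1-u²) du`. -/
theorem stmt_14 :
    ∃ L : ℝ, Tendsto (fun v => (1+2+2+4:ℝ)^2 * boxSum 1 2 2 4 v) atTop (𝓝 L) ∧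
      256/(9*π^2) * L =
        ∫ u in (Real.sqrt 2 - 1)..1, (3*u-1)/Real.sqrt (u*(1-u)) * hyp2F1half (1-u^2) := by
  refine ⟨_, (tendsto_boxSum one_pos two_pos two_pos four_pos).const_mul _, ?_⟩
  rw [integral_etaTheta, tsum_lattice, tsum_eq_integral_sinh_div_cosh (by positivity),
    integral_hyp2F1half_eq_integral_tsum]
  have := pi_ne_zero
  field_simp
  ring
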